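/- There exist constants c > 0 and d₀ such that for all integers d ≥ d₀, | |F| − 2e·2^{2^{d−1}} | ≤ e^{−cd}·2^{2^{d−1}}. -/

import Mathlib

/-- Two vertices of the Hamming cube `{0,1}^d` are adjacent iff they differ in
exactly one coordinate. -/
def cubeAdj (d : ℕ) (u v : Fin d → Bool) : Prop :=
  (Finset.univ.filter fun i => u i ≠ v i).card = 1


/-- The set of homomorphisms from `Q_d` to `ℤ` sending the all-zeros vertex to `0`. -/
def HomF (d : ℕ) : Set ((Fin d → Bool) → ℤ) :=
  {f | f (fun _ => false) = 0 ∧ ∀ u v, cubeAdj d u v → |f u - f v| = 1}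

section

/-- Hölder's inequality for `q` functions with equal exponents, over a uniform measure. -/
theorem holder_uniform {C U : Type*} [Fintype C] [Nonempty C] (s : Finset U) (hs : s.Nonempty)
    (ψ : U → C → ℝ) (hψ : ∀ u c, 0 ≤ ψ u c) :
    (∑ c, ∏ u ∈ s, ψ u c ^ ((s.card : ℝ)⁻¹)) / Fintype.card C ≤
      ∏ u ∈ s, ((∑ c, ψ u c) / Fintype.card C) ^ ((s.card : ℝ)⁻¹) := by
  have hC : (0 : ℝ) < Fintype.card C := by exact_mod_cast Fintype.card_pos
  have hq : (0 : ℝ) < s.card := by exact_mod_cast hs.card_pos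
  by_cases hz : ∃ u ∈ s, ∑ c, ψ u c = 0
  · obtain ⟨u, hu, h0⟩ := hz
    have h1 : ∀ c, ψ u c = 0 := fun c =>
      (Finset.sum_eq_zero_iff_of_nonneg (fun c _ => hψ u c)).1 h0 c (Finset.mem_univ _)
    have h2 : ∀ c, ∏ u ∈ s, ψ u c ^ ((s.card : ℝ)⁻¹) = 0 := fun c =>
      Finset.prod_eq_zero hu (by rw [h1, Real.zero_rpow (by positivity)])
    simp only [h2, Finset.sum_const_zero, zero_div]
    exact Finset.prod_nonneg fun u _ => Real.rpow_nonneg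
      (div_nonneg (Finset.sum_nonneg fun c _ => hψ u c) hC.le) _
  · push Not at hz
    set S : U → ℝ := fun u => (∑ c, ψ u c) / Fintype.card C with hS
    have hSpos : ∀ u ∈ s, 0 < S u := fun u hu =>
      div_pos (lt_of_le_of_ne (Finset.sum_nonneg fun c _ => hψ u c) (Ne.symm (hz u hu))) hC
    have hP : 0 < ∏ u ∈ s, S u ^ ((s.card : ℝ)⁻¹) :=
      Finset.prod_pos fun u hu => Real.rpow_pos_of_pos (hSpos u hu) _
    have key : ∀ c, ∏ u ∈ s, ψ u c ^ ((s.card : ℝ)⁻¹) ≤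
        (∏ u ∈ s, S u ^ ((s.card : ℝ)⁻¹)) * ∑ u ∈ s, (s.card : ℝ)⁻¹ * (ψ u c / S u) := by
      intro c
      have h := Real.geom_mean_le_arith_mean_weighted s (fun _ => (s.card : ℝ)⁻¹)
        (fun u => ψ u c / S u) (fun _ _ => by positivity)
        (by rw [Finset.sum_const, nsmul_eq_mul, mul_inv_cancel₀ hq.ne'])
        (fun u hu => div_nonneg (hψ u c) (hSpos u hu).le)
      have h3 : ∏ u ∈ s, ψ u c ^ ((s.card : ℝ)⁻¹) = (∏ u ∈ s, S u ^ ((s.card : ℝ)⁻¹)) *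
          ∏ u ∈ s, (ψ u c / S u) ^ ((s.card : ℝ)⁻¹) := by
        rw [← Finset.prod_mul_distrib]
        refine Finset.prod_congr rfl fun u hu => ?_
        rw [← Real.mul_rpow (hSpos u hu).le (div_nonneg (hψ u c) (hSpos u hu).le),
          mul_div_cancel₀ _ (hSpos u hu).ne']
      rw [h3]
      exact mul_le_mul_of_nonneg_left h hP.le
    rw [div_le_iff₀ hC]
    refine (Finset.sum_le_sum fun c _ => key c).trans (le_of_eq ?_)
    rw [← Finset.mul_sum, Finset.sum_comm]
    congr 1
    have : ∀ u ∈ s, ∑ c, (s.card : ℝ)⁻¹ * (ψ u c / S u) = (s.card : ℝ)⁻¹ * Fintype.card C := by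
      intro u hu
      rw [← Finset.mul_sum, ← Finset.sum_div]
      congr 1
      rw [div_eq_iff (hSpos u hu).ne', hS]
      field_simp
    rw [Finset.sum_congr rfl this, Finset.sum_const, nsmul_eq_mul]
    field_simp

/-- Finner's inequality: if every coordinate belongs to exactly `q` of the sets `W u` and `φ u`
depends only on the coordinates in `W u`, then the average of `∏ u, φ u` is at most the product
of the `L^q` norms. -/
theorem finner_fin {C U : Type*} [Fintype C] [Nonempty C] [Fintype U] (q : ℕ) (hq : 0 < q) :
    ∀ (n : ℕ) (W : U → Fin n → Prop) (φ : U → (Fin n → C) → ℝ), (∀ u χ, 0 ≤ φ u χ) →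
      (∀ u χ χ', (∀ e, W u e → χ e = χ' e) → φ u χ = φ u χ') →
      (∀ e, Nat.card {u // W u e} = q) →
      (∑ χ, ∏ u, φ u χ) / (Fintype.card C : ℝ) ^ n ≤
        ∏ u, ((∑ χ, φ u χ ^ q) / (Fintype.card C : ℝ) ^ n) ^ ((q : ℝ)⁻¹) := by
  classical
  have hC : (0 : ℝ) < Fintype.card C := by exact_mod_cast Fintype.card_pos
  intro n
  induction n with
  | zero =>
    intro W φ h0 _ _
    simp only [Fintype.sum_unique, pow_zero, div_one]
    refine (Finset.prod_congr rfl fun u _ => ?_).le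
    rw [Real.pow_rpow_inv_natCast (h0 _ _) hq.ne']
  | succ n ih =>
    intro W φ h0 hdep hcov
    have hsum : ∀ F : (Fin (n + 1) → C) → ℝ, (∑ χ, F χ) / (Fintype.card C : ℝ) ^ (n + 1) =
        (∑ c, (∑ χ : Fin n → C, F (Fin.cons c χ)) / (Fintype.card C : ℝ) ^ n) /
          Fintype.card C := by
      intro F
      rw [← (Fin.consEquiv (fun _ : Fin (n + 1) => C)).sum_comp, Fintype.sum_prod_type,
        ← Finset.sum_div, div_div, pow_succ]
      rfl
    rw [hsum]
    set ψ : U → C → ℝ := fun u c =>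
      (∑ χ : Fin n → C, φ u (Fin.cons c χ) ^ q) / (Fintype.card C : ℝ) ^ n with hψ
    have hψ0 : ∀ u c, 0 ≤ ψ u c := fun u c =>
      div_nonneg (Finset.sum_nonneg fun χ _ => pow_nonneg (h0 _ _) _) (by positivity)
    have h1 : ∀ c, (∑ χ : Fin n → C, ∏ u, φ u (Fin.cons c χ)) / (Fintype.card C : ℝ) ^ n ≤
        ∏ u, ψ u c ^ ((q : ℝ)⁻¹) := by
      intro c
      refine ih (fun u e => W u e.succ) (fun u χ => φ u (Fin.cons c χ)) (fun _ _ => h0 _ _) ?_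
        (fun e => hcov e.succ)
      intro u χ χ' h
      refine hdep _ _ _ fun e => ?_
      refine Fin.cases (fun _ => by simp) (fun i hi => by simpa using h i hi) e
    refine (div_le_div_of_nonneg_right (Finset.sum_le_sum fun c _ => h1 c) hC.le).trans ?_
    have h2 : ∀ u, ((∑ χ, φ u χ ^ q) / (Fintype.card C : ℝ) ^ (n + 1)) =
        (∑ c, ψ u c) / Fintype.card C := fun u => hsum _
    simp only [h2]
    set s : Finset U := Finset.univ.filter fun u => W u 0
    have hs : s.card = q := by
      rw [← hcov 0, Nat.card_eq_fintype_card, Fintype.card_subtype]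
    have hconst : ∀ u, u ∉ s → ∀ c c', ψ u c = ψ u c' := by
      intro u hu c c'
      simp only [hψ]
      congr 1
      refine Finset.sum_congr rfl fun χ _ => ?_
      congr 1
      refine hdep _ _ _ fun e => ?_
      refine Fin.cases (fun h => ?_) (fun i _ => by simp) e
      exact absurd (by simpa [s] using h) hu
    obtain ⟨c₀⟩ := ‹Nonempty C›
    have hsplit : ∀ F : U → ℝ, ∏ u, F u = (∏ u ∈ s, F u) * ∏ u ∈ sᶜ, F u := fun F =>
      (Finset.prod_mul_prod_compl s F).symm
    have h3 : ∀ c, ∏ u ∈ sᶜ, ψ u c ^ ((q : ℝ)⁻¹) = ∏ u ∈ sᶜ, ψ u c₀ ^ ((q : ℝ)⁻¹) := fun c =>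
      Finset.prod_congr rfl fun u hu => by rw [hconst u (Finset.mem_compl.1 hu) c c₀]
    have h4 : ∏ u ∈ sᶜ, ((∑ c, ψ u c) / Fintype.card C) ^ ((q : ℝ)⁻¹) =
        ∏ u ∈ sᶜ, ψ u c₀ ^ ((q : ℝ)⁻¹) := by
      refine Finset.prod_congr rfl fun u hu => ?_
      rw [Finset.sum_congr rfl fun c _ => hconst u (Finset.mem_compl.1 hu) c c₀]
      simp only [Finset.sum_const, Finset.card_univ, nsmul_eq_mul]
      rw [mul_div_cancel_left₀ _ hC.ne']
    simp only [hsplit, h3]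
    rw [h4, ← Finset.sum_mul, mul_div_right_comm]
    have : Nonempty C := ⟨c₀⟩
    have h5 := holder_uniform s (Finset.card_pos.1 (hs ▸ hq)) ψ hψ0
    rw [hs] at h5
    exact mul_le_mul_of_nonneg_right h5 (Finset.prod_nonneg fun u _ => Real.rpow_nonneg (hψ0 _ _) _)

/-- Summing over all `χ` a function of `χ ∘ a`, with `a` injective. -/
theorem sum_comp_injective {C E G : Type*} [Fintype C] [Fintype E] [Fintype G] [DecidableEq E]
    [DecidableEq G] (a : G → E) (ha : Function.Injective a) (F : (G → C) → ℝ) :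
    ∑ χ : E → C, F (χ ∘ a) =
      (Fintype.card C : ℝ) ^ (Fintype.card E - Fintype.card G) * ∑ p, F p := by
  classical
  let e1 : E ≃ G ⊕ {x // x ∉ Set.range a} :=
    (Equiv.Set.sumCompl (Set.range a)).symm.trans
      (Equiv.sumCongr (Equiv.ofInjective a ha).symm (Equiv.refl _))
  have he1 : ∀ g, e1.symm (Sum.inl g) = a g := fun g => by simp [e1]
  have hcard : Fintype.card {x // x ∉ Set.range a} = Fintype.card E - Fintype.card G := by
    have := Fintype.card_congr e1
    rw [Fintype.card_sum] at this
    omega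
  let e2 : ((G → C) × ({x // x ∉ Set.range a} → C)) ≃ (E → C) :=
    (Equiv.sumArrowEquivProdArrow _ _ _).symm.trans (e1.arrowCongr (Equiv.refl C)).symm
  rw [← e2.sum_comp, Fintype.sum_prod_type]
  have : ∀ p r, F (e2 (p, r) ∘ a) = F p := by
    intro p r
    congr 1
    funext g
    have : e1 (a g) = Sum.inl g := by rw [← he1, Equiv.apply_symm_apply]
    simp [e2, Equiv.arrowCongr, this, Equiv.sumArrowEquivProdArrow]
  simp only [this, Finset.sum_const, Finset.card_univ, nsmul_eq_mul, Fintype.card_fun, hcard]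
  rw [Finset.mul_sum]
  push_cast
  rfl

/-- Finner's inequality for translates of a single pattern function. -/
theorem finner_pattern {C E G : Type*} [Fintype C] [Nonempty C] [Fintype E] [Fintype G]
    [DecidableEq E] [DecidableEq G] [Nonempty G] (a : E → G → E)
    (ha : ∀ u, Function.Injective (a u)) (hcov : ∀ e, Nat.card {u // ∃ g, a u g = e} = Fintype.card G)
    (φ : (G → C) → ℝ) (hφ : ∀ p, 0 ≤ φ p) :
    ∑ χ : E → C, ∏ u, φ (χ ∘ a u) ≤
      (∑ p, φ p ^ Fintype.card G) ^ ((Fintype.card E : ℝ) / Fintype.card G) := by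
  classical
  have hC : (0 : ℝ) < Fintype.card C := by exact_mod_cast Fintype.card_pos
  have hG : 0 < Fintype.card G := Fintype.card_pos
  set q := Fintype.card G with hq
  set n := Fintype.card E with hn
  rcases isEmpty_or_nonempty E with hE | ⟨⟨u₀⟩⟩
  · simp [hn, Fintype.card_eq_zero]
  have hqn : q ≤ n := Fintype.card_le_of_injective _ (ha u₀)
  let ε := Fintype.equivFin E
  have h := finner_fin (C := C) (U := E) q hG n (fun u e => ∃ g, a u g = ε.symm e)
    (fun u χ => φ (fun g => χ (ε (a u g)))) (fun _ _ => hφ _)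
    (fun u χ χ' h => by
      congr 1
      funext g
      exact h _ ⟨g, by simp⟩)
    (fun e => hcov (ε.symm e))
  have ht : ∀ F : (E → C) → ℝ, ∑ χ : Fin n → C, F (χ ∘ ε) = ∑ χ : E → C, F χ := fun F =>
    (ε.arrowCongr (Equiv.refl C)).symm.sum_comp F
  have h1 : ∑ χ : Fin n → C, ∏ u, φ (fun g => χ (ε (a u g))) = ∑ χ : E → C, ∏ u, φ (χ ∘ a u) :=
    ht fun χ => ∏ u, φ (χ ∘ a u)
  have h2 : ∀ u, ∑ χ : Fin n → C, φ (fun g => χ (ε (a u g))) ^ q =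
      (Fintype.card C : ℝ) ^ (n - q) * ∑ p, φ p ^ q := fun u => by
    rw [← sum_comp_injective (a u) (ha u) (fun p => φ p ^ q)]
    exact ht fun χ => φ (χ ∘ a u) ^ q
  have hS : 0 ≤ ∑ p, φ p ^ q := Finset.sum_nonneg fun p _ => pow_nonneg (hφ p) _
  have h3 : ∀ u : E, (∑ χ : Fin n → C, φ (fun g => χ (ε (a u g))) ^ q) / (Fintype.card C : ℝ) ^ n
      = (∑ p, φ p ^ q) / (Fintype.card C : ℝ) ^ q := fun u => by
    rw [h2, div_eq_div_iff (by positivity) (by positivity), ← Nat.sub_add_cancel hqn, pow_add]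
    simp only [Nat.add_sub_cancel]
    ring
  rw [h1] at h
  simp only [h3] at h
  rw [Finset.prod_const, Finset.card_univ, ← hn, div_le_iff₀ (by positivity)] at h
  refine h.trans (le_of_eq ?_)
  have hq0 : (q : ℝ) ≠ 0 := by exact_mod_cast hG.ne'
  rw [← Real.rpow_natCast (_ ^ _) n, ← Real.rpow_mul (by positivity),
    Real.div_rpow hS (by positivity), ← Real.rpow_natCast _ q, ← Real.rpow_mul hC.le,
    ← Real.rpow_natCast _ n]
  have : (q : ℝ) * ((q : ℝ)⁻¹ * n) = n := by field_simp
  rw [this, div_mul_cancel₀ _ (by positivity)]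
  congr 1
  field_simp

end

section

open Finset

/-- The vertices of the `d`-dimensional Hamming cube, as a group. -/
abbrev Cube (d : ℕ) := Fin d → ZMod 2

/-- The `i`-th coordinate direction. -/
def dir {d : ℕ} (i : Fin d) : Cube d := Pi.single i 1

/-- The parity of a vertex. -/
def par {d : ℕ} (v : Cube d) : ZMod 2 := ∑ i, v i

theorem cube_add_self {d : ℕ} (v : Cube d) : v + v = 0 := by
  funext i
  exact CharTwo.add_self_eq_zero _

theorem add_dir_add_dir {d : ℕ} (v : Cube d) (i : Fin d) : v + dir i + dir i = v := by
  rw [add_assoc, cube_add_self, add_zero]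

theorem par_add {d : ℕ} (v w : Cube d) : par (v + w) = par v + par w := by
  simp [par, sum_add_distrib]

theorem par_dir {d : ℕ} (i : Fin d) : par (dir i) = 1 := by
  simp [par, dir]

theorem par_add_dir {d : ℕ} (v : Cube d) (i : Fin d) : par (v + dir i) = par v + 1 := by
  rw [par_add, par_dir]

theorem dir_injective {d : ℕ} : Function.Injective (dir : Fin d → Cube d) := by
  intro i j h
  by_contra hij
  have := congrFun h i
  simp [dir, hij] at this

theorem sum_add_dir {d : ℕ} {M : Type*} [AddCommMonoid M] (F : Cube d → M) (i : Fin d) :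
    ∑ v, F (v + dir i) = ∑ v, F v :=
  Equiv.sum_comp (Equiv.addRight (dir i)) F

theorem two_point_log {a b : ℝ} (ha : 0 ≤ a) (hb : 0 ≤ b) (hba : b ≤ a) :
    a * Real.log a + b * Real.log b + 2 * b * Real.log 2 ≤ (a + b) * Real.log (a + b) := by
  rcases hb.eq_or_lt with rfl | hb'
  · simp
  have ha' : 0 < a := hb'.trans_le hba
  have h1 : b / a * Real.log 2 ≤ Real.log (1 + b / a) := by
    have hx0 : 0 ≤ b / a := by positivity
    have hx1 : b / a ≤ 1 := (div_le_one ha').2 hba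
    have := strictConcaveOn_log_Ioi.concaveOn.2 (Set.mem_Ioi.2 one_pos) (Set.mem_Ioi.2 two_pos)
      (sub_nonneg.2 hx1) hx0 (by ring)
    simp only [smul_eq_mul, Real.log_one, mul_zero, zero_add] at this
    refine this.trans (le_of_eq ?_)
    congr 1
    ring
  have h2 : Real.log (a + b) = Real.log a + Real.log (1 + b / a) := by
    rw [← Real.log_mul ha'.ne' (by positivity)]
    congr 1
    field_simp
  have h3 : Real.log b + Real.log 2 ≤ Real.log (a + b) := by
    rw [← Real.log_mul hb'.ne' two_ne_zero]
    exact Real.log_le_log (by positivity) (by linarith)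
  have h4 : b * Real.log 2 ≤ a * Real.log (1 + b / a) := by
    have := mul_le_mul_of_nonneg_left h1 ha
    refine le_trans (le_of_eq ?_) this
    field_simp
  have h5 := mul_le_mul_of_nonneg_left h3 hb
  have h6 : a * Real.log (a + b) = a * Real.log a + a * Real.log (1 + b / a) := by rw [h2]; ring
  rw [add_mul, h6]
  linarith

theorem sum_mul_add_dir_le {d : ℕ} : ∀ (x : Cube d → ℝ), (∀ v, x v = 0 ∨ x v = 1) →
    (∑ v, ∑ i, x v * x (v + dir i)) * Real.log 2 ≤ (∑ v, x v) * Real.log (∑ v, x v) := by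
  induction d with
  | zero =>
    intro x hx
    have h : (∑ v, x v) * Real.log (∑ v, x v) = 0 := by
      rw [Fintype.sum_unique]
      have h01 : ∀ y : ℝ, y = 0 ∨ y = 1 → y * Real.log y = 0 := by
        rintro y (rfl | rfl) <;> simp
      exact h01 _ (hx _)
    rw [h]
    simp
  | succ d ih =>
    intro x hx
    have hs : ∀ F : Cube (d + 1) → ℝ, ∑ v, F v =
        (∑ w : Cube d, F (Fin.cons 0 w)) + ∑ w : Cube d, F (Fin.cons 1 w) := by
      intro F
      rw [← (Fin.consEquiv (fun _ : Fin (d + 1) => ZMod 2)).sum_comp, Fintype.sum_prod_type]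
      exact Fin.sum_univ_two (fun c : Fin 2 => ∑ w : Cube d, F (Fin.cons (c : ZMod 2) w))
    have h0 : ∀ (c : ZMod 2) (w : Cube d),
        (Fin.cons c w + dir 0 : Cube (d + 1)) = Fin.cons (c + 1) w := by
      intro c w
      funext i
      refine Fin.cases ?_ (fun j => ?_) i <;> simp [dir]
    have h1 : ∀ (c : ZMod 2) (w : Cube d) (i : Fin d),
        (Fin.cons c w + dir i.succ : Cube (d + 1)) = Fin.cons c (w + dir i) := by
      intro c w i
      funext k
      refine Fin.cases ?_ (fun j => ?_) k
      · simp [dir]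
      · simp [dir, Pi.single_apply]
    have i0 := ih (fun w => x (Fin.cons 0 w)) (fun _ => hx _)
    have i1 := ih (fun w => x (Fin.cons 1 w)) (fun _ => hx _)
    rw [hs, hs]
    simp only [Fin.sum_univ_succ, h0, h1, sum_add_distrib]
    have e11 : (1 + 1 : ZMod 2) = 0 := rfl
    rw [zero_add, e11]
    have hnn : ∀ v, 0 ≤ x v := fun v => by rcases hx v with h | h <;> simp [h]
    have hle : ∀ v, x v ≤ 1 := fun v => by rcases hx v with h | h <;> simp [h]
    set a := ∑ w : Cube d, x (Fin.cons 0 w) with ha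
    set b := ∑ w : Cube d, x (Fin.cons 1 w) with hb
    have ha0 : 0 ≤ a := sum_nonneg fun _ _ => hnn _
    have hb0 : 0 ≤ b := sum_nonneg fun _ _ => hnn _
    have hc : ∑ w : Cube d, x (Fin.cons 1 w) * x (Fin.cons 0 w) =
      ∑ w : Cube d, x (Fin.cons 0 w) * x (Fin.cons 1 w) := sum_congr rfl fun _ _ => mul_comm _ _
    have hca : ∑ w : Cube d, x (Fin.cons 0 w) * x (Fin.cons 1 w) ≤ a :=
      sum_le_sum fun w _ => mul_le_of_le_one_right (hnn _) (hle _)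
    have hcb : ∑ w : Cube d, x (Fin.cons 0 w) * x (Fin.cons 1 w) ≤ b :=
      sum_le_sum fun w _ => mul_le_of_le_one_left (hnn _) (hle _)
    have hl := Real.log_nonneg (one_le_two : (1:ℝ) ≤ 2)
    rw [hc]
    rcases le_total b a with h | h
    · have := two_point_log ha0 hb0 h
      have := mul_le_mul_of_nonneg_right hcb hl
      nlinarith
    · have := two_point_log hb0 ha0 h
      rw [add_comm b a] at this
      have := mul_le_mul_of_nonneg_right hca hl
      nlinarith

/-- The isoperimetric profile `x log (2^d / x)`. -/
noncomputable def isoProfile (d : ℕ) (x : ℝ) : ℝ := x * Real.log (2 ^ d / x)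

/-- The number of edges leaving `S`. -/
def edgeBoundary {d : ℕ} (S : Finset (Cube d)) : ℕ := ∑ v ∈ S, #{i | v + dir i ∉ S}

theorem edgeBoundary_eq_sum {d : ℕ} (S : Finset (Cube d)) :
    edgeBoundary S = ∑ v, ∑ i, if v ∈ S ∧ v + dir i ∉ S then 1 else 0 := by
  rw [edgeBoundary, ← sum_filter_add_sum_filter_not univ (· ∈ S)]
  rw [sum_eq_zero (s := {v | v ∉ S}), add_zero, filter_mem_eq_inter, univ_inter]
  · refine sum_congr rfl fun v hv => ?_
    rw [card_filter]
    simp [hv]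
  · intro v hv
    simp [(mem_filter.1 hv).2]

theorem edgeBoundary_compl {d : ℕ} (S : Finset (Cube d)) : edgeBoundary Sᶜ = edgeBoundary S := by
  rw [edgeBoundary_eq_sum, edgeBoundary_eq_sum, sum_comm, sum_comm (s := univ (α := Cube d))]
  refine sum_congr rfl fun i _ => ?_
  rw [← sum_add_dir _ i]
  refine sum_congr rfl fun v _ => ?_
  simp [add_dir_add_dir, and_comm]

theorem card_cube (d : ℕ) : Fintype.card (Cube d) = 2 ^ d := by
  simp [Cube, ZMod.card]

theorem isoProfile_le_edgeBoundary {d : ℕ} (S : Finset (Cube d)) :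
    isoProfile d #S ≤ edgeBoundary S := by
  rcases S.eq_empty_or_nonempty with rfl | hS
  · simp [isoProfile]
  have hS0 : (0:ℝ) < #S := by exact_mod_cast hS.card_pos
  have h := sum_mul_add_dir_le (fun v => if v ∈ S then (1:ℝ) else 0) (fun v => by
    by_cases hv : v ∈ S <;> simp [hv])
  have hc : ∑ v : Cube d, (if v ∈ S then (1:ℝ) else 0) = #S := by simp
  rw [hc] at h
  have hsum : (∑ v : Cube d, ∑ i, (if v ∈ S then (1:ℝ) else 0) * (if v + dir i ∈ S then 1 else 0)) +
      edgeBoundary S = d * #S := by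
    rw [edgeBoundary_eq_sum]
    push_cast
    rw [← sum_add_distrib]
    have : ∀ v ∈ univ (α := Cube d), ((∑ i, (if v ∈ S then (1:ℝ) else 0) *
        (if v + dir i ∈ S then 1 else 0)) + ∑ i, if v ∈ S ∧ v + dir i ∉ S then (1:ℝ) else 0) =
        if v ∈ S then (d:ℝ) else 0 := by
      intro v _
      rw [← sum_add_distrib]
      by_cases hv : v ∈ S
      · have : ∀ i ∈ univ (α := Fin d), ((if v ∈ S then (1:ℝ) else 0) *
          (if v + dir i ∈ S then 1 else 0) + if v ∈ S ∧ v + dir i ∉ S then (1:ℝ) else 0) = 1 := by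
          intro i _
          by_cases hi : v + dir i ∈ S <;> simp [hv, hi]
        rw [sum_congr rfl this]
        simp [hv]
      · simp [hv]
    rw [sum_congr rfl this]
    simp [mul_comm]
  set I := ∑ v : Cube d, ∑ i, (if v ∈ S then (1:ℝ) else 0) * (if v + dir i ∈ S then 1 else 0)
  have hb0 : (0:ℝ) ≤ edgeBoundary S := Nat.cast_nonneg _
  have hl2 : Real.log 2 ≤ 1 := by linarith [Real.log_two_lt_d9]
  rw [isoProfile, Real.log_div (by positivity) hS0.ne', Real.log_pow]
  have : (edgeBoundary S : ℝ) * Real.log 2 ≤ edgeBoundary S := mul_le_of_le_one_right hb0 hl2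
  have h3 : (edgeBoundary S : ℝ) * Real.log 2 = d * #S * Real.log 2 - I * Real.log 2 := by
    rw [← hsum]; ring
  nlinarith

theorem isoProfile_nonneg {d : ℕ} {x : ℝ} (hx : 0 ≤ x) (hxd : x ≤ 2 ^ d) :
    0 ≤ isoProfile d x := by
  rcases hx.eq_or_lt with rfl | hx
  · simp [isoProfile]
  · exact mul_nonneg hx.le (Real.log_nonneg ((one_le_div hx).2 hxd))

theorem isoProfile_mono {d : ℕ} {x y : ℝ} (hx : 0 ≤ x) (hxy : x ≤ y) (hy : 4 * y ≤ 2 ^ d) :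
    isoProfile d x ≤ isoProfile d y := by
  rcases hx.eq_or_lt with rfl | hx
  · have := isoProfile_nonneg (d := d) hxy (by linarith)
    simpa [isoProfile] using this
  have hy0 : 0 < y := hx.trans_le hxy
  have h1 : Real.log (2 ^ d / x) = Real.log (2 ^ d / y) + Real.log (y / x) := by
    rw [← Real.log_mul (by positivity) (by positivity)]
    congr 1
    field_simp
  have h2 : Real.log (y / x) ≤ y / x - 1 := Real.log_le_sub_one_of_pos (by positivity)
  have h3 : 1 ≤ Real.log (2 ^ d / y) := by
    rw [Real.le_log_iff_exp_le (by positivity), le_div_iff₀ hy0]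
    have := Real.exp_one_lt_d9
    nlinarith
  rw [isoProfile, isoProfile, h1]
  have h4 : x * Real.log (y / x) ≤ y - x := by
    refine (mul_le_mul_of_nonneg_left h2 hx.le).trans (le_of_eq ?_)
    field_simp
  nlinarith

/-- The number of neighbours of `u` in `X`. -/
def nbrCount {d : ℕ} (X : Finset (Cube d)) (u : Cube d) : ℕ := #{i | u + dir i ∈ X}

theorem sum_nbrCount {d : ℕ} (X : Finset (Cube d)) : ∑ u, nbrCount X u = d * #X := by
  simp only [nbrCount, card_filter]
  rw [sum_comm]
  have : ∀ i ∈ univ (α := Fin d), ∑ u : Cube d, (if u + dir i ∈ X then 1 else 0) = #X := by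
    intro i _
    rw [sum_add_dir (fun v => if v ∈ X then 1 else 0) i]
    simp
  rw [sum_congr rfl this]
  simp

/-- The completion of a set `X` of vertices of parity `c`: add the vertices of the other
parity having at least half of their neighbours in `X`. -/
def completion {d : ℕ} (c : ZMod 2) (X : Finset (Cube d)) : Finset (Cube d) :=
  X ∪ ({u | par u = c + 1 ∧ d ≤ 2 * nbrCount X u} : Finset (Cube d))

theorem subset_completion {d : ℕ} (c : ZMod 2) (X : Finset (Cube d)) : X ⊆ completion c X :=
  subset_union_left

theorem card_completion_le {d : ℕ} (hd : 0 < d) (c : ZMod 2) (X : Finset (Cube d)) :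
    #(completion c X) ≤ 3 * #X := by
  have h : #({u | par u = c + 1 ∧ d ≤ 2 * nbrCount X u} : Finset (Cube d)) * d ≤ (2 * #X) * d := by
    calc _ ≤ ∑ u ∈ ({u | par u = c + 1 ∧ d ≤ 2 * nbrCount X u} : Finset (Cube d)),
          2 * nbrCount X u := by
          rw [← smul_eq_mul]
          exact card_nsmul_le_sum _ _ _ fun u hu => ((mem_filter.1 hu).2).2
      _ ≤ ∑ u, 2 * nbrCount X u := sum_le_sum_of_subset (subset_univ _)
      _ = _ := by rw [← mul_sum, sum_nbrCount]; ring
  have h2 := Nat.le_of_mul_le_mul_right h hd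
  have := card_union_le X ({u | par u = c + 1 ∧ d ≤ 2 * nbrCount X u} : Finset (Cube d))
  rw [completion]
  omega

theorem zmod_two_add_one_ne (c : ZMod 2) : c + 1 ≠ c := by
  revert c; decide

theorem zmod_two_ne_iff (a c : ZMod 2) : a ≠ c ↔ a = c + 1 := by
  revert a c; decide

theorem zmod_two_add_eq_iff (a c : ZMod 2) : a + 1 = c ↔ a = c + 1 := by
  revert a c; decide

theorem edgeBoundary_completion {d : ℕ} (c : ZMod 2) (X : Finset (Cube d))
    (hX : ∀ v ∈ X, par v = c) : edgeBoundary (completion c X) =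
      ∑ u with par u = c + 1, min (nbrCount X u) (d - nbrCount X u) := by
  set P := completion c X with hP
  have memP : ∀ v, par v = c → (v ∈ P ↔ v ∈ X) := by
    intro v hv
    have : v ∉ ({u | par u = c + 1 ∧ d ≤ 2 * nbrCount X u} : Finset (Cube d)) := by
      simp [hv, (zmod_two_add_one_ne c).symm]
    rw [hP, completion, mem_union]
    tauto
  have memP' : ∀ v, par v = c + 1 → (v ∈ P ↔ d ≤ 2 * nbrCount X v) := by
    intro v hv
    have : v ∉ X := fun h => zmod_two_add_one_ne c (hv.symm.trans (hX v h))
    rw [hP, completion, mem_union]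
    simp [this, hv]
  rw [edgeBoundary_eq_sum]
  have h1 : ∑ v, ∑ i, (if v ∈ P ∧ v + dir i ∉ P then 1 else 0) =
      ∑ v, ∑ i, ((if par v = c + 1 ∧ v ∈ P ∧ v + dir i ∉ P then 1 else 0) +
        if par v = c ∧ v ∈ P ∧ v + dir i ∉ P then 1 else 0) := by
    refine sum_congr rfl fun v _ => sum_congr rfl fun i _ => ?_
    by_cases hv : par v = c
    · simp [hv, (zmod_two_add_one_ne c).symm]
    · have := (zmod_two_ne_iff _ _).1 hv
      simp [this]
  have h2 : ∑ v, ∑ i, (if par v = c ∧ v ∈ P ∧ v + dir i ∉ P then 1 else 0) =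
      ∑ v, ∑ i, (if par v = c + 1 ∧ v ∉ P ∧ v + dir i ∈ P then 1 else 0) := by
    rw [sum_comm, sum_comm (s := univ (α := Cube d))]
    refine sum_congr rfl fun i _ => ?_
    rw [← sum_add_dir _ i]
    refine sum_congr rfl fun v _ => ?_
    simp [add_dir_add_dir, par_add_dir, zmod_two_add_eq_iff, and_comm]
  rw [h1]
  simp only [sum_add_distrib] at h2 ⊢
  rw [h2]
  simp only [← sum_add_distrib]
  rw [sum_filter]
  refine sum_congr rfl fun u _ => ?_
  by_cases hu : par u = c + 1
  · have hnb : ∀ i, (u + dir i ∈ P ↔ u + dir i ∈ X) := fun i => memP _ (by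
      rw [par_add_dir, zmod_two_add_eq_iff, hu])
    have hcount : nbrCount X u + #{i | u + dir i ∉ X} = d := by
      rw [nbrCount, card_filter_add_card_filter_not]; simp
    by_cases huP : u ∈ P
    · have := (memP' u hu).1 huP
      simp only [hu, huP, hnb, true_and, not_true, false_and, if_false, add_zero, if_true]
      rw [← card_filter]
      omega
    · have := mt (memP' u hu).2 huP
      simp only [hu, huP, hnb, true_and, not_false_eq_true, false_and, if_false, zero_add, if_true]
      rw [← card_filter]
      change nbrCount X u = _
      omega
  · simp [hu]

end

section

open Finset

/-- Index set of the vectors of weight `0` and `2`. -/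
abbrev Gadget (d : ℕ) := Option {x : Fin d × Fin d // x.1 < x.2}

/-- The vector of weight `0` or `2` with the given index. -/
def Gadget.vec {d : ℕ} : Gadget d → Cube d
  | none => 0
  | some x => dir x.1.1 + dir x.1.2

/-- The index of `e_i + e_j`. -/
def Gadget.idx {d : ℕ} (i j : Fin d) : Gadget d :=
  if h : i < j then some ⟨(i, j), h⟩ else if h : j < i then some ⟨(j, i), h⟩ else none

theorem Gadget.idx_comm {d : ℕ} (i j : Fin d) : Gadget.idx i j = Gadget.idx j i := by
  unfold Gadget.idx
  rcases lt_trichotomy i j with h | h | h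
  · simp [h, h.not_gt]
  · simp [h]
  · simp [h, h.not_gt]

theorem Gadget.idx_self {d : ℕ} (i : Fin d) : Gadget.idx i i = none := by
  simp [Gadget.idx]

theorem Gadget.vec_idx {d : ℕ} (i j : Fin d) : (Gadget.idx i j).vec = dir i + dir j := by
  unfold Gadget.idx
  rcases lt_trichotomy i j with h | h | h
  · simp [h, Gadget.vec]
  · subst h; simp [Gadget.vec, cube_add_self]
  · simp [h, h.not_gt, Gadget.vec, add_comm]

theorem dir_add_dir_apply {d : ℕ} (i j m : Fin d) (h : i ≠ j) :
    (dir i + dir j : Cube d) m ≠ 0 ↔ m = i ∨ m = j := by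
  simp only [dir, Pi.add_apply, Pi.single_apply]
  by_cases h1 : m = i <;> by_cases h2 : m = j <;> simp [h1, h2]
  · exact absurd (h1.symm.trans h2) h
  · simp [h]
  · subst h2; simp [h1]

theorem Gadget.vec_injective {d : ℕ} : Function.Injective (Gadget.vec : Gadget d → Cube d) := by
  have key : ∀ x : {x : Fin d × Fin d // x.1 < x.2}, Gadget.vec (some x) ≠ 0 := by
    intro x h
    have := (dir_add_dir_apply x.1.1 x.1.2 x.1.1 x.2.ne).2 (Or.inl rfl)
    exact this (congrFun h _)
  rintro (_ | ⟨⟨i, j⟩, hij⟩) (_ | ⟨⟨k, l⟩, hkl⟩) h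
  · rfl
  · exact absurd h.symm (key _)
  · exact absurd h (key _)
  · simp only [Gadget.vec] at h hij hkl
    have h1 : ∀ m, (m = i ∨ m = j) ↔ (m = k ∨ m = l) := fun m => by
      rw [← dir_add_dir_apply i j m hij.ne, ← dir_add_dir_apply k l m hkl.ne, h]
    have a1 := (h1 i).1 (Or.inl rfl)
    have a2 := (h1 j).1 (Or.inr rfl)
    have a3 := (h1 k).2 (Or.inl rfl)
    have : i = k ∧ j = l := by omega
    simp [this.1, this.2]

theorem two_mul_card_lt {d : ℕ} (T : Finset (Fin d)) :
    2 * #{x : {x : Fin d × Fin d // x.1 < x.2} | x.1.1 ∈ T ∧ x.1.2 ∈ T} + #T = #T * #T := by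
  have h1 : #{x : {x : Fin d × Fin d // x.1 < x.2} | x.1.1 ∈ T ∧ x.1.2 ∈ T} =
      #{x ∈ T ×ˢ T | x.1 < x.2} := by
    refine card_bij (fun x _ => x.1) ?_ ?_ ?_
    · intro x hx
      simpa [x.2] using hx
    · intro x _ y _ h
      exact Subtype.ext h
    · intro x hx
      simp only [mem_filter, mem_product] at hx
      exact ⟨⟨x, hx.2⟩, by simpa using hx.1, rfl⟩
  have h2 : #{x ∈ T ×ˢ T | x.1 < x.2} = #{x ∈ T ×ˢ T | x.2 < x.1} := by
    refine card_bij (fun x _ => x.swap) ?_ ?_ ?_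
    · intro x hx; simp at hx ⊢; tauto
    · intro x _ y _ h; exact Prod.swap_injective h
    · intro x hx; exact ⟨x.swap, by simp at hx ⊢; tauto, by simp⟩
  have h3 : #{x ∈ T ×ˢ T | x.1 = x.2} = #T := by
    refine (card_bij (fun x _ => (x, x)) ?_ ?_ ?_).symm
    · intro x hx; simpa using hx
    · intro x _ y _ h; exact (Prod.ext_iff.1 h).1
    · rintro ⟨x, y⟩ hx
      simp at hx
      exact ⟨x, hx.1.1, by simp [hx.2]⟩
  have h4 : #(T ×ˢ T) = #T * #T := card_product _ _
  have h5 := card_filter_add_card_filter_not (s := T ×ˢ T) (fun x => x.1 < x.2)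
  have h6 := card_filter_add_card_filter_not (s := {x ∈ T ×ˢ T | ¬ x.1 < x.2}) (fun x => x.1 = x.2)
  have h7 : {x ∈ {x ∈ T ×ˢ T | ¬ x.1 < x.2} | x.1 = x.2} = {x ∈ T ×ˢ T | x.1 = x.2} := by
    ext x
    simp only [mem_filter]
    constructor
    · tauto
    · rintro ⟨h, h'⟩
      exact ⟨⟨h, by simp [h']⟩, h'⟩
  have h8 : {x ∈ {x ∈ T ×ˢ T | ¬ x.1 < x.2} | ¬ x.1 = x.2} = {x ∈ T ×ˢ T | x.2 < x.1} := by
    ext x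
    simp only [mem_filter]
    constructor
    · rintro ⟨⟨h, h'⟩, h''⟩
      exact ⟨h, by omega⟩
    · rintro ⟨h, h'⟩
      exact ⟨⟨h, by omega⟩, by omega⟩
  rw [h7, h8] at h6
  omega

theorem card_gadget (d : ℕ) : 2 * Fintype.card (Gadget d) + d = d * d + 2 := by
  have := two_mul_card_lt (univ : Finset (Fin d))
  simp only [mem_univ, and_self, card_univ, Fintype.card_fin, filter_true] at this
  rw [Fintype.card_option]
  omega

section Patterns

variable {d : ℕ} (p : Gadget d → ZMod 3)

/-- The coordinates `i` for which the colors `p (e_i + e_j)` are not all equal to `p 0`. -/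
def nonmonoDirs : Finset (Fin d) := {i | ∃ j, p (Gadget.idx i j) ≠ p none}

/-- For every `i` some color is missing among the `p (e_i + e_j)`. -/
def Admissible : Prop := ∀ i, ∃ c, ∀ j, p (Gadget.idx i j) ≠ c

/-- More than half of the coordinates are non-monochromatic and no color is missing from all of
their neighbourhoods. -/
def Mixed : Prop := d < 2 * #(nonmonoDirs p) ∧ ∀ c, ∃ i ∈ nonmonoDirs p, ∃ j, p (Gadget.idx i j) = c

open Classical in
/-- The local energy of a pattern. -/
noncomputable def patternEnergy : ℕ :=
  min #(nonmonoDirs p) (d - #(nonmonoDirs p)) + if Mixed p then 1 else 0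

open Classical in
/-- The weight of a pattern. -/
noncomputable def patternWeight (t l : ℝ) : ℝ :=
  if Admissible p then Real.exp (Real.log 2 / d * #(nonmonoDirs p)ᶜ +
    l / Fintype.card (Gadget d) * patternEnergy p -
    t / Fintype.card (Gadget d) * #{g | p g ≠ 0}) else 0

/-- The colors allowed at a gadget point, given the color `a` at the centre, the set `R` of
non-monochromatic directions and the set `S` of directions colored `a + 1`. -/
def allowed (a : ZMod 3) (R S : Finset (Fin d)) : Gadget d → ZMod 3 → Prop
  | none, x => x = a
  | some y, x => if y.1.1 ∈ R ∧ y.1.2 ∈ R ∧ (y.1.1 ∈ S ↔ y.1.2 ∈ S) then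
      x ≠ (if y.1.1 ∈ S then a + 1 else a + 2) else x = a

end Patterns

theorem patternWeight_nonneg {d : ℕ} (p : Gadget d → ZMod 3) (t l : ℝ) :
    0 ≤ patternWeight p t l := by
  unfold patternWeight
  split_ifs
  · exact (Real.exp_pos _).le
  · exact le_rfl

theorem zmod_three_cases (a c : ZMod 3) (h : a ≠ c) : c = a + 1 ∨ c = a + 2 := by
  revert a c; decide

theorem zmod_three_eq (a x : ZMod 3) (h1 : x ≠ a + 1) (h2 : x ≠ a + 2) : x = a := by
  revert a x; decide

theorem Admissible.exists_allowed {d : ℕ} {p : Gadget d → ZMod 3} (h : Admissible p) :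
    ∃ S ⊆ nonmonoDirs p, (∀ g, allowed (p none) (nonmonoDirs p) S g (p g)) ∧
      (Mixed p → d < 2 * #(nonmonoDirs p) ∧ S ≠ ∅ ∧ S ≠ nonmonoDirs p) := by
  choose c hc using h
  set a := p none with ha
  have hca : ∀ i, a ≠ c i := fun i => by simpa [Gadget.idx_self] using hc i i
  have hc' : ∀ i j, p (Gadget.idx i j) ≠ c j := fun i j => by
    rw [Gadget.idx_comm]; exact hc j i
  have hR : ∀ i j, i ∉ nonmonoDirs p → p (Gadget.idx i j) = a := fun i j hi => by
    simp only [nonmonoDirs, mem_filter, mem_univ, true_and, not_exists, not_not] at hi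
    exact hi j
  have a12 : a + 1 ≠ a + 2 := by generalize a = b; revert b; decide
  refine ⟨{i ∈ nonmonoDirs p | c i = a + 1}, filter_subset _ _, ?_, ?_⟩
  · rintro (_ | ⟨⟨i, j⟩, hij⟩)
    · rfl
    · have hidx : (some ⟨(i, j), hij⟩ : Gadget d) = Gadget.idx i j := by
        simp only at hij
        simp [Gadget.idx, hij]
      simp only [allowed]
      rw [hidx]
      by_cases hi : i ∈ nonmonoDirs p
      · by_cases hj : j ∈ nonmonoDirs p
        · simp only [hi, hj, mem_filter, true_and]
          split_ifs with h1 h2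
          · rw [← h2]; exact hc i j
          · rw [← ((zmod_three_cases a _ (hca i)).resolve_left h2)]; exact hc i j
          · rcases zmod_three_cases a _ (hca i) with h2 | h2 <;>
              rcases zmod_three_cases a _ (hca j) with h3 | h3
            · exact absurd (by simp [h2, h3]) h1
            · exact zmod_three_eq _ _ (h2 ▸ hc i j) (h3 ▸ hc' i j)
            · exact zmod_three_eq _ _ (h3 ▸ hc' i j) (h2 ▸ hc i j)
            · exact absurd (by simp [h2, h3, a12.symm]) h1
        · simp only [hj, false_and, and_false, if_false]
          rw [Gadget.idx_comm]; exact hR j i hj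
      · simp only [hi, false_and, if_false]
        exact hR i j hi
  · rintro ⟨h1, h2⟩
    refine ⟨h1, ?_, ?_⟩
    · intro hS
      obtain ⟨i, hi, j, hj⟩ := h2 (a + 2)
      have : c i ≠ a + 1 := fun hci => by
        have : i ∈ ({i ∈ nonmonoDirs p | c i = a + 1} : Finset (Fin d)) := by simp [hi, hci]
        simp [hS] at this
      have := (zmod_three_cases a _ (hca i)).resolve_left this
      exact hc i j (hj.trans this.symm)
    · intro hS
      obtain ⟨i, hi, j, hj⟩ := h2 (a + 1)
      have : i ∈ ({i ∈ nonmonoDirs p | c i = a + 1} : Finset (Fin d)) := by rw [hS]; exact hi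
      exact hc i j (hj.trans (mem_filter.1 this).2.symm)

theorem card_nonmonoDirs_ne_one {d : ℕ} (p : Gadget d → ZMod 3) : #(nonmonoDirs p) ≠ 1 := by
  intro h
  obtain ⟨i, hi⟩ := card_eq_one.1 h
  have h1 : i ∈ nonmonoDirs p := by simp [hi]
  simp only [nonmonoDirs, mem_filter, mem_univ, true_and] at h1
  obtain ⟨j, hj⟩ := h1
  have h2 : j ∈ nonmonoDirs p := by
    simp only [nonmonoDirs, mem_filter, mem_univ, true_and]
    exact ⟨i, by rwa [Gadget.idx_comm]⟩
  have : j = i := by simpa [hi] using h2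
  subst this
  exact hj (by rw [Gadget.idx_self])

open Classical in
/-- The contribution of the data `(a, R, S)` to the partition function of the gadget. -/
noncomputable def gadgetCount {d : ℕ} (t : ℝ) (a : ZMod 3) (R S : Finset (Fin d)) : ℝ :=
  ∏ g : Gadget d, ∑ x : ZMod 3, if allowed a R S g x then (if x ≠ 0 then Real.exp (-t) else 1) else 0

/-- The exponential factor attached to `(R, S)`. -/
noncomputable def gadgetFactor {d : ℕ} (l : ℝ) (R S : Finset (Fin d)) : ℝ :=
  if #R = 1 then 0 else 2 ^ ((Fintype.card (Gadget d) : ℝ) * (d - #R) / d) *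
    Real.exp (l * (min #R (d - #R) + if d < 2 * #R ∧ S ≠ ∅ ∧ S ≠ R then 1 else 0 : ℕ))

theorem gadgetFactor_nonneg {d : ℕ} (l : ℝ) (R S : Finset (Fin d)) : 0 ≤ gadgetFactor l R S := by
  unfold gadgetFactor
  split_ifs <;> positivity

theorem sum_patternWeight_le {d : ℕ} (hd : 0 < d) {t l : ℝ} (hl : 0 ≤ l) :
    ∑ p : Gadget d → ZMod 3, patternWeight p t l ^ Fintype.card (Gadget d) ≤
      ∑ a : ZMod 3, ∑ R : Finset (Fin d), ∑ S ∈ R.powerset,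
        gadgetFactor l R S * gadgetCount t a R S := by
  classical
  have hprod : ∀ (a : ZMod 3) (R S : Finset (Fin d)), gadgetCount t a R S =
      ∑ p : Gadget d → ZMod 3, ∏ g : Gadget d,
        if allowed a R S g (p g) then (if p g ≠ 0 then Real.exp (-t) else 1) else 0 := by
    intro a R S
    rw [gadgetCount, prod_univ_sum, Fintype.piFinset_univ]
  have hnn : ∀ (a : ZMod 3) (R S : Finset (Fin d)) (p : Gadget d → ZMod 3), 0 ≤ ∏ g : Gadget d,
        if allowed a R S g (p g) then (if p g ≠ 0 then Real.exp (-t) else 1) else 0 := by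
    intro a R S p
    refine prod_nonneg fun g _ => ?_
    split_ifs <;> positivity
  simp only [hprod, mul_sum]
  have hswap : ∑ a : ZMod 3, ∑ R : Finset (Fin d), ∑ S ∈ R.powerset, ∑ p : Gadget d → ZMod 3,
      gadgetFactor l R S * ∏ g : Gadget d,
        (if allowed a R S g (p g) then (if p g ≠ 0 then Real.exp (-t) else 1) else 0) =
      ∑ p : Gadget d → ZMod 3, ∑ a : ZMod 3, ∑ R : Finset (Fin d), ∑ S ∈ R.powerset,
      gadgetFactor l R S * ∏ g : Gadget d,
        (if allowed a R S g (p g) then (if p g ≠ 0 then Real.exp (-t) else 1) else 0) := by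
    refine (sum_congr rfl fun a _ => sum_congr rfl fun R _ => sum_comm).trans ?_
    exact (sum_congr rfl fun a _ => sum_comm).trans sum_comm
  rw [hswap]
  refine sum_le_sum fun p _ => ?_
  have hq : 0 < Fintype.card (Gadget d) := Fintype.card_pos
  by_cases hp : Admissible p
  · obtain ⟨S, hSR, hall, hmix⟩ := hp.exists_allowed
    set R := nonmonoDirs p with hR
    have hterm : patternWeight p t l ^ Fintype.card (Gadget d) ≤ gadgetFactor l R S *
        ∏ g : Gadget d, (if allowed (p none) R S g (p g) then
          (if p g ≠ 0 then Real.exp (-t) else 1) else 0) := by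
      rw [prod_congr rfl fun g _ => if_pos (hall g), prod_ite, prod_const_one, mul_one, prod_const,
        ← Real.exp_nat_mul, patternWeight, if_pos hp, ← Real.exp_nat_mul, gadgetFactor,
        if_neg (card_nonmonoDirs_ne_one p), Real.rpow_def_of_pos two_pos, ← Real.exp_add,
        ← Real.exp_add, Real.exp_le_exp, ← hR]
      have hRc : ((#Rᶜ : ℕ) : ℝ) = d - #R := by
        rw [card_compl, Fintype.card_fin, Nat.cast_sub]
        exact (card_le_univ R).trans (by simp)
      have hE : patternEnergy p ≤
          min #R (d - #R) + if d < 2 * #R ∧ S ≠ ∅ ∧ S ≠ R then 1 else 0 := by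
        rw [patternEnergy, ← hR]
        refine add_le_add_right ?_ _
        split_ifs with h1 h2
        · exact le_rfl
        · exact absurd (hmix h1) h2
        · exact Nat.zero_le _
        · exact le_rfl
      have hE' := mul_le_mul_of_nonneg_left (Nat.cast_le (α := ℝ).2 hE) hl
      rw [hRc]
      have hq' : (Fintype.card (Gadget d) : ℝ) ≠ 0 := by exact_mod_cast hq.ne'
      have hd' : (d : ℝ) ≠ 0 := by exact_mod_cast hd.ne'
      have : (Fintype.card (Gadget d) : ℝ) * (Real.log 2 / d * (d - #R) +
          l / Fintype.card (Gadget d) * patternEnergy p - t / Fintype.card (Gadget d) *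
          #{g | p g ≠ 0}) = Real.log 2 * (Fintype.card (Gadget d) * (d - #R) / d) +
          l * patternEnergy p + (#{g | p g ≠ 0} : ℝ) * (-t) := by
        field_simp
        ring
      rw [this]
      linarith
    refine hterm.trans ?_
    have nn : ∀ (a : ZMod 3) (R S : Finset (Fin d)), 0 ≤ gadgetFactor l R S * ∏ g : Gadget d,
        (if allowed a R S g (p g) then (if p g ≠ 0 then Real.exp (-t) else 1) else 0) :=
      fun a R S => mul_nonneg (gadgetFactor_nonneg _ _ _) (hnn _ _ _ _)
    refine le_trans ?_ (single_le_sum (fun a _ => sum_nonneg fun R _ => sum_nonneg fun S _ =>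
      nn a R S) (mem_univ (p none)))
    refine le_trans ?_ (single_le_sum (fun R _ => sum_nonneg fun S _ =>
      nn (p none) R S) (mem_univ R))
    exact single_le_sum (f := fun S => gadgetFactor l R S * ∏ g : Gadget d,
        (if allowed (p none) R S g (p g) then (if p g ≠ 0 then Real.exp (-t) else 1) else 0))
        (fun S _ => nn (p none) R S) (mem_powerset.2 hSR)
  · rw [patternWeight, if_neg hp, zero_pow hq.ne']
    exact sum_nonneg fun a _ => sum_nonneg fun R _ => sum_nonneg fun S _ =>
      mul_nonneg (gadgetFactor_nonneg _ _ _) (hnn _ _ _ _)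

end

section

open Finset

theorem half_one_add_exp_neg_le {t : ℝ} (h0 : 0 ≤ t) (h1 : t ≤ 1) :
    (1 + Real.exp (-t)) / 2 ≤ Real.exp (-(t / 4)) := by
  set y := Real.exp (-(t / 4)) with hy
  have hy4 : Real.exp (-t) = y ^ 4 := by
    rw [hy, ← Real.exp_nat_mul]; congr 1; push_cast; ring
  have hy1 : y ≤ 1 := Real.exp_le_one_iff.2 (by linarith)
  have hy2 : 3 / 4 ≤ y := by
    have := Real.add_one_le_exp (-(t / 4))
    linarith
  rw [hy4]
  have h3 : (y - 1) * (y ^ 3 + y ^ 2 + y - 1) ≤ 0 := by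
    refine mul_nonpos_of_nonpos_of_nonneg (by linarith) ?_
    have : 0 ≤ y ^ 3 := by positivity
    nlinarith
  nlinarith

open Classical in
/-- Pairs of directions in `R` on the same side of the partition `S`, `R \ S`. -/
noncomputable def sameSidePairs {d : ℕ} (R S : Finset (Fin d)) :
    Finset {x : Fin d × Fin d // x.1 < x.2} :=
  {y | y.1.1 ∈ R ∧ y.1.2 ∈ R ∧ (y.1.1 ∈ S ↔ y.1.2 ∈ S)}

theorem two_mul_card_sameSidePairs {d : ℕ} {R S : Finset (Fin d)} (h : S ⊆ R) :
    2 * #(sameSidePairs R S) + 2 * (#S * (#R - #S)) + #R = #R * #R := by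
  have h1 := two_mul_card_lt S
  have h2 := two_mul_card_lt (R \ S)
  have h3 : #(sameSidePairs R S) = #{x : {x : Fin d × Fin d // x.1 < x.2} | x.1.1 ∈ S ∧ x.1.2 ∈ S} +
      #{x : {x : Fin d × Fin d // x.1 < x.2} | x.1.1 ∈ R \ S ∧ x.1.2 ∈ R \ S} := by
    rw [← card_union_of_disjoint]
    · congr 1
      ext y
      simp only [sameSidePairs, mem_filter, mem_univ, true_and, mem_union, mem_sdiff]
      have := @h y.1.1
      have := @h y.1.2
      tauto
    · rw [disjoint_left]
      intro y
      simp only [mem_filter, mem_univ, true_and, mem_sdiff]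
      tauto
  have h4 : #(R \ S) = #R - #S := card_sdiff_of_subset h
  have h5 : #S ≤ #R := card_le_card h
  rw [h4] at h2
  obtain ⟨k, hk⟩ := Nat.exists_eq_add_of_le h5
  rw [hk] at h2 ⊢
  simp only [Nat.add_sub_cancel_left] at h2 ⊢
  rw [h3]
  rw [hk] at *
  nlinarith

theorem sum_ite_of_iff_eq {α M : Type*} [Fintype α] [AddCommMonoid M] {P : α → Prop}
    [DecidablePred P] (a : α) (h : ∀ x, P x ↔ x = a) (f : α → M) :
    ∑ x, (if P x then f x else 0) = f a := by
  rw [sum_eq_single a]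
  · rw [if_pos ((h a).2 rfl)]
  · intro x _ hx
    rw [if_neg fun hP => hx ((h x).1 hP)]
  · simp

theorem gadgetCount_le {d : ℕ} {t : ℝ} (ht : 0 ≤ t) (a : ZMod 3) (R S : Finset (Fin d)) :
    gadgetCount t a R S ≤ (1 + Real.exp (-t)) ^ #(sameSidePairs R S) := by
  classical
  have hw : ∀ x : ZMod 3, (if x ≠ 0 then Real.exp (-t) else 1) ≤ 1 := by
    intro x
    split_ifs
    · exact Real.exp_le_one_iff.2 (by linarith)
    · exact le_rfl
  have hw0 : ∀ x : ZMod 3, (0:ℝ) ≤ (if x ≠ 0 then Real.exp (-t) else 1) := by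
    intro x
    split_ifs <;> positivity
  have hnn : ∀ g : Gadget d, 0 ≤ ∑ x : ZMod 3,
      if allowed a R S g x then (if x ≠ 0 then Real.exp (-t) else 1) else 0 := fun g =>
    sum_nonneg fun x _ => by
      split_ifs <;> positivity
  have hnone : ∑ x : ZMod 3, (if allowed a R S none x then (if x ≠ 0 then Real.exp (-t) else 1)
      else 0) ≤ 1 := by
    rw [sum_ite_of_iff_eq (P := allowed a R S none) a (fun x => Iff.rfl)]
    exact hw a
  rw [gadgetCount, Fintype.prod_option]
  refine (mul_le_of_le_one_left (prod_nonneg fun y _ => hnn _) hnone).trans ?_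
  rw [← prod_const, sameSidePairs, prod_filter]
  refine prod_le_prod (fun y _ => hnn _) fun y _ => ?_
  split_ifs with hy
  · have hiff : ∀ x, allowed a R S (some y) x ↔ x ≠ (if y.1.1 ∈ S then a + 1 else a + 2) := fun x => by
      rw [allowed, if_pos hy]
    rw [sum_congr rfl fun x _ => if_congr (hiff x) rfl rfl]
    have key : ∀ c : ZMod 3, ∑ x : ZMod 3, (if x ≠ c then (if x ≠ 0 then Real.exp (-t) else 1)
        else 0) ≤ 1 + Real.exp (-t) := by
      intro c
      have he : Real.exp (-t) ≤ 1 := Real.exp_le_one_iff.2 (by linarith)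
      have h3 : ∀ F : ZMod 3 → ℝ, ∑ x : ZMod 3, F x = F 0 + F 1 + F 2 := Fin.sum_univ_three
      have n1 : (1 : ZMod 3) ≠ 0 := by decide
      have n2 : (2 : ZMod 3) ≠ 0 := by decide
      have n12 : (1 : ZMod 3) ≠ 2 := by decide
      rw [h3]
      have hc : c = 0 ∨ c = 1 ∨ c = 2 := by revert c; decide
      rcases hc with rfl | rfl | rfl
      · simp [n1, n2]; linarith
      · simp [n1.symm, n2, n12.symm]
      · simp [n2.symm, n1, n12]
    exact key _
  · rw [sum_ite_of_iff_eq (P := allowed a R S (some y)) a (fun x => by rw [allowed, if_neg hy])]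
    exact hw a

theorem gadgetCount_empty {d : ℕ} (t : ℝ) (a : ZMod 3) :
    gadgetCount (d := d) t a ∅ ∅ =
      (if a ≠ 0 then Real.exp (-t) else 1) ^ Fintype.card (Gadget d) := by
  classical
  rw [gadgetCount, ← card_univ, ← prod_const]
  refine prod_congr rfl fun g _ => ?_
  have : ∀ x, allowed a (∅ : Finset (Fin d)) ∅ g x ↔ x = a := by
    intro x
    rcases g with _ | y
    · exact Iff.rfl
    · simp [allowed]
  rw [sum_ite_of_iff_eq a this]

/-- The number of colorings of a split `R = S ∪ (R \ S)`, in exponential form. -/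
theorem gadget_term_le {d : ℕ} (hd : 0 < d) {t l : ℝ} (h0 : 0 ≤ t) (h1 : t ≤ 1) (a : ZMod 3)
    {R S : Finset (Fin d)} (h : S ⊆ R) (hR : #R ≠ 1) :
    gadgetFactor l R S * gadgetCount t a R S ≤
      2 ^ Fintype.card (Gadget d) * ((2:ℝ) ^ (-((#R : ℝ) * (d - #R) / 2)) *
        ((1 / 2 : ℝ) ^ (#S * (#R - #S)) * (Real.exp (-(t * ((#R : ℝ) * (#R - 2)) / 16)) *
        Real.exp (l * (min #R (d - #R) + if d < 2 * #R ∧ S ≠ ∅ ∧ S ≠ R then 1 else 0 : ℕ))))) := by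
  set M := #(sameSidePairs R S) with hM
  have hM2 := two_mul_card_sameSidePairs h
  rw [← hM] at hM2
  have hsr : #S ≤ #R := card_le_card h
  have hrd : #R ≤ d := (card_le_univ R).trans (by simp)
  have hMr : (2:ℝ) * M + 2 * (#S * (#R - #S)) + #R = #R * #R := by
    have := congrArg (Nat.cast (R := ℝ)) hM2
    push_cast [Nat.cast_sub hsr] at this
    exact this
  have hM4 : (#R : ℝ) * (#R - 2) / 4 ≤ M := by
    nlinarith [sq_nonneg ((#R : ℝ) - 2 * #S)]
  have hq : (2:ℝ) * Fintype.card (Gadget d) + d = d * d + 2 := by exact_mod_cast card_gadget d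
  have hc : gadgetCount t a R S ≤ 2 ^ M * Real.exp (-(t * ((#R : ℝ) * (#R - 2)) / 16)) := by
    refine (gadgetCount_le h0 a R S).trans ?_
    have : (1 + Real.exp (-t)) ^ M = 2 ^ M * ((1 + Real.exp (-t)) / 2) ^ M := by
      rw [← mul_pow]; congr 1; ring
    rw [← hM, this]
    refine mul_le_mul_of_nonneg_left ?_ (by positivity)
    refine (pow_le_pow_left₀ (by positivity) (half_one_add_exp_neg_le h0 h1) M).trans ?_
    rw [← Real.exp_nat_mul, Real.exp_le_exp]
    nlinarith
  rw [gadgetFactor, if_neg hR]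
  set X := Real.exp (l * (min #R (d - #R) + if d < 2 * #R ∧ S ≠ ∅ ∧ S ≠ R then 1 else 0 : ℕ))
  refine (mul_le_mul_of_nonneg_left hc (by positivity)).trans ?_
  set Y := Real.exp (-(t * ((#R : ℝ) * (#R - 2)) / 16))
  have hpow : (2:ℝ) ^ ((Fintype.card (Gadget d) : ℝ) * (d - #R) / d) * 2 ^ M ≤
      2 ^ Fintype.card (Gadget d) * ((2:ℝ) ^ (-((#R : ℝ) * (d - #R) / 2)) *
        (1 / 2 : ℝ) ^ (#S * (#R - #S))) := by
    have e1 : (1 / 2 : ℝ) ^ (#S * (#R - #S)) = (2:ℝ) ^ (-((#S : ℝ) * (#R - #S))) := by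
      rw [Real.rpow_neg two_pos.le, one_div, inv_pow]
      congr 1
      rw [← Real.rpow_natCast]
      push_cast [Nat.cast_sub hsr]
      rfl
    rw [e1, ← Real.rpow_natCast 2 M, ← Real.rpow_natCast 2 (Fintype.card _),
      ← Real.rpow_add two_pos, ← Real.rpow_add two_pos, ← Real.rpow_add two_pos]
    refine Real.rpow_le_rpow_of_exponent_le one_le_two ?_
    have hd' : (0:ℝ) < d := by exact_mod_cast hd
    have e2 : (Fintype.card (Gadget d) : ℝ) * (d - #R) / d =
        Fintype.card (Gadget d) - #R / d - #R * (d - 1) / 2 := by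
      have : (Fintype.card (Gadget d) : ℝ) = (d * d + 2 - d) / 2 := by linarith
      rw [this]
      field_simp
      ring
    rw [e2]
    have : (0:ℝ) ≤ #R / d := by positivity
    nlinarith
  calc _ = ((2:ℝ) ^ ((Fintype.card (Gadget d) : ℝ) * (d - #R) / d) * 2 ^ M) * (Y * X) := by ring
    _ ≤ _ := mul_le_mul_of_nonneg_right hpow (by positivity)
    _ = _ := by ring

theorem sum_split_le {r : ℕ} {α : Type*} [DecidableEq α] (R : Finset α) (hR : #R = r) (hr : 2 ≤ r) :
    ∑ S ∈ R.powerset with S ≠ ∅ ∧ S ≠ R, (1 / 2 : ℝ) ^ (#S * (r - #S)) ≤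
      (4 * r + 16) * (1 / 2) ^ r := by
  have hiff : ∀ S ∈ R.powerset, (S ≠ ∅ ∧ S ≠ R) ↔ (#S ≠ 0 ∧ #S ≠ r) := by
    intro S hS
    rw [mem_powerset] at hS
    rw [Ne, Ne, Ne, card_eq_zero, ← hR]
    refine and_congr Iff.rfl (not_congr ⟨fun h => by rw [h], fun h => eq_of_subset_of_card_le hS h.ge⟩)
  rw [sum_filter, sum_congr rfl fun S hS => if_congr (hiff S hS) rfl rfl]
  rw [sum_powerset_apply_card (fun s => if s ≠ 0 ∧ s ≠ r then (1 / 2 : ℝ) ^ (s * (r - s)) else 0),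
    hR]
  have hle : ∀ s ∈ range (r + 1), r.choose s •
      (if s ≠ 0 ∧ s ≠ r then (1 / 2 : ℝ) ^ (s * (r - s)) else 0) ≤
      (if s = 1 then (r:ℝ) * (2 * (1 / 2) ^ r) else 0) + (if s = r - 1 then (r:ℝ) * (2 * (1 / 2) ^ r) else 0) +
        r.choose s * (16 * ((1 / 2) ^ r * (1 / 2) ^ r)) := by
    intro s hs
    rw [nsmul_eq_mul]
    have hs' : s ≤ r := Nat.lt_succ_iff.1 (mem_range.1 hs)
    have hp1 : (2 : ℝ) * (1 / 2) ^ r = (1 / 2) ^ (r - 1) := by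
      obtain ⟨k, rfl⟩ : ∃ k, r = k + 1 := ⟨r - 1, by omega⟩
      rw [Nat.add_sub_cancel, pow_succ]; ring
    have nn1 : (0:ℝ) ≤ (if s = 1 then (r:ℝ) * (2 * (1 / 2) ^ r) else 0) := by split_ifs <;> positivity
    have nn2 : (0:ℝ) ≤ (if s = r - 1 then (r:ℝ) * (2 * (1 / 2) ^ r) else 0) := by
      split_ifs <;> positivity
    have nn3 : (0:ℝ) ≤ r.choose s * (16 * ((1 / 2) ^ r * (1 / 2) ^ r)) := by positivity
    have nn4 : (0:ℝ) ≤ r * (16 * ((1 / 2) ^ r * (1 / 2) ^ r)) := by positivity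
    split_ifs at nn1 nn2 ⊢ with h1 h2 h3 h4 h5
    all_goals try (simp only [mul_zero]; linarith)
    · subst h2
      rw [Nat.choose_one_right, one_mul, ← hp1]
      linarith
    · subst h2
      rw [Nat.choose_one_right, one_mul, ← hp1]
      linarith
    · have : r.choose s = r := by
        rw [h4, ← Nat.choose_symm (by omega), show r - (r - 1) = 1 by omega, Nat.choose_one_right]
      rw [this, h4, show r - (r - 1) = 1 by omega, mul_one, ← hp1]
      linarith
    · have hk : 2 * r ≤ s * (r - s) + 4 := by
        obtain ⟨k, hk⟩ : ∃ k, s = k + 2 := ⟨s - 2, by omega⟩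
        obtain ⟨m, hm⟩ : ∃ m, r = s + (m + 2) := ⟨r - s - 2, by omega⟩
        rw [hm, Nat.add_sub_cancel_left, hk]
        nlinarith [Nat.zero_le (k * m)]
      have : (1 / 2 : ℝ) ^ (s * (r - s)) ≤ 16 * ((1 / 2) ^ r * (1 / 2) ^ r) := by
        have h16 : (16 : ℝ) * ((1 / 2) ^ r * (1 / 2) ^ r) = 16 * (1 / 2) ^ (2 * r) := by
          rw [two_mul, pow_add]
        have : (1 / 2 : ℝ) ^ (s * (r - s) + 4) ≤ (1 / 2) ^ (2 * r) :=
          pow_le_pow_of_le_one (by norm_num) (by norm_num) hk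
        rw [h16]
        rw [pow_add] at this
        linarith
      have := mul_le_mul_of_nonneg_left this (Nat.cast_nonneg (α := ℝ) (r.choose s))
      linarith
  refine (sum_le_sum hle).trans (le_of_eq ?_)
  rw [sum_add_distrib, sum_add_distrib, sum_ite_eq', sum_ite_eq', if_pos (by simp; omega),
    if_pos (by simp), ← sum_mul]
  have hsum : ∑ s ∈ range (r + 1), (r.choose s : ℝ) = 2 ^ r := by
    exact_mod_cast Nat.sum_range_choose r
  rw [hsum]
  have : (2:ℝ) ^ r * (1 / 2) ^ r = 1 := by rw [← mul_pow]; norm_num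
  linear_combination 16 * (1 / 2) ^ r * this

theorem sum_const_split_le {r : ℕ} {α : Type*} [DecidableEq α] (R : Finset α) :
    ∑ S ∈ R.powerset with ¬ (S ≠ ∅ ∧ S ≠ R), (1 / 2 : ℝ) ^ (#S * (r - #S)) ≤ 2 := by
  have hsub : {S ∈ R.powerset | ¬ (S ≠ ∅ ∧ S ≠ R)} ⊆ {∅, R} := by
    intro S hS
    simp only [mem_filter] at hS
    simp only [mem_insert, mem_singleton]
    tauto
  refine (sum_le_sum_of_subset_of_nonneg hsub fun _ _ _ => by positivity).trans ?_
  calc _ ≤ ∑ S ∈ ({∅, R} : Finset (Finset α)), (1:ℝ) :=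
        sum_le_sum fun S _ => pow_le_one₀ (by norm_num) (by norm_num)
    _ ≤ 2 := by
        rw [sum_const, nsmul_eq_mul, mul_one]
        exact_mod_cast card_le_two

end

section

open Finset

variable {d : ℕ} {y : ℝ}

theorem choose_mul_small_le (hy0 : 0 ≤ y) (H : 4 * d * y ≤ 2 ^ ((d : ℝ) / 4)) {r : ℕ} (hr : 2 ≤ r)
    (hrd : 2 * r ≤ d) : (d.choose r : ℝ) * ((2:ℝ) ^ (-((r : ℝ) * (d - r) / 2)) * y ^ r) ≤
      4 * d ^ 2 * (1 / 2) ^ d * y ^ 2 * (1 / 2) ^ (r - 2) := by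
  obtain ⟨k, rfl⟩ : ∃ k, r = k + 2 := ⟨r - 2, by omega⟩
  have h1 : (d.choose (k + 2) : ℝ) ≤ d ^ (k + 2) := by exact_mod_cast Nat.choose_le_pow _ _
  have h2 : (2:ℝ) ^ (-(((k + 2 : ℕ) : ℝ) * (d - (k + 2 : ℕ)) / 2)) =
      4 * (1 / 2) ^ d * ((2:ℝ) ^ (-(((d:ℝ) - k - 4) / 2))) ^ k := by
    rw [← Real.rpow_natCast (_ ^ _) k, ← Real.rpow_mul two_pos.le, one_div, inv_pow,
      ← Real.rpow_natCast 2 d, ← Real.rpow_neg two_pos.le]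
    have : (4:ℝ) = 2 ^ (2:ℝ) := by norm_num
    rw [this, ← Real.rpow_add two_pos, ← Real.rpow_add two_pos]
    congr 1
    push_cast
    ring
  have h3 : d * y * (2:ℝ) ^ (-(((d:ℝ) - k - 4) / 2)) ≤ 1 / 2 := by
    have hk : ((k:ℝ) + 2) * 2 ≤ d := by exact_mod_cast (by omega : (k + 2) * 2 ≤ d)
    have : (2:ℝ) ^ (-(((d:ℝ) - k - 4) / 2)) ≤ 2 * (2 ^ ((d : ℝ) / 4))⁻¹ := by
      rw [← Real.rpow_neg two_pos.le]
      have e2 : (2:ℝ) * 2 ^ (-((d:ℝ) / 4)) = 2 ^ (1 + -((d:ℝ) / 4)) := by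
        rw [Real.rpow_add two_pos, Real.rpow_one]
      rw [e2]
      exact Real.rpow_le_rpow_of_exponent_le one_le_two (by linarith)
    refine (mul_le_mul_of_nonneg_left this (by positivity)).trans ?_
    have hp : (0:ℝ) < 2 ^ ((d : ℝ) / 4) := by positivity
    rw [← div_eq_mul_inv, mul_div_assoc', div_le_iff₀ hp]
    linarith
  rw [h2, Nat.add_sub_cancel]
  calc _ ≤ (d:ℝ) ^ (k + 2) * (4 * (1 / 2) ^ d * ((2:ℝ) ^ (-(((d:ℝ) - k - 4) / 2))) ^ k * y ^ (k + 2)) :=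
        mul_le_mul_of_nonneg_right h1 (by positivity)
    _ = 4 * d ^ 2 * (1 / 2) ^ d * y ^ 2 * (d * y * (2:ℝ) ^ (-(((d:ℝ) - k - 4) / 2))) ^ k := by
        rw [mul_pow, mul_pow]; ring
    _ ≤ _ := by
        refine mul_le_mul_of_nonneg_left (pow_le_pow_left₀ (by positivity) h3 k) (by positivity)

theorem choose_mul_large_le (hy0 : 0 ≤ y) (H : 4 * d * y ≤ 2 ^ ((d : ℝ) / 4)) {r : ℕ} (hr : r ≤ d)
    (hrd : d < 2 * r) : (d.choose r : ℝ) * ((2:ℝ) ^ (-((r : ℝ) * (d - r) / 2)) * y ^ (d - r)) ≤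
      (1 / 2) ^ (d - r) := by
  obtain ⟨k, hk⟩ : ∃ k, d = r + k := ⟨d - r, by omega⟩
  have hk' : d - r = k := by omega
  have h1 : (d.choose r : ℝ) ≤ d ^ k := by
    rw [← Nat.choose_symm hr, hk']
    exact_mod_cast Nat.choose_le_pow _ _
  have h2 : (2:ℝ) ^ (-((r : ℝ) * (d - r) / 2)) = ((2:ℝ) ^ (-((r:ℝ) / 2))) ^ k := by
    rw [← Real.rpow_natCast (_ ^ _) k, ← Real.rpow_mul two_pos.le]
    congr 1
    rw [hk]; push_cast
    ring
  have h3 : d * y * (2:ℝ) ^ (-((r:ℝ) / 2)) ≤ 1 / 2 := by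
    have hk : (d:ℝ) ≤ 2 * r := by exact_mod_cast hrd.le
    have : (2:ℝ) ^ (-((r:ℝ) / 2)) ≤ (2 ^ ((d : ℝ) / 4))⁻¹ := by
      rw [← Real.rpow_neg two_pos.le]
      exact Real.rpow_le_rpow_of_exponent_le one_le_two (by linarith)
    refine (mul_le_mul_of_nonneg_left this (by positivity)).trans ?_
    have hp : (0:ℝ) < 2 ^ ((d : ℝ) / 4) := by positivity
    rw [← div_eq_mul_inv, div_le_iff₀ hp]
    linarith
  rw [h2, hk']
  calc _ ≤ (d:ℝ) ^ k * (((2:ℝ) ^ (-((r:ℝ) / 2))) ^ k * y ^ k) :=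
        mul_le_mul_of_nonneg_right h1 (by positivity)
    _ = (d * y * (2:ℝ) ^ (-((r:ℝ) / 2))) ^ k := by
        rw [mul_pow, mul_pow]; ring
    _ ≤ _ := pow_le_pow_left₀ (by positivity) h3 k

theorem four_mul_add_le_two_pow (r : ℕ) (hr : 2 ≤ r) : 4 * r + 16 ≤ 6 * 2 ^ r := by
  induction r, hr using Nat.le_induction with
  | base => norm_num
  | succ n hn ih => rw [pow_succ]; omega

variable {t l : ℝ}

theorem sum_powerset_small_le (h0 : 0 ≤ t) (h1 : t ≤ 1) (a : ZMod 3)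
    (R : Finset (Fin d)) (hr : 2 ≤ #R) (hrd : 2 * #R ≤ d) :
    ∑ S ∈ R.powerset, gadgetFactor l R S * gadgetCount t a R S ≤
      2 ^ Fintype.card (Gadget d) *
        (8 * ((2:ℝ) ^ (-((#R : ℝ) * (d - #R) / 2)) * Real.exp l ^ #R)) := by
  set K := (2:ℝ) ^ (-((#R : ℝ) * (d - #R) / 2)) with hK
  have hle : ∀ S ∈ R.powerset, gadgetFactor l R S * gadgetCount t a R S ≤
      2 ^ Fintype.card (Gadget d) * (K * Real.exp l ^ #R) * (1 / 2 : ℝ) ^ (#S * (#R - #S)) := by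
    intro S hS
    refine (gadget_term_le (by omega) h0 h1 a (mem_powerset.1 hS) (by omega)).trans ?_
    have e1 : min #R (d - #R) = #R := min_eq_left (by omega)
    rw [if_neg (by omega), add_zero, e1, mul_comm l, Real.exp_nat_mul, ← hK]
    have hr' : (2:ℝ) ≤ #R := by exact_mod_cast hr
    have : Real.exp (-(t * ((#R : ℝ) * (#R - 2)) / 16)) ≤ 1 := by
      rw [Real.exp_le_one_iff]
      have : 0 ≤ t * ((#R : ℝ) * (#R - 2)) := mul_nonneg h0 (mul_nonneg (by positivity) (by linarith))
      linarith
    calc _ ≤ 2 ^ Fintype.card (Gadget d) * (K * ((1 / 2 : ℝ) ^ (#S * (#R - #S)) *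
          (1 * Real.exp l ^ #R))) := by gcongr
      _ = _ := by ring
  refine (sum_le_sum hle).trans ?_
  rw [← mul_sum, ← sum_filter_add_sum_filter_not _ (fun S => S ≠ ∅ ∧ S ≠ R)]
  have s1 := sum_split_le R rfl hr
  have s2 := sum_const_split_le (r := #R) R
  have s3 : (4 * (#R : ℝ) + 16) * (1 / 2) ^ #R ≤ 6 := by
    have := four_mul_add_le_two_pow _ hr
    have h' : (4 * (#R : ℝ) + 16) ≤ 6 * 2 ^ #R := by exact_mod_cast this
    calc _ ≤ (6 * 2 ^ #R : ℝ) * (1 / 2) ^ #R := mul_le_mul_of_nonneg_right h' (by positivity)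
      _ = 6 := by rw [mul_assoc, ← mul_pow]; norm_num
  have : (0:ℝ) ≤ 2 ^ Fintype.card (Gadget d) * (K * Real.exp l ^ #R) := by positivity
  calc _ ≤ 2 ^ Fintype.card (Gadget d) * (K * Real.exp l ^ #R) * 8 :=
        mul_le_mul_of_nonneg_left (by linarith) this
    _ = _ := by ring

theorem sum_powerset_large_le (hd : 16 ≤ d) (h0 : 0 ≤ t) (h1 : t ≤ 1) (hl : 0 ≤ l)
    (H : 4 * d * Real.exp l ≤ 2 ^ ((d : ℝ) / 4)) (a : ZMod 3)
    (R : Finset (Fin d)) (hrd : d < 2 * #R) :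
    ∑ S ∈ R.powerset, gadgetFactor l R S * gadgetCount t a R S ≤
      2 ^ Fintype.card (Gadget d) * (3 * Real.exp (-(t * d ^ 2 / 100)) *
        ((2:ℝ) ^ (-((#R : ℝ) * (d - #R) / 2)) * Real.exp l ^ (d - #R))) := by
  have hRd : #R ≤ d := (card_le_univ R).trans (by simp)
  have hd' : (16:ℝ) ≤ d := by exact_mod_cast hd
  set K := (2:ℝ) ^ (-((#R : ℝ) * (d - #R) / 2)) with hK
  set X := Real.exp (-(t * d ^ 2 / 100)) with hX
  set y := Real.exp l with hy
  have hy1 : 1 ≤ y := Real.one_le_exp hl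
  have hle : ∀ S ∈ R.powerset, gadgetFactor l R S * gadgetCount t a R S ≤
      2 ^ Fintype.card (Gadget d) * (X * (K * y ^ (d - #R))) *
        ((1 / 2 : ℝ) ^ (#S * (#R - #S)) * if S ≠ ∅ ∧ S ≠ R then y else 1) := by
    intro S hS
    refine (gadget_term_le (by omega) h0 h1 a (mem_powerset.1 hS) (by omega)).trans ?_
    have e1 : min #R (d - #R) = d - #R := min_eq_right (by omega)
    have e2 : Real.exp (l * ((min #R (d - #R) + if d < 2 * #R ∧ S ≠ ∅ ∧ S ≠ R then 1 else 0 : ℕ) : ℝ))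
        = y ^ (d - #R) * if S ≠ ∅ ∧ S ≠ R then y else 1 := by
      rw [e1, mul_comm l, Real.exp_nat_mul, pow_add]
      simp only [hrd, true_and]
      split_ifs <;> simp [hy]
    rw [e2, ← hK]
    have hr' : (d:ℝ) ≤ 2 * #R := by exact_mod_cast hrd.le
    have : Real.exp (-(t * ((#R : ℝ) * (#R - 2)) / 16)) ≤ X := by
      rw [hX, Real.exp_le_exp]
      have h3 : (d:ℝ) ^ 2 / 100 ≤ ((#R : ℝ) * (#R - 2)) / 16 := by nlinarith
      have := mul_le_mul_of_nonneg_left h3 h0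
      linarith
    have hz : 0 ≤ if S ≠ ∅ ∧ S ≠ R then y else 1 := by split_ifs <;> positivity
    calc _ ≤ 2 ^ Fintype.card (Gadget d) * (K * ((1 / 2 : ℝ) ^ (#S * (#R - #S)) *
          (X * (y ^ (d - #R) * if S ≠ ∅ ∧ S ≠ R then y else 1)))) := by gcongr
      _ = _ := by ring
  refine (sum_le_sum hle).trans ?_
  rw [← mul_sum, ← sum_filter_add_sum_filter_not _ (fun S => S ≠ ∅ ∧ S ≠ R)]
  have s1 := sum_split_le R rfl (by omega)
  have s2 := sum_const_split_le (r := #R) R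
  have s1' : ∑ S ∈ R.powerset with S ≠ ∅ ∧ S ≠ R, ((1 / 2 : ℝ) ^ (#S * (#R - #S)) *
      if S ≠ ∅ ∧ S ≠ R then y else 1) ≤ ((4 * (#R : ℝ) + 16) * (1 / 2) ^ #R) * y := by
    refine le_trans (le_of_eq ?_) (mul_le_mul_of_nonneg_right s1 (by positivity))
    rw [sum_mul]
    exact sum_congr rfl fun S hS => by rw [if_pos (mem_filter.1 hS).2]
  have s2' : ∑ S ∈ R.powerset with ¬ (S ≠ ∅ ∧ S ≠ R), ((1 / 2 : ℝ) ^ (#S * (#R - #S)) *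
      if S ≠ ∅ ∧ S ≠ R then y else 1) ≤ 2 := by
    refine le_trans (le_of_eq ?_) s2
    exact sum_congr rfl fun S hS => by rw [if_neg (mem_filter.1 hS).2, mul_one]
  have s3 : ((4 * (#R : ℝ) + 16) * (1 / 2) ^ #R) * y ≤ 1 := by
    have hRd' : (#R : ℝ) ≤ d := by exact_mod_cast hRd
    have b1 : (4 * (#R : ℝ) + 16) ≤ 5 * d := by linarith
    have b2 : ((1:ℝ) / 2) ^ #R ≤ (2 ^ ((d : ℝ) / 4))⁻¹ * (1 / 16) := by
      have : (1:ℝ) / 16 = 2 ^ (-(4:ℝ)) := by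
        rw [Real.rpow_neg two_pos.le]; norm_num
      rw [one_div, inv_pow, ← Real.rpow_natCast 2, ← Real.rpow_neg two_pos.le,
        ← Real.rpow_neg two_pos.le, this, ← Real.rpow_add two_pos]
      refine Real.rpow_le_rpow_of_exponent_le one_le_two ?_
      have hr' : (d:ℝ) ≤ 2 * #R := by exact_mod_cast hrd.le
      linarith
    have hp : (0:ℝ) < 2 ^ ((d : ℝ) / 4) := by positivity
    calc _ ≤ ((5 * d) * ((2 ^ ((d : ℝ) / 4))⁻¹ * (1 / 16))) * y := by gcongr
      _ = (5 / 64) * (4 * d * y) / 2 ^ ((d : ℝ) / 4) := by ring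
      _ ≤ 1 := by
          rw [div_le_one hp]
          linarith
  have : (0:ℝ) ≤ 2 ^ Fintype.card (Gadget d) * (X * (K * y ^ (d - #R))) := by positivity
  calc _ ≤ 2 ^ Fintype.card (Gadget d) * (X * (K * y ^ (d - #R))) * 3 :=
        mul_le_mul_of_nonneg_left (by linarith) this
    _ = _ := by ring

/-- The partition function of the gadget. -/
theorem gadget_partition_le (hd : 16 ≤ d) (h0 : 0 ≤ t) (h1 : t ≤ 1) (hl : 0 ≤ l)
    (H : 4 * d * Real.exp l ≤ 2 ^ ((d : ℝ) / 4)) :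
    ∑ p : Gadget d → ZMod 3, patternWeight p t l ^ Fintype.card (Gadget d) ≤
      2 ^ Fintype.card (Gadget d) * (1 + 200 * d ^ 2 * (1 / 2) ^ d * Real.exp l ^ 2 +
        20 * Real.exp (-(t * d ^ 2 / 100))) := by
  refine (sum_patternWeight_le (by omega) hl).trans ?_
  set q := Fintype.card (Gadget d) with hq
  have hq2 : (2:ℝ) * q + d = d * d + 2 := by exact_mod_cast card_gadget d
  have hd' : (16:ℝ) ≤ d := by exact_mod_cast hd
  set X := Real.exp (-(t * d ^ 2 / 100)) with hX
  set y := Real.exp l with hy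
  have hX0 : 0 < X := Real.exp_pos _
  have hy0 : 0 < y := Real.exp_pos _
  set A := 4 * (d:ℝ) ^ 2 * (1 / 2) ^ d * y ^ 2 with hA
  have hA0 : 0 ≤ A := by positivity
  set w : ZMod 3 → ℝ := fun a => if a ≠ 0 then Real.exp (-t) else 1 with hw
  have hw0 : ∀ a, 0 ≤ w a := fun a => by simp only [hw]; split_ifs <;> positivity
  set B : ZMod 3 → ℕ → ℝ := fun a r => if r = 0 then w a ^ q else if r = 1 then 0 else
    if 2 * r ≤ d then 8 * ((2:ℝ) ^ (-((r : ℝ) * (d - r) / 2)) * y ^ r)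
    else 3 * X * ((2:ℝ) ^ (-((r : ℝ) * (d - r) / 2)) * y ^ (d - r)) with hB
  have hT : ∀ a (R : Finset (Fin d)), ∑ S ∈ R.powerset, gadgetFactor l R S * gadgetCount t a R S ≤
      2 ^ q * B a #R := by
    intro a R
    simp only [hB]
    split_ifs with c1 c2 c3
    · rw [card_eq_zero] at c1
      subst c1
      rw [powerset_empty, sum_singleton, gadgetCount_empty]
      refine le_of_eq ?_
      congr 1
      rw [gadgetFactor]
      have : (d:ℝ) ≠ 0 := by positivity
      simp [this, ← hq]
    · rw [sum_eq_zero]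
      · simp
      · intro S _
        rw [gadgetFactor, if_pos c2, zero_mul]
    · exact sum_powerset_small_le h0 h1 a R (by omega) c3
    · exact sum_powerset_large_le hd h0 h1 hl H a R (by omega)
  have hc : ∀ a, ∀ r ∈ range (d + 1), d.choose r • B a r ≤ (if r = 0 then w a ^ q else 0) +
      (if 2 ≤ r then 8 * A * (1 / 2) ^ (r - 2) else 0) + 3 * X * (1 / 2) ^ (d - r) := by
    intro a r hr
    have hr' : r ≤ d := Nat.lt_succ_iff.1 (mem_range.1 hr)
    have n1 : 0 ≤ 8 * A * (1 / 2) ^ (r - 2) := by positivity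
    have n2 : 0 ≤ 3 * X * (1 / 2) ^ (d - r) := by positivity
    simp only [hB]
    rw [nsmul_eq_mul]
    by_cases c1 : r = 0
    · subst c1
      simp only [if_true, Nat.choose_zero_right, Nat.cast_one, one_mul]
      rw [if_neg (by norm_num)]
      linarith
    rw [if_neg c1, if_neg c1]
    by_cases c2 : r = 1
    · subst c2
      rw [if_pos rfl, if_neg (by norm_num)]
      linarith
    rw [if_neg c2, if_pos (by omega : 2 ≤ r)]
    split_ifs with c3
    · have := choose_mul_small_le hy0.le H (by omega : 2 ≤ r) c3
      rw [← hA] at this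
      linarith
    · have := choose_mul_large_le hy0.le H hr' (by omega)
      have := mul_le_mul_of_nonneg_left this (by positivity : 0 ≤ 3 * X)
      linarith
  have hgeo : ∀ n, ∑ k ∈ range n, ((1:ℝ) / 2) ^ k ≤ 2 := by
    intro n
    have := geom_sum_eq (by norm_num : ((1:ℝ) / 2) ≠ 1) n
    rw [this]
    have : (0:ℝ) < (1 / 2) ^ n := by positivity
    rw [div_le_iff_of_neg (by norm_num)]
    linarith
  have hR : ∀ a, ∑ R : Finset (Fin d), ∑ S ∈ R.powerset, gadgetFactor l R S * gadgetCount t a R S ≤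
      2 ^ q * (w a ^ q + 16 * A + 6 * X) := by
    intro a
    refine (sum_le_sum fun R _ => hT a R).trans ?_
    rw [← mul_sum]
    refine mul_le_mul_of_nonneg_left ?_ (by positivity)
    rw [← powerset_univ, sum_powerset_apply_card (B a), card_univ, Fintype.card_fin]
    refine (sum_le_sum (hc a)).trans ?_
    rw [sum_add_distrib, sum_add_distrib]
    refine add_le_add (add_le_add ?_ ?_) ?_
    · rw [sum_ite_eq', if_pos (by simp)]
    · rw [← sum_filter]
      have : ∑ r ∈ range (d + 1) with 2 ≤ r, 8 * A * ((1:ℝ) / 2) ^ (r - 2) =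
          ∑ k ∈ range (d - 1), 8 * A * ((1:ℝ) / 2) ^ k := by
        refine sum_bij' (fun r _ => r - 2) (fun k _ => k + 2) ?_ ?_ ?_ ?_ ?_
        · intro r hr; simp at hr ⊢; omega
        · intro r hr; simp at hr ⊢; omega
        · intro r hr; simp at hr ⊢; omega
        · intro r hr; simp
        · intro r hr; rfl
      rw [this, ← mul_sum]
      have := mul_le_mul_of_nonneg_left (hgeo (d - 1)) (by positivity : 0 ≤ 8 * A)
      linarith
    · rw [← mul_sum]
      have h2 : ∑ r ∈ range (d + 1), ((1:ℝ) / 2) ^ (d - r) ≤ 2 := by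
        have := sum_range_reflect (fun k => ((1:ℝ) / 2) ^ k) (d + 1)
        simp only [Nat.add_sub_cancel] at this
        rw [this]
        exact hgeo _
      have := mul_le_mul_of_nonneg_left h2 (by positivity : 0 ≤ 3 * X)
      linarith
  refine (sum_le_sum fun a _ => hR a).trans ?_
  rw [← mul_sum]
  refine mul_le_mul_of_nonneg_left ?_ (by positivity)
  rw [sum_add_distrib, sum_add_distrib, sum_const, sum_const, card_univ, ZMod.card]
  have h3 : ∑ a : ZMod 3, w a ^ q = w 0 ^ q + w 1 ^ q + w 2 ^ q := Fin.sum_univ_three _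
  have hwX : Real.exp (-t) ^ q ≤ X := by
    rw [← Real.exp_nat_mul, hX, Real.exp_le_exp]
    have : (d:ℝ) ^ 2 / 100 ≤ q := by nlinarith
    have := mul_le_mul_of_nonneg_left this h0
    linarith
  have e0 : w 0 = 1 := if_neg (by simp)
  have e1 : w 1 = Real.exp (-t) := if_pos (by decide)
  have e2 : w 2 = Real.exp (-t) := if_pos (by decide)
  rw [h3, e0, e1, e2, one_pow, nsmul_eq_mul, nsmul_eq_mul]
  push_cast
  have : 200 * (d:ℝ) ^ 2 * (1 / 2) ^ d * y ^ 2 = 50 * A := by rw [hA]; ring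
  rw [this]
  linarith

end

section

open Finset

/-- Proper 3-colorings of the cube. -/
def IsProper {d : ℕ} (χ : Cube d → ZMod 3) : Prop := ∀ v i, χ (v + dir i) ≠ χ v

/-- The vertices of parity `c` whose neighbourhood is not monochromatic. -/
def nonmono {d : ℕ} (χ : Cube d → ZMod 3) (c : ZMod 2) : Finset (Cube d) :=
  {x | par x = c ∧ ∃ i j, χ (x + dir i) ≠ χ (x + dir j)}

/-- The vertices of parity `c` whose neighbourhood is monochromatic. -/
def mono {d : ℕ} (χ : Cube d → ZMod 3) (c : ZMod 2) : Finset (Cube d) :=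
  {x | par x = c ∧ ∀ i j, χ (x + dir i) = χ (x + dir j)}

/-- The gadget pattern at `u`. -/
def pat {d : ℕ} (χ : Cube d → ZMod 3) (u : Cube d) : Gadget d → ZMod 3 := fun g => χ (u + g.vec)

/-- The even vertices whose color is not `0`. -/
def defects {d : ℕ} (χ : Cube d → ZMod 3) : Finset (Cube d) := {u | par u = 0 ∧ χ u ≠ 0}

/-- The total energy of the even patterns. -/
noncomputable def energy {d : ℕ} (χ : Cube d → ZMod 3) : ℕ :=
  ∑ u with par u = 0, patternEnergy (pat χ u)

section

variable {d : ℕ} (χ : Cube d → ZMod 3)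

theorem pat_idx (u : Cube d) (i j : Fin d) : pat χ u (Gadget.idx i j) = χ (u + dir i + dir j) := by
  rw [pat, Gadget.vec_idx, add_assoc]

theorem pat_none (u : Cube d) : pat χ u none = χ u := by
  simp [pat, Gadget.vec]

theorem mem_nonmonoDirs_pat (u : Cube d) (i : Fin d) :
    i ∈ nonmonoDirs (pat χ u) ↔ u + dir i ∈ nonmono χ (par u + 1) := by
  simp only [nonmonoDirs, nonmono, mem_filter, mem_univ, true_and, par_add_dir, pat_idx, pat_none]
  constructor
  · rintro ⟨j, hj⟩
    exact ⟨j, i, by rwa [add_dir_add_dir]⟩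
  · rintro ⟨j, k, hjk⟩
    by_contra! h
    exact hjk ((h j).trans (h k).symm)

theorem card_nonmonoDirs_pat (u : Cube d) :
    #(nonmonoDirs (pat χ u)) = nbrCount (nonmono χ (par u + 1)) u := by
  rw [nbrCount]
  congr 1
  ext i
  simp [mem_nonmonoDirs_pat]

theorem mem_compl_nonmonoDirs_pat (u : Cube d) (i : Fin d) :
    i ∈ (nonmonoDirs (pat χ u))ᶜ ↔ u + dir i ∈ mono χ (par u + 1) := by
  rw [mem_compl, mem_nonmonoDirs_pat]
  simp [nonmono, mono, par_add_dir]

variable {χ}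

theorem IsProper.admissible (h : IsProper χ) (u : Cube d) : Admissible (pat χ u) := fun i =>
  ⟨χ (u + dir i), fun j => by rw [pat_idx]; exact h _ _⟩

theorem zmod_three_dichotomy (a b : ZMod 3) (h : a ≠ b) : a = b + 1 ∨ a = b + 2 := by
  revert a b; decide

theorem zmod_three_unique (a b x y : ZMod 3) (h : a ≠ b) (hxa : x ≠ a) (hxb : x ≠ b) (hya : y ≠ a)
    (hyb : y ≠ b) : x = y := by
  have key : ∀ a b x y : ZMod 3, a = b ∨ x = a ∨ x = b ∨ y = a ∨ y = b ∨ x = y := by decide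
  have := key a b x y
  tauto

open Classical in
/-- The number of proper colorings with given even part. -/
theorem card_extensions_le (hd : 0 < d) (χ₀ : Cube d → ZMod 3) :
    #{χ : Cube d → ZMod 3 | IsProper χ ∧ ∀ v, par v = 0 → χ v = χ₀ v} ≤ 2 ^ #(mono χ₀ 1) := by
  have i₀ : Fin d := ⟨0, hd⟩
  have hcard : Fintype.card ({x // x ∈ mono χ₀ 1} → Bool) = 2 ^ #(mono χ₀ 1) := by simp
  rw [← hcard, ← card_univ]
  refine card_le_card_of_injOn (fun χ x => decide (χ x.1 = χ₀ (x.1 + dir i₀) + 1))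
    (fun _ _ => mem_coe.2 (mem_univ _)) ?_
  intro χ hχ χ' hχ' h
  simp only [coe_filter, mem_univ, true_and, Set.mem_ofPred_eq] at hχ hχ'
  funext x
  by_cases hx : par x = 0
  · rw [hχ.2 x hx, hχ'.2 x hx]
  have hx1 : par x = 1 := by simpa using (zmod_two_ne_iff _ _).1 hx
  have hnb : ∀ i, par (x + dir i) = 0 := fun i => by rw [par_add_dir, hx1]; rfl
  have hne : ∀ i, χ x ≠ χ₀ (x + dir i) := fun i => by
    rw [← hχ.2 _ (hnb i)]; exact (hχ.1 x i).symm
  have hne' : ∀ i, χ' x ≠ χ₀ (x + dir i) := fun i => by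
    rw [← hχ'.2 _ (hnb i)]; exact (hχ'.1 x i).symm
  by_cases hm : x ∈ mono χ₀ 1
  · have h1 := congrFun h ⟨x, hm⟩
    simp only [decide_eq_decide] at h1
    rcases zmod_three_dichotomy _ _ (hne i₀) with h2 | h2
    · rw [h2, h1.1 h2]
    · rcases zmod_three_dichotomy _ _ (hne' i₀) with h3 | h3
      · rw [h1.2 h3, h3]
      · rw [h2, h3]
  · simp only [mono, mem_filter, mem_univ, true_and, hx1, not_forall] at hm
    obtain ⟨i, j, hij⟩ := hm
    exact zmod_three_unique _ _ _ _ hij (hne i) (hne j) (hne' i) (hne' j)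

theorem Gadget.par_vec (g : Gadget d) : par g.vec = 0 := by
  rcases g with _ | x
  · simp [Gadget.vec, par]
  · simp only [Gadget.vec, par_add, par_dir]; rfl

theorem sum_card_defects : ∑ u : Cube d with par u = 0, #{g | pat χ u g ≠ 0} =
    Fintype.card (Gadget d) * #(defects χ) := by
  simp only [card_filter]
  rw [sum_comm, ← smul_eq_mul, ← card_univ, ← sum_const]
  refine sum_congr rfl fun g _ => ?_
  rw [sum_filter, defects, card_filter, ← Equiv.sum_comp (Equiv.addRight g.vec)]
  refine sum_congr rfl fun u _ => ?_
  simp only [Equiv.coe_addRight, par_add, Gadget.par_vec, add_zero, pat, add_assoc,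
    cube_add_self, ite_and]

theorem sum_card_mono : ∑ u : Cube d with par u = 0, #(nonmonoDirs (pat χ u))ᶜ = d * #(mono χ 1) := by
  have h : ∀ u ∈ (univ : Finset (Cube d)).filter (fun u => par u = 0),
      #(nonmonoDirs (pat χ u))ᶜ = ∑ i, if u + dir i ∈ mono χ 1 then 1 else 0 := by
    intro u hu
    rw [← card_filter]
    congr 1
    ext i
    rw [mem_compl_nonmonoDirs_pat, (mem_filter.1 hu).2, mem_filter]
    simp
  rw [sum_congr rfl h, sum_comm]
  have h2 : ∀ i ∈ (univ : Finset (Fin d)), ∑ u : Cube d with par u = 0,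
      (if u + dir i ∈ mono χ 1 then 1 else 0) = #(mono χ 1) := by
    intro i _
    rw [sum_filter]
    have h3 : ∀ u : Cube d, (if par u = 0 then (if u + dir i ∈ mono χ 1 then 1 else 0) else 0) =
        (fun v => if v ∈ mono χ 1 then 1 else 0) (u + dir i) := by
      intro u
      by_cases hu : par u = 0
      · simp [hu]
      · have : u + dir i ∉ mono χ 1 := by
          simp only [mono, mem_filter, mem_univ, true_and, par_add_dir, not_and]
          intro h'
          exact absurd (by simpa using h') hu
        simp [hu, this]
    rw [sum_congr rfl fun u _ => h3 u]
    exact (sum_add_dir (fun v => if v ∈ mono χ 1 then 1 else 0) i).trans (by simp)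
  rw [sum_congr rfl h2]
  simp

theorem card_par_eq (hd : 0 < d) (c : ZMod 2) : #{v : Cube d | par v = c} = 2 ^ (d - 1) := by
  have h1 : ∀ c, #{v : Cube d | par v = c} = #{v : Cube d | par v = c + 1} := by
    intro c
    rw [card_filter, card_filter, ← sum_add_dir _ (⟨0, hd⟩ : Fin d)]
    refine sum_congr rfl fun v _ => ?_
    simp only [par_add_dir, zmod_two_add_eq_iff]
  have h2 := card_filter_add_card_filter_not (s := (univ : Finset (Cube d))) (fun v => par v = c)
  have h3 : #{v : Cube d | ¬ par v = c} = #{v : Cube d | par v = c + 1} := by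
    congr 1
    ext v
    simp [← zmod_two_ne_iff]
  rw [h3, ← h1, card_univ, card_cube] at h2
  obtain ⟨k, rfl⟩ : ∃ k, d = k + 1 := ⟨d - 1, by omega⟩
  rw [pow_succ] at h2
  simp only [Nat.add_sub_cancel]
  omega

open Classical in
theorem weighted_count_le (hd : 16 ≤ d) {t l : ℝ} (h0 : 0 ≤ t) (h1 : t ≤ 1) (hl : 0 ≤ l)
    (H : 4 * d * Real.exp l ≤ 2 ^ ((d : ℝ) / 4)) :
    ∑ χ : Cube d → ZMod 3 with IsProper χ,
      Real.exp (l / Fintype.card (Gadget d) * energy χ - t * #(defects χ)) ≤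
    2 ^ 2 ^ (d - 1) * Real.exp (2 ^ (d - 1) / Fintype.card (Gadget d) *
      (200 * d ^ 2 * (1 / 2) ^ d * Real.exp l ^ 2 + 20 * Real.exp (-(t * d ^ 2 / 100)))) := by
  set q := Fintype.card (Gadget d) with hq
  have hq0 : (0:ℝ) < q := by exact_mod_cast Fintype.card_pos
  have hd0 : (0:ℝ) < d := by exact_mod_cast (by omega : 0 < d)
  let E := {v : Cube d // par v = 0}
  have hE : Fintype.card E = 2 ^ (d - 1) := by
    rw [Fintype.card_subtype, card_par_eq (by omega)]
  let a : E → Gadget d → E := fun u g => ⟨u.1 + g.vec, by rw [par_add, u.2, g.par_vec, add_zero]⟩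
  have ha : ∀ u, Function.Injective (a u) := fun u g g' h =>
    Gadget.vec_injective (add_left_cancel (congrArg Subtype.val h))
  have hcov : ∀ e, Nat.card {u // ∃ g, a u g = e} = Fintype.card (Gadget d) := by
    intro e
    rw [← Nat.card_eq_fintype_card]
    refine (Nat.card_congr (Equiv.ofBijective (fun g => (⟨a e g, g, ?_⟩ : {u // ∃ g, a u g = e}))
      ⟨?_, ?_⟩)).symm
    · exact Subtype.ext (by simp only [a]; rw [add_assoc, cube_add_self, add_zero])
    · intro g g' h
      exact ha e (congrArg Subtype.val h)
    · rintro ⟨u, g, hg⟩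
      refine ⟨g, Subtype.ext (Subtype.ext ?_)⟩
      have : u.1 + g.vec = e.1 := congrArg Subtype.val hg
      simp only [a]
      rw [← this, add_assoc, cube_add_self, add_zero]
  have F := finner_pattern (C := ZMod 3) a ha hcov (fun p => patternWeight p t l)
    (fun p => patternWeight_nonneg p t l)
  rw [hE, ← hq] at F
  have G := gadget_partition_le hd h0 h1 hl H
  rw [← hq] at G
  set K := 200 * (d:ℝ) ^ 2 * (1 / 2) ^ d * Real.exp l ^ 2 + 20 * Real.exp (-(t * d ^ 2 / 100)) with hK
  have hK0 : 0 ≤ K := by positivity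
  have step1 : (∑ p : Gadget d → ZMod 3, patternWeight p t l ^ q) ^ (((2 ^ (d - 1) : ℕ) : ℝ) / q) ≤
      2 ^ 2 ^ (d - 1) * Real.exp (2 ^ (d - 1) / q * K) := by
    have G' : ∑ p : Gadget d → ZMod 3, patternWeight p t l ^ q ≤ 2 ^ q * Real.exp K := by
      refine G.trans (mul_le_mul_of_nonneg_left ?_ (by positivity))
      have := Real.add_one_le_exp K
      linarith
    refine (Real.rpow_le_rpow (sum_nonneg fun p _ => pow_nonneg (patternWeight_nonneg p t l) _) G'
      (by positivity)).trans (le_of_eq ?_)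
    rw [Real.mul_rpow (by positivity) (by positivity), ← Real.rpow_natCast 2 q,
      ← Real.rpow_mul two_pos.le, ← Real.exp_mul]
    have e1 : (q:ℝ) * (((2 ^ (d - 1) : ℕ) : ℝ) / q) = ((2 ^ (d - 1) : ℕ) : ℝ) := by field_simp
    rw [e1, Real.rpow_natCast]
    congr 2
    push_cast
    ring
  refine le_trans ?_ (F.trans step1)
  rw [← sum_fiberwise_of_maps_to (t := (univ : Finset (E → ZMod 3)))
    (g := fun χ u => χ u.1) (fun _ _ => mem_univ _)]
  refine sum_le_sum fun η _ => ?_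
  have hsum : ∀ f : Cube d → ℝ, ∑ u : E, f u.1 = ∑ u with par u = 0, f u := fun f =>
    (sum_subtype _ (by simp) f).symm
  rcases ({χ ∈ ({χ : Cube d → ZMod 3 | IsProper χ} : Finset _) | (fun u : E => χ u.1) = η} :
    Finset _).eq_empty_or_nonempty with he | ⟨χ₀, hχ₀⟩
  · rw [he, sum_empty]
    exact prod_nonneg fun u _ => patternWeight_nonneg _ _ _
  simp only [mem_filter, mem_univ, true_and] at hχ₀
  have hpat : ∀ χ ∈ ({χ ∈ ({χ : Cube d → ZMod 3 | IsProper χ} : Finset _) |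
      (fun u : E => χ u.1) = η} : Finset _), Real.exp (l / q * energy χ - t * #(defects χ)) =
      Real.exp (l / q * energy χ₀ - t * #(defects χ₀)) := by
    intro χ hχ
    simp only [mem_filter, mem_univ, true_and] at hχ
    have hag : ∀ v, par v = 0 → χ v = χ₀ v := fun v hv =>
      (congrFun hχ.2 ⟨v, hv⟩).trans (congrFun hχ₀.2 ⟨v, hv⟩).symm
    have e1 : energy χ = energy χ₀ := by
      refine sum_congr rfl fun u hu => ?_
      congr 1
      funext g
      exact hag _ (by rw [par_add, (mem_filter.1 hu).2, g.par_vec, add_zero])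
    have e2 : defects χ = defects χ₀ := by
      ext u
      simp only [defects, mem_filter, mem_univ, true_and]
      exact and_congr_right fun hu => by rw [hag u hu]
    rw [e1, e2]
  rw [sum_congr rfl hpat, sum_const, nsmul_eq_mul]
  have hprod : ∏ u : E, patternWeight (η ∘ a u) t l =
      2 ^ #(mono χ₀ 1) * Real.exp (l / q * energy χ₀ - t * #(defects χ₀)) := by
    have e0 : ∀ u : E, η ∘ a u = pat χ₀ u.1 := by
      intro u
      rw [← hχ₀.2]
      rfl
    have e1 : ∀ u : E, patternWeight (η ∘ a u) t l = Real.exp ((fun v : Cube d =>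
        Real.log 2 / d * #(nonmonoDirs (pat χ₀ v))ᶜ + l / q * patternEnergy (pat χ₀ v) -
        t / q * #{g | pat χ₀ v g ≠ 0}) u.1) := by
      intro u
      rw [e0, patternWeight, if_pos (hχ₀.1.admissible _)]
    rw [prod_congr rfl fun u _ => e1 u, ← Real.exp_sum, hsum (fun v : Cube d =>
        Real.log 2 / d * #(nonmonoDirs (pat χ₀ v))ᶜ + l / q * patternEnergy (pat χ₀ v) -
        t / q * #{g | pat χ₀ v g ≠ 0}), sum_sub_distrib, sum_add_distrib,
      ← mul_sum, ← mul_sum, ← mul_sum, ← Nat.cast_sum, ← Nat.cast_sum, ← Nat.cast_sum,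
      sum_card_defects, sum_card_mono, ← energy, ← hq]
    have : (2:ℝ) ^ #(mono χ₀ 1) = Real.exp (#(mono χ₀ 1) * Real.log 2) := by
      rw [Real.exp_nat_mul, Real.exp_log two_pos]
    rw [this, ← Real.exp_add]
    congr 1
    push_cast
    field_simp
    ring
  rw [hprod]
  refine mul_le_mul_of_nonneg_right ?_ (Real.exp_pos _).le
  refine le_trans (Nat.cast_le.2 (card_le_card ?_)) (by
    exact_mod_cast card_extensions_le (by omega) χ₀)
  intro χ hχ
  simp only [mem_filter, mem_univ, true_and] at hχ ⊢
  exact ⟨hχ.1, fun v hv => (congrFun hχ.2 ⟨v, hv⟩).trans (congrFun hχ₀.2 ⟨v, hv⟩).symm⟩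

end

section

open Finset

variable {d : ℕ} (χ : Cube d → ZMod 3)

theorem edgeBoundary_le_energy : edgeBoundary (completion 1 (nonmono χ 1)) ≤ energy χ := by
  rw [edgeBoundary_completion 1 _ fun v hv => (mem_filter.1 hv).2.1, energy]
  refine sum_le_sum fun u hu => ?_
  have hu0 : par u = 0 := (mem_filter.1 hu).2
  rw [patternEnergy, card_nonmonoDirs_pat, hu0, zero_add]
  exact Nat.le_add_right _ _

open Classical in
theorem card_mixed_le_energy : #{u | par u = 0 ∧ Mixed (pat χ u)} ≤ energy χ := by
  rw [energy, ← filter_filter, card_filter]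
  exact sum_le_sum fun u _ => Nat.le_add_left _ _

theorem mem_completion_of_par {c : ZMod 2} {X : Finset (Cube d)} {u : Cube d} (hu : par u = c) :
    u ∈ completion c X ↔ u ∈ X := by
  have : c ≠ c + 1 := (zmod_two_add_one_ne c).symm
  simp [completion, hu, this]

variable {χ}

theorem IsProper.notMem_nonmono (h : IsProper χ) {u : Cube d} (hu : par u = 0)
    (hm : ¬ Mixed (pat χ u)) (hall : ∀ i, u + dir i ∈ nonmono χ 1) : u ∉ nonmono χ 0 := by
  intro hu'
  obtain ⟨-, i, j, hij⟩ := (mem_filter.1 hu').2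
  have hd : 0 < d := i.pos
  have hmem : ∀ i, i ∈ nonmonoDirs (pat χ u) := fun i => by
    rw [mem_nonmonoDirs_pat, hu, zero_add]; exact hall i
  have hcard : #(nonmonoDirs (pat χ u)) = d := by
    rw [eq_univ_of_forall hmem, card_univ, Fintype.card_fin]
  rw [Mixed, hcard, not_and, not_forall] at hm
  obtain ⟨c, hc⟩ := hm (by omega)
  push Not at hc
  have key : ∀ i, χ (u + dir i) = c := by
    intro i
    obtain ⟨-, j, k, hjk⟩ := (mem_filter.1 (hall i)).2
    have h1 := hc i (hmem i) j
    have h2 := hc i (hmem i) k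
    rw [pat_idx] at h1 h2
    exact zmod_three_unique _ _ _ _ hjk (h _ j).symm (h _ k).symm h1.symm h2.symm
  exact hij ((key i).trans (key j).symm)

theorem IsProper.card_nonmono_zero_le (h : IsProper χ) :
    #(nonmono χ 0) ≤ d * #(completion 1 (nonmono χ 1))ᶜ + energy χ := by
  classical
  have hsub : nonmono χ 0 ⊆
      ((univ : Finset (Fin d)) ×ˢ (completion 1 (nonmono χ 1))ᶜ).image (fun p => p.2 + dir p.1) ∪
        ({u | par u = 0 ∧ Mixed (pat χ u)} : Finset _) := by
    intro u hu
    have hu0 : par u = 0 := (mem_filter.1 hu).2.1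
    by_cases hm : Mixed (pat χ u)
    · exact mem_union_right _ (mem_filter.2 ⟨mem_univ _, hu0, hm⟩)
    · by_cases hall : ∀ i, u + dir i ∈ nonmono χ 1
      · exact absurd hu (h.notMem_nonmono hu0 hm hall)
      · push Not at hall
        obtain ⟨i, hi⟩ := hall
        refine mem_union_left _ (mem_image.2 ⟨(i, u + dir i), ?_, add_dir_add_dir u i⟩)
        simp only [mem_product, mem_univ, true_and, mem_compl]
        rwa [mem_completion_of_par (by rw [par_add_dir, hu0, zero_add])]
  refine (card_le_card hsub).trans ((card_union_le _ _).trans (add_le_add ?_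
    (card_mixed_le_energy χ)))
  exact card_image_le.trans (by simp)

theorem two_mul_edgeBoundary_le (p : ZMod 3 → Prop) [DecidablePred p] :
    2 * edgeBoundary (completion 0 ({u | par u = 0 ∧ p (χ u)} : Finset (Cube d))) ≤
      d * #(nonmono χ 1) := by
  rw [edgeBoundary_completion 0 _ fun v hv => (mem_filter.1 hv).2.1, mul_sum, zero_add]
  calc _ ≤ ∑ x with par x = 1, if x ∈ nonmono χ 1 then d else 0 := by
        refine sum_le_sum fun x hx => ?_
        have hx1 : par x = 1 := (mem_filter.1 hx).2
        split_ifs with hm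
        · omega
        · have hmono : ∀ i j, χ (x + dir i) = χ (x + dir j) := by
            by_contra! hcon
            exact hm (mem_filter.2 ⟨mem_univ _, hx1, hcon⟩)
          have hpar : ∀ i, par (x + dir i) = 0 := fun i => by rw [par_add_dir, hx1]; rfl
          rw [nbrCount]
          by_cases hex : ∃ i, p (χ (x + dir i))
          · obtain ⟨i, hi⟩ := hex
            rw [filter_true_of_mem fun j _ => by
              simpa [hpar j] using (hmono i j) ▸ hi]
            simp
          · push Not at hex
            rw [filter_false_of_mem fun j _ => by simp [hex j]]
            simp
    _ ≤ ∑ x, if x ∈ nonmono χ 1 then d else 0 :=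
        sum_le_sum_of_subset (filter_subset _ _)
    _ = d * #(nonmono χ 1) := by simp [mul_comm]

theorem card_le_of_edgeBoundary_le {S : Finset (Cube d)} {δ : ℝ} (hS : 2 * #S ≤ 2 ^ d)
    (h : edgeBoundary S ≤ δ * 2 ^ d) : #S ≤ 2 * δ * 2 ^ d := by
  have h1 := isoProfile_le_edgeBoundary S
  rcases Nat.eq_zero_or_pos #S with h0 | h0
  · have : (0:ℝ) ≤ edgeBoundary S := Nat.cast_nonneg _
    rw [h0, Nat.cast_zero]; nlinarith
  have h0' : (0:ℝ) < #S := by exact_mod_cast h0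
  have hS' : 2 * (#S:ℝ) ≤ 2 ^ d := by exact_mod_cast hS
  have h2 : Real.log 2 ≤ Real.log (2 ^ d / #S) :=
    Real.log_le_log two_pos (by rw [le_div_iff₀ h0']; linarith)
  have h3 := Real.log_two_gt_d9
  rw [isoProfile] at h1
  nlinarith

theorem card_le_of_edgeBoundary_le_div {S : Finset (Cube d)} {C ε : ℝ} (hC : 0 < C) (hε : 0 < ε)
    (hS : 2 * #S ≤ 2 ^ d) (h : edgeBoundary S ≤ C * 2 ^ d / d)
    (hd : 2 * C * Real.exp (C / ε) ≤ d) : #S ≤ ε * 2 ^ d / d := by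
  have hd0 : (0:ℝ) < d := lt_of_lt_of_le (by positivity) hd
  have h1 := isoProfile_le_edgeBoundary S
  have h2 := card_le_of_edgeBoundary_le (δ := C / d) hS (by rw [div_mul_eq_mul_div]; exact h)
  rcases Nat.eq_zero_or_pos #S with h0 | h0
  · rw [h0, Nat.cast_zero]; positivity
  have h0' : (0:ℝ) < #S := by exact_mod_cast h0
  have h3 : C / ε ≤ Real.log (2 ^ d / #S) := by
    rw [Real.le_log_iff_exp_le (by positivity), le_div_iff₀ h0']
    calc Real.exp (C / ε) * #S ≤ Real.exp (C / ε) * (2 * (C / d) * 2 ^ d) := by gcongr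
      _ = (2 * C * Real.exp (C / ε)) / d * 2 ^ d := by ring
      _ ≤ 1 * 2 ^ d := by gcongr; exact (div_le_one hd0).2 hd
      _ = _ := one_mul _
  rw [isoProfile] at h1
  have h4 : #S * (C / ε) ≤ C * 2 ^ d / d :=
    ((mul_le_mul_of_nonneg_left h3 h0'.le).trans h1).trans h
  have h5 : (#S : ℝ) = #S * (C / ε) * (ε / C) := by field_simp
  rw [h5]
  calc _ ≤ C * 2 ^ d / d * (ε / C) := by gcongr
    _ = _ := by field_simp

end

section

open Finset

variable {d : ℕ}

/-- The neighbourhood of a set of vertices. -/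
def nbhd (D : Finset (Cube d)) : Finset (Cube d) := {x | ∃ i, x + dir i ∈ D}

theorem mem_nbhd {D : Finset (Cube d)} {x : Cube d} : x ∈ nbhd D ↔ ∃ i, x + dir i ∈ D := by
  simp [nbhd]

theorem nbhd_mono {D D' : Finset (Cube d)} (h : D ⊆ D') : nbhd D ⊆ nbhd D' := fun x hx => by
  obtain ⟨i, hi⟩ := mem_nbhd.1 hx
  exact mem_nbhd.2 ⟨i, h hi⟩

theorem card_dir_add_eq_le_two {z : Cube d} (hz : z ≠ 0) : #{i : Fin d | ∃ j, dir i + dir j = z} ≤ 2 := by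
  rcases ({i : Fin d | ∃ j, dir i + dir j = z} : Finset (Fin d)).eq_empty_or_nonempty with h | ⟨i, hi⟩
  · simp [h]
  obtain ⟨j, hj⟩ := (mem_filter.1 hi).2
  have hij : i ≠ j := by
    rintro rfl
    exact hz (by rw [← hj, cube_add_self])
  refine (card_le_card (t := {i, j}) fun i' hi' => ?_).trans card_le_two
  obtain ⟨j', hj'⟩ := (mem_filter.1 hi').2
  have hij' : i' ≠ j' := by
    rintro rfl
    exact hz (by rw [← hj', cube_add_self])
  have h1 := (dir_add_dir_apply i' j' i' hij').2 (Or.inl rfl)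
  rw [hj', ← hj] at h1
  simpa using (dir_add_dir_apply i j i' hij).1 h1

/-- The elements of `D` at distance two from `v`. -/
def nearby (D : Finset (Cube d)) (v : Cube d) : Finset (Cube d) :=
  {w ∈ D | ∃ i j, v + dir i + dir j = w}

theorem card_nbhd_insert {D : Finset (Cube d)} {v : Cube d} (hv : v ∉ D) :
    #(nbhd D) + d ≤ #(nbhd (insert v D)) + 2 * #(nearby D v) := by
  set B : Finset (Cube d) := univ.image fun i => v + dir i with hB
  have hBc : #B = d := by
    rw [hB, card_image_of_injective _ fun i j h => dir_injective (add_left_cancel h), card_univ,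
      Fintype.card_fin]
  have hun : nbhd D ∪ B ⊆ nbhd (insert v D) := by
    refine union_subset (nbhd_mono (subset_insert _ _)) fun x hx => ?_
    obtain ⟨i, -, rfl⟩ := mem_image.1 hx
    exact mem_nbhd.2 ⟨i, by rw [add_dir_add_dir]; exact mem_insert_self _ _⟩
  have h_int : #(nbhd D ∩ B) ≤ 2 * #(nearby D v) := by
    have hsub : nbhd D ∩ B ⊆ (nearby D v).biUnion fun w =>
        ({i : Fin d | ∃ j, dir i + dir j = v + w} : Finset (Fin d)).image fun i => v + dir i := by
      intro x hx
      obtain ⟨h1, h2⟩ := mem_inter.1 hx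
      obtain ⟨i, -, rfl⟩ := mem_image.1 h2
      obtain ⟨j, hj⟩ := mem_nbhd.1 h1
      refine mem_biUnion.2 ⟨_, mem_filter.2 ⟨hj, i, j, rfl⟩, mem_image.2 ⟨i, ?_, rfl⟩⟩
      refine mem_filter.2 ⟨mem_univ _, j, ?_⟩
      rw [add_assoc, ← add_assoc, cube_add_self, zero_add]
    refine (card_le_card hsub).trans (card_biUnion_le.trans ?_)
    rw [mul_comm, ← smul_eq_mul]
    refine sum_le_card_nsmul _ _ _ fun w hw => card_image_le.trans (card_dir_add_eq_le_two ?_)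
    intro h0
    have : v = w := by
      have := congrArg (v + ·) h0
      simpa [← add_assoc, cube_add_self] using this.symm
    exact hv (this ▸ (mem_filter.1 hw).1)
  have h1 := card_union_add_card_inter (nbhd D) B
  have h2 := card_le_card hun
  omega

theorem card_mul_le_card_nbhd (D : Finset (Cube d)) : #D * (d + 1) ≤ #(nbhd D) + #D * #D := by
  induction D using Finset.induction_on with
  | empty => simp
  | insert v D hv ih =>
    have h1 := card_nbhd_insert hv
    have h2 : #(nearby D v) ≤ #D := card_filter_le _ _
    rw [card_insert_of_notMem hv]
    nlinarith

theorem card_forall_mem_le (hd : 0 < d) (D : Finset (Cube d)) :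
    #{x : Cube d | ∀ i, x + dir i ∈ D} ≤ #D := by
  refine Nat.le_of_mul_le_mul_left ?_ hd
  rw [← sum_nbrCount D, mul_comm]
  calc _ = ∑ x with ∀ i, x + dir i ∈ D, d := by rw [sum_const, smul_eq_mul]
    _ ≤ ∑ x with ∀ i, x + dir i ∈ D, nbrCount D x := by
        refine sum_le_sum fun x hx => ?_
        have := (mem_filter.1 hx).2
        simp [nbrCount, this]
    _ ≤ _ := sum_le_sum_of_subset (subset_univ _)

theorem card_nbhd_defects_le (hd : 0 < d) (χ : Cube d → ZMod 3) :
    #(nbhd (defects χ)) ≤ #(nonmono χ 1) + #(defects χ) := by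
  refine (card_le_card (t := nonmono χ 1 ∪
    ({x : Cube d | ∀ i, x + dir i ∈ defects χ} : Finset _))
    fun x hx => ?_).trans ((card_union_le _ _).trans
      (Nat.add_le_add_left (card_forall_mem_le hd _) _))
  obtain ⟨i, hi⟩ := mem_nbhd.1 hx
  by_cases h : ∀ j, x + dir j ∈ defects χ
  · exact mem_union_right _ (by simpa using h)
  · push Not at h
    obtain ⟨j, hj⟩ := h
    simp only [defects, mem_filter, mem_univ, true_and, par_add_dir, zmod_two_add_eq_iff,
      zero_add] at hi hj
    refine mem_union_left _ (mem_filter.2 ⟨mem_univ _, hi.1, i, j, fun h => ?_⟩)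
    exact hj ⟨hi.1, h ▸ hi.2⟩

theorem isoProfile_le_energy {χ : Cube d → ZMod 3}
    (hP : 4 * #(completion 1 (nonmono χ 1)) ≤ 2 ^ d) {x : ℝ} (hx : 0 ≤ x) (hxb : x ≤ #(nonmono χ 1)) :
    isoProfile d x ≤ energy χ := by
  have h1 : (#(nonmono χ 1) : ℝ) ≤ #(completion 1 (nonmono χ 1)) :=
    Nat.cast_le.2 (card_le_card (subset_completion _ _))
  refine (isoProfile_mono hx (hxb.trans h1) (by exact_mod_cast hP)).trans
    ((isoProfile_le_edgeBoundary _).trans (Nat.cast_le.2 (edgeBoundary_le_energy χ)))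

theorem isoProfile_defects_le (hd : 0 < d) {χ : Cube d → ZMod 3} (hD : 12 * #(defects χ) ≤ 2 ^ d) :
    2 / d * isoProfile d #(defects χ) ≤ #(nonmono χ 1) := by
  have hd0 : (0:ℝ) < d := by exact_mod_cast hd
  have h1 : (2 * edgeBoundary (completion 0 (defects χ)) : ℝ) ≤ d * #(nonmono χ 1) := by
    exact_mod_cast two_mul_edgeBoundary_le (χ := χ) (fun c => c ≠ 0)
  have h2 : (#(defects χ) : ℝ) ≤ #(completion 0 (defects χ)) :=
    Nat.cast_le.2 (card_le_card (subset_completion _ _))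
  have h3 := card_completion_le hd 0 (defects χ)
  have h4 : 4 * (#(completion 0 (defects χ)) : ℝ) ≤ 2 ^ d := by
    exact_mod_cast (by omega : 4 * #(completion 0 (defects χ)) ≤ 2 ^ d)
  have h5 := (isoProfile_mono (Nat.cast_nonneg _) h2 h4).trans (isoProfile_le_edgeBoundary _)
  rw [div_mul_eq_mul_div, div_le_iff₀ hd0]
  linarith

theorem sq_log_le_energy (hd : 0 < d) {χ : Cube d → ZMod 3}
    (hP : 4 * #(completion 1 (nonmono χ 1)) ≤ 2 ^ d) (hD0 : 0 < #(defects χ))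
    (hD : 12 * #(defects χ) ≤ 2 ^ d) :
    (#(defects χ) : ℝ) * Real.log (2 ^ d / #(defects χ)) ^ 2 / d ≤ energy χ := by
  have hd0 : (0:ℝ) < d := by exact_mod_cast hd
  have hb := isoProfile_defects_le hd hD
  have hm1 : (1:ℝ) ≤ #(defects χ) := by exact_mod_cast hD0
  have hmu : 12 * (#(defects χ) : ℝ) ≤ 2 ^ d := by exact_mod_cast hD
  set m : ℝ := ((#(defects χ) : ℕ) : ℝ) with hm
  have hm0 : 0 < m := by linarith
  have hlog2 := Real.log_two_lt_d9
  have hlog2' := Real.log_two_gt_d9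
  set l := Real.log (2 ^ d / m) with hl
  have hl1 : 2 * Real.log 2 ≤ l := by
    rw [hl, ← Real.log_rpow two_pos]
    exact Real.log_le_log (by positivity) (by rw [le_div_iff₀ hm0]; norm_num; linarith)
  have hl2 : l ≤ d * Real.log 2 := by
    rw [hl, ← Real.log_pow]
    exact Real.log_le_log (by positivity) (div_le_self (by positivity) hm1)
  have hl0 : 0 < l := by linarith
  have hld : l ≤ d := by nlinarith
  have key := isoProfile_le_energy hP (x := 2 / d * isoProfile d m)
    (mul_nonneg (by positivity) (isoProfile_nonneg hm0.le (by linarith))) hb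
  refine le_trans ?_ key
  have e1 : (2:ℝ) / d * isoProfile d m = 2 * m * l / d := by rw [isoProfile, ← hl]; ring
  rw [e1, isoProfile]
  have h6 : l / 2 ≤ Real.log (2 ^ d / (2 * m * l / d)) := by
    have e2 : (2:ℝ) ^ d / (2 * m * l / d) = (2 ^ d / m) * (d / (2 * l)) := by
      field_simp
    rw [e2, Real.log_mul (by positivity) (by positivity), ← hl]
    have : Real.log (1 / 2) ≤ Real.log (d / (2 * l)) :=
      Real.log_le_log (by norm_num) (by rw [div_le_div_iff₀ two_pos (by positivity)]; linarith)
    rw [one_div, Real.log_inv] at this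
    linarith
  calc m * l ^ 2 / d = 2 * m * l / d * (l / 2) := by ring
    _ ≤ _ := mul_le_mul_of_nonneg_left h6 (by positivity)

end

section

open Finset

variable {d : ℕ}

open Classical in
theorem card_le_of_energy (hd : 16 ≤ d) {t l T G₀ : ℝ} (h0 : 0 ≤ t) (h1 : t ≤ 1) (hl : 0 ≤ l)
    (H : 4 * d * Real.exp l ≤ 2 ^ ((d : ℝ) / 4)) (hG₀ : 0 ≤ G₀) (S : Finset (Cube d → ZMod 3))
    (hS : ∀ χ ∈ S, IsProper χ ∧ G₀ ≤ energy χ ∧ t * #(defects χ) ≤ T) :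
    (#S : ℝ) ≤ 2 ^ 2 ^ (d - 1) * Real.exp (T - 2 * l * G₀ / d ^ 2 + 400 * Real.exp l ^ 2 +
      40 * 2 ^ d / d ^ 2 * Real.exp (-(t * d ^ 2 / 100))) := by
  have key := weighted_count_le hd h0 h1 hl H
  set q := Fintype.card (Gadget d) with hq
  have hcard : (2 * q + d : ℝ) = d * d + 2 := by exact_mod_cast card_gadget (d := d)
  have hd' : (16:ℝ) ≤ d := by exact_mod_cast hd
  have hd0 : (0:ℝ) < d := by linarith
  have hq0 : (0:ℝ) < q := by exact_mod_cast Fintype.card_pos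
  have hq1 : (d:ℝ) ^ 2 / 4 ≤ q := by nlinarith
  have hq2 : (q:ℝ) ≤ d ^ 2 / 2 := by nlinarith
  have e1 : (#S : ℝ) * Real.exp (l / q * G₀ - T) ≤
      ∑ χ : Cube d → ZMod 3 with IsProper χ, Real.exp (l / q * energy χ - t * #(defects χ)) := by
    rw [← nsmul_eq_mul, ← sum_const]
    calc _ ≤ ∑ χ ∈ S, Real.exp (l / q * energy χ - t * #(defects χ)) := by
          refine sum_le_sum fun χ hχ => Real.exp_le_exp.2 ?_
          obtain ⟨-, h2, h3⟩ := hS χ hχ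
          have : l / q * G₀ ≤ l / q * energy χ := mul_le_mul_of_nonneg_left h2 (by positivity)
          linarith
      _ ≤ _ := sum_le_sum_of_subset_of_nonneg
          (fun χ hχ => mem_filter.2 ⟨mem_univ _, (hS χ hχ).1⟩) fun _ _ _ => (Real.exp_pos _).le
  have e2 := e1.trans key
  rw [← le_div_iff₀ (Real.exp_pos _), mul_div_assoc, ← Real.exp_sub] at e2
  refine e2.trans (mul_le_mul_of_nonneg_left (Real.exp_le_exp.2 ?_) (by positivity))
  have e3 : 2 * l * G₀ / d ^ 2 ≤ l / q * G₀ := by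
    rw [div_mul_eq_mul_div, div_le_div_iff₀ (by positivity) hq0]
    have : 0 ≤ l * G₀ := by positivity
    nlinarith
  have e4 : (2:ℝ) ^ (d - 1) / q ≤ 2 * 2 ^ d / d ^ 2 := by
    have : (2:ℝ) ^ d = 2 * 2 ^ (d - 1) := by
      rw [← pow_succ', Nat.sub_add_cancel (by omega)]
    rw [this, div_le_div_iff₀ hq0 (by positivity)]
    have : (0:ℝ) < 2 ^ (d - 1) := by positivity
    nlinarith
  have e5 : (2:ℝ) ^ (d - 1) / q * (200 * d ^ 2 * (1 / 2) ^ d * Real.exp l ^ 2 +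
      20 * Real.exp (-(t * d ^ 2 / 100))) ≤ 2 * 2 ^ d / d ^ 2 * (200 * d ^ 2 * (1 / 2) ^ d *
      Real.exp l ^ 2 + 20 * Real.exp (-(t * d ^ 2 / 100))) :=
    mul_le_mul_of_nonneg_right e4 (by positivity)
  have e6 : 2 * 2 ^ d / d ^ 2 * (200 * d ^ 2 * (1 / 2) ^ d * Real.exp l ^ 2 +
      20 * Real.exp (-(t * d ^ 2 / 100))) = 400 * Real.exp l ^ 2 +
      40 * 2 ^ d / d ^ 2 * Real.exp (-(t * d ^ 2 / 100)) := by
    have : (2:ℝ) ^ d * (1 / 2) ^ d = 1 := by rw [← mul_pow]; norm_num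
    calc _ = 400 * (2 ^ d * (1 / 2) ^ d) * Real.exp l ^ 2 * (d ^ 2 / d ^ 2) +
          40 * 2 ^ d / d ^ 2 * Real.exp (-(t * d ^ 2 / 100)) := by ring
      _ = _ := by rw [this, div_self (by positivity)]; ring
  linarith

theorem exp_scaled (d : ℕ) : Real.exp (d * Real.log 2 / 40) = 2 ^ ((d:ℝ) / 40) := by
  rw [Real.rpow_def_of_pos two_pos]; ring_nf

theorem exp_scaled_sq (d : ℕ) : Real.exp (d * Real.log 2 / 40) ^ 2 = 2 ^ ((d:ℝ) / 20) := by
  rw [exp_scaled, ← Real.rpow_natCast, ← Real.rpow_mul two_pos.le]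
  congr 1
  push_cast
  ring

open Classical in
theorem card_large_energy_le (hd : 16 ≤ d) (H : 4 * d * (2:ℝ) ^ ((d:ℝ) / 40) ≤ 2 ^ ((d : ℝ) / 4))
    (H2 : 400 * (2:ℝ) ^ ((d:ℝ) / 20) + 2 * d ≤ 2 ^ d / d ^ 2) :
    (#{χ : Cube d → ZMod 3 | IsProper χ ∧ 2000 * 2 ^ d / d ≤ (energy χ : ℝ)} : ℝ) ≤
      2 ^ 2 ^ (d - 1) * Real.exp (-(2 * d)) := by
  have hd0 : (0:ℝ) < d := by exact_mod_cast (by omega : 0 < d)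
  have hlog := Real.log_two_gt_d9
  refine (card_le_of_energy hd (t := 0) (l := d * Real.log 2 / 40) (T := 0)
    (G₀ := 2000 * 2 ^ d / d) le_rfl zero_le_one (by positivity) (by rwa [exp_scaled])
    (by positivity) _ ?_).trans (mul_le_mul_of_nonneg_left (Real.exp_le_exp.2 ?_) (by positivity))
  · intro χ hχ
    obtain ⟨h1, h2⟩ := (mem_filter.1 hχ).2
    exact ⟨h1, h2, by simp⟩
  · rw [exp_scaled_sq]
    have e1 : 2 * (d * Real.log 2 / 40) * (2000 * 2 ^ d / d) / d ^ 2 =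
        100 * Real.log 2 * (2 ^ d / d ^ 2) := by field_simp; ring
    have e2 : 40 * 2 ^ d / d ^ 2 * Real.exp (-(0 * (d:ℝ) ^ 2 / 100)) = 40 * (2 ^ d / d ^ 2) := by
      simp; ring
    rw [e1, e2]
    have : (0:ℝ) < 2 ^ d / d ^ 2 := by positivity
    nlinarith

theorem sq_le_card_nonmono {χ : Cube d → ZMod 3} (hd : 16 ≤ d) (h1 : d < 8 * #(defects χ))
    (h2 : 100 * #(defects χ) ≤ d ^ 2) : (d:ℝ) ^ 2 / 25 ≤ #(nonmono χ 1) := by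
  obtain ⟨D', hD', hk⟩ := exists_subset_card_eq (s := defects χ) (n := d / 8) (by omega)
  have a1 := card_mul_le_card_nbhd D'
  have a2 := card_le_card (nbhd_mono hD')
  have a3 := card_nbhd_defects_le (by omega) χ
  rw [hk] at a1
  have a4 : d / 8 * (d + 1) ≤ #(nonmono χ 1) + #(defects χ) + d / 8 * (d / 8) := by omega
  have b1 : (((d / 8 : ℕ) : ℝ)) * (d + 1) ≤ #(nonmono χ 1) + #(defects χ) +
      ((d / 8 : ℕ) : ℝ) * ((d / 8 : ℕ) : ℝ) := by exact_mod_cast a4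
  have b2 : 8 * ((d / 8 : ℕ) : ℝ) ≤ d := by exact_mod_cast Nat.mul_div_le d 8
  have b3 : (d:ℝ) ≤ 8 * ((d / 8 : ℕ) : ℝ) + 7 := by exact_mod_cast (by omega : d ≤ 8 * (d / 8) + 7)
  have b4 : 100 * (#(defects χ) : ℝ) ≤ d ^ 2 := by exact_mod_cast h2
  have b5 : (16:ℝ) ≤ d := by exact_mod_cast hd
  set k : ℝ := ((d / 8 : ℕ) : ℝ)
  have : 0 ≤ (k - (d - 7) / 8) * (7 / 8 * d) := mul_nonneg (by linarith) (by linarith)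
  nlinarith

open Classical in
theorem card_medium_le {m : ℕ} (hd : 1000 ≤ d) (H : 4 * d * (2:ℝ) ^ ((d:ℝ) / 40) ≤ 2 ^ ((d : ℝ) / 4))
    (H2 : 400 * (2:ℝ) ^ ((d:ℝ) / 20) + 2 * d ≤ 2 ^ ((d:ℝ) / 10) / d ^ 2)
    (H3 : 4 * d * Real.exp 1000 ≤ 2 ^ ((d : ℝ) / 4)) (H4 : 400 * Real.exp 1000 ^ 2 ≤ d)
    (H5 : d ^ 2 * Real.exp (d / 4) ≤ 2 ^ d) (hm : d < 8 * m)
    (hm2 : m * Real.exp 20000 ≤ 2 ^ d) :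
    (#{χ : Cube d → ZMod 3 | IsProper χ ∧ 4 * #(completion 1 (nonmono χ 1)) ≤ 2 ^ d ∧
      #(defects χ) = m} : ℝ) ≤ 2 ^ 2 ^ (d - 1) * Real.exp (-(2 * d)) := by
  have hd0 : (1000:ℝ) ≤ d := by exact_mod_cast hd
  have hd1 : (0:ℝ) < d := by linarith
  have hlog := Real.log_two_gt_d9
  have hlog' := Real.log_two_lt_d9
  have hm1 : (1:ℝ) ≤ m := by exact_mod_cast (by omega : 1 ≤ m)
  have hm0 : (0:ℝ) < m := by linarith
  have hm12 : 12 * m ≤ 2 ^ d := by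
    have h1 : (12:ℝ) ≤ Real.exp 20000 := by have := Real.add_one_le_exp (20000:ℝ); linarith
    have : 12 * (m:ℝ) ≤ 2 ^ d := by nlinarith
    exact_mod_cast this
  set ℓ := Real.log (2 ^ d / m) with hℓ
  have hℓ1 : 20000 ≤ ℓ := by
    rw [hℓ, Real.le_log_iff_exp_le (by positivity), le_div_iff₀ hm0]; linarith
  have hℓ2 : ℓ ≤ d * Real.log 2 := by
    rw [hℓ, ← Real.log_pow]
    exact Real.log_le_log (by positivity) (div_le_self (by positivity) hm1)
  have hexp : Real.exp ℓ = 2 ^ d / m := Real.exp_log (by positivity)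
  set t := 200 * ℓ / d ^ 2 with ht
  have ht0 : 0 ≤ t := by positivity
  have ht1 : t ≤ 1 := by rw [ht, div_le_one (by positivity)]; nlinarith
  have htail : 40 * 2 ^ d / d ^ 2 * Real.exp (-(t * (d:ℝ) ^ 2 / 100)) ≤ 40 * m / d ^ 2 := by
    have e1 : -(t * (d:ℝ) ^ 2 / 100) = -ℓ + -ℓ := by rw [ht]; field_simp; ring
    rw [e1, Real.exp_add, Real.exp_neg, hexp]
    have e2 : 40 * (2:ℝ) ^ d / d ^ 2 * ((2 ^ d / (m:ℝ))⁻¹ * (2 ^ d / (m:ℝ))⁻¹) =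
        40 * m / d ^ 2 * (m / 2 ^ d) := by field_simp
    rw [e2]
    have e3 : (m:ℝ) / 2 ^ d ≤ 1 := by
      rw [div_le_one (by positivity)]
      exact_mod_cast (by omega : m ≤ 2 ^ d)
    exact mul_le_of_le_one_right (by positivity) e3
  have hsq : ∀ χ ∈ ({χ : Cube d → ZMod 3 | IsProper χ ∧ 4 * #(completion 1 (nonmono χ 1)) ≤ 2 ^ d ∧
      #(defects χ) = m} : Finset _), m * ℓ ^ 2 / d ≤ energy χ := by
    intro χ hχ
    obtain ⟨h1, h2, h3⟩ := (mem_filter.1 hχ).2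
    have := sq_log_le_energy (by omega) h2 (by omega) (by omega)
    rwa [h3] at this
  have hd2 : (0:ℝ) < d ^ 2 := by positivity
  rcases le_or_gt ((2:ℝ) ^ ((d:ℝ) / 10)) m with hbig | hbig
  · refine (card_le_of_energy (by omega) (t := t) (l := d * Real.log 2 / 40) (T := t * m)
      (G₀ := m * ℓ ^ 2 / d) ht0 ht1 (by positivity) (by rwa [exp_scaled])
      (by positivity) _ ?_).trans
      (mul_le_mul_of_nonneg_left (Real.exp_le_exp.2 ?_) (by positivity))
    · intro χ hχ
      have h3 := hsq χ hχ
      obtain ⟨h1, -, h2⟩ := (mem_filter.1 hχ).2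
      exact ⟨h1, h3, by rw [h2]⟩
    · rw [exp_scaled_sq]
      have e1 : 2 * (d * Real.log 2 / 40) * (m * ℓ ^ 2 / d) / d ^ 2 =
          m / d ^ 2 * (Real.log 2 / 20 * ℓ ^ 2) := by field_simp; ring
      have e2 : t * m = m / d ^ 2 * (200 * ℓ) := by rw [ht]; ring
      have e3 : 40 * (m:ℝ) / d ^ 2 = m / d ^ 2 * 40 := by ring
      rw [e3] at htail
      have e4 : (2:ℝ) ^ ((d:ℝ) / 10) / d ^ 2 ≤ m / d ^ 2 := by gcongr
      rw [e1, e2]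
      have e5 : m / (d:ℝ) ^ 2 * (200 * ℓ + 40 - Real.log 2 / 20 * ℓ ^ 2) ≤ m / d ^ 2 * (-1) := by
        refine mul_le_mul_of_nonneg_left ?_ (by positivity)
        nlinarith
      linarith
  have hℓ3 : (3 / 5 : ℝ) * d ≤ ℓ := by
    rw [hℓ, Real.log_div (by positivity) hm0.ne', Real.log_pow]
    have : Real.log m ≤ d / 10 * Real.log 2 := by
      rw [← Real.log_rpow two_pos]; exact Real.log_le_log hm0 hbig.le
    nlinarith
  rcases le_or_gt (d ^ 2) (100 * m) with hm3 | hm3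
  · have hm3' : (d:ℝ) ^ 2 ≤ 100 * m := by exact_mod_cast hm3
    refine (card_le_of_energy (by omega) (t := t) (l := 1000) (T := t * m)
      (G₀ := m * ℓ ^ 2 / d) ht0 ht1 (by positivity) H3
      (by positivity) _ ?_).trans
      (mul_le_mul_of_nonneg_left (Real.exp_le_exp.2 ?_) (by positivity))
    · intro χ hχ
      have h3 := hsq χ hχ
      obtain ⟨h1, -, h2⟩ := (mem_filter.1 hχ).2
      exact ⟨h1, h3, by rw [h2]⟩
    · have e1 : 2 * 1000 * (m * ℓ ^ 2 / d) / (d:ℝ) ^ 2 = m / d ^ 2 * ℓ * (2000 * (ℓ / d)) := by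
        field_simp
        norm_num
      have e2 : t * m = m / d ^ 2 * ℓ * 200 := by rw [ht]; ring
      have e3 : 40 * (m:ℝ) / d ^ 2 ≤ m / d ^ 2 * ℓ := by
        rw [div_mul_eq_mul_div, mul_comm (m:ℝ)]; gcongr; linarith
      have e4 : (3 / 5 : ℝ) ≤ ℓ / d := by rw [le_div_iff₀ hd1]; exact hℓ3
      have e5 : (1 / 100 : ℝ) ≤ m / d ^ 2 := by rw [le_div_iff₀ hd2]; linarith
      have e6 : m / (d:ℝ) ^ 2 * ℓ * (2000 * (3 / 5)) ≤ m / d ^ 2 * ℓ * (2000 * (ℓ / d)) := by gcongr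
      have e7 : (1 / 100 : ℝ) * (3 / 5 * d) ≤ m / d ^ 2 * ℓ := by gcongr
      rw [e1, e2]
      linarith
  · have hm3' : 100 * (m:ℝ) ≤ (d:ℝ) ^ 2 := by exact_mod_cast hm3.le
    refine (card_le_of_energy (by omega) (t := t) (l := 1000) (T := t * m)
      (G₀ := d ^ 2 / 25 * (d / 4)) ht0 ht1 (by positivity) H3
      (by positivity) _ ?_).trans
      (mul_le_mul_of_nonneg_left (Real.exp_le_exp.2 ?_) (by positivity))
    · intro χ hχ
      obtain ⟨h1, h2, h3⟩ := (mem_filter.1 hχ).2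
      refine ⟨h1, le_trans ?_ (isoProfile_le_energy h2 (x := (d:ℝ) ^ 2 / 25) (by positivity)
        (sq_le_card_nonmono (by omega) (by omega) (by rw [h3]; exact hm3.le))), by rw [h3]⟩
      rw [isoProfile]
      refine mul_le_mul_of_nonneg_left ?_ (by positivity)
      rw [Real.le_log_iff_exp_le (by positivity), le_div_iff₀ (by positivity)]
      have := Real.exp_pos ((d:ℝ) / 4)
      nlinarith
    · have e1 : 2 * 1000 * (d ^ 2 / 25 * (d / 4)) / (d:ℝ) ^ 2 = 20 * d := by field_simp; ring
      have e2 : t * m = m / d ^ 2 * (200 * ℓ) := by rw [ht]; ring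
      have e5 : m / (d:ℝ) ^ 2 ≤ 1 / 100 := by rw [div_le_iff₀ hd2]; linarith
      have e6 : m / (d:ℝ) ^ 2 * (200 * ℓ) ≤ 1 / 100 * (200 * ℓ) := by gcongr
      have e3 : 40 * (m:ℝ) / d ^ 2 = 40 * (m / d ^ 2) := by ring
      have e7 : ℓ ≤ 7 / 10 * d := by nlinarith
      rw [e1, e2]
      linarith

end

section

open Finset

variable {d : ℕ}

/-- Translate a coloring along the `i`-th direction. -/
def shift (i : Fin d) (χ : Cube d → ZMod 3) : Cube d → ZMod 3 := fun v => χ (v + dir i)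

theorem shift_shift (i : Fin d) (χ : Cube d → ZMod 3) : shift i (shift i χ) = χ := by
  funext v
  rw [shift, shift, add_dir_add_dir]

theorem IsProper.shift {χ : Cube d → ZMod 3} (h : IsProper χ) (i : Fin d) : IsProper (shift i χ) := by
  intro v j
  have := h (v + dir i) j
  rwa [add_right_comm] at this

theorem IsProper.sub_const {χ : Cube d → ZMod 3} (h : IsProper χ) (a : ZMod 3) :
    IsProper (fun v => χ v - a) := fun v i hv => h v i (sub_left_injective hv)

theorem card_nonmono_shift (i : Fin d) (χ : Cube d → ZMod 3) :
    #(nonmono (shift i χ) 1) = #(nonmono χ 0) := by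
  refine card_bij' (fun x _ => x + dir i) (fun x _ => x + dir i) ?_ ?_
    (fun x _ => add_dir_add_dir x i) fun x _ => add_dir_add_dir x i
  · intro x hx
    obtain ⟨-, h1, j, k, hjk⟩ := mem_filter.1 hx
    refine mem_filter.2 ⟨mem_univ _, by rw [par_add_dir, h1]; rfl, j, k, ?_⟩
    simpa only [_root_.shift, add_right_comm _ (dir i)] using hjk
  · intro x hx
    obtain ⟨-, h1, j, k, hjk⟩ := mem_filter.1 hx
    refine mem_filter.2 ⟨mem_univ _, by rw [par_add_dir, h1]; rfl, j, k, ?_⟩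
    simpa only [_root_.shift, add_right_comm _ (dir i), add_dir_add_dir] using hjk

theorem nonmono_sub_const (χ : Cube d → ZMod 3) (a : ZMod 3) (c : ZMod 2) :
    nonmono (fun v => χ v - a) c = nonmono χ c := by
  simp [nonmono, sub_left_inj]

theorem two_mul_card_compl_le {S : Finset (Cube d)} (h : ¬ 2 * #S ≤ 2 ^ d) : 2 * #Sᶜ ≤ 2 ^ d := by
  have := card_add_card_compl S
  rw [card_cube] at this
  omega

theorem card_completion_le_or_shift {χ : Cube d → ZMod 3} {C ε : ℝ} (i : Fin d) (h : IsProper χ)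
    (hC : 0 < C) (hε : 0 < ε) (hε' : ε ≤ 1 / 12) (hd : 2 * C * Real.exp (C / ε) ≤ d)
    (hd' : 12 * C ≤ d) (h1 : energy χ ≤ C * 2 ^ d / d) (h2 : energy (shift i χ) ≤ C * 2 ^ d / d) :
    (#(completion 1 (nonmono χ 1)) : ℝ) ≤ ε * 2 ^ d / d ∨
      (#(completion 1 (nonmono (shift i χ) 1)) : ℝ) ≤ ε * 2 ^ d / d := by
  have hd0 : (0:ℝ) < d := lt_of_lt_of_le (by positivity) hd
  have hb : ∀ χ : Cube d → ZMod 3, (edgeBoundary (completion 1 (nonmono χ 1)) : ℝ) ≤ energy χ :=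
    fun χ => Nat.cast_le.2 (edgeBoundary_le_energy χ)
  by_cases hP : 2 * #(completion 1 (nonmono χ 1)) ≤ 2 ^ d
  · exact Or.inl (card_le_of_edgeBoundary_le_div hC hε hP ((hb χ).trans h1) hd)
  right
  have hc := card_le_of_edgeBoundary_le_div hC hε (two_mul_card_compl_le hP)
    (by rw [edgeBoundary_compl]; exact (hb χ).trans h1) hd
  refine card_le_of_edgeBoundary_le_div hC hε ?_ ((hb _).trans h2) hd
  have h3 : (#(nonmono χ 0) : ℝ) ≤ d * #(completion 1 (nonmono χ 1))ᶜ + energy χ := by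
    exact_mod_cast h.card_nonmono_zero_le
  have h4 := card_completion_le i.pos 1 (nonmono (shift i χ) 1)
  rw [card_nonmono_shift] at h4
  have h4' : (#(completion 1 (nonmono (shift i χ) 1)) : ℝ) ≤ 3 * #(nonmono χ 0) := by
    exact_mod_cast h4
  have h5 : (d:ℝ) * #(completion 1 (nonmono χ 1))ᶜ ≤ 1 / 12 * 2 ^ d := by
    calc _ ≤ (d:ℝ) * (ε * 2 ^ d / d) := by gcongr
      _ = ε * 2 ^ d := by field_simp
      _ ≤ _ := by gcongr
  have h6 : C * 2 ^ d / d ≤ 1 / 12 * 2 ^ d := by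
    rw [div_le_iff₀ hd0]
    have : (0:ℝ) < 2 ^ d := by positivity
    nlinarith
  have : 2 * (#(completion 1 (nonmono (shift i χ) 1)) : ℝ) ≤ 2 ^ d := by linarith
  exact_mod_cast this

theorem exists_dominant_color {χ : Cube d → ZMod 3} {ε : ℝ} (hd : 0 < d) (hε' : ε ≤ 1 / 12)
    (h : (#(completion 1 (nonmono χ 1)) : ℝ) ≤ ε * 2 ^ d / d) :
    ∃ a, (#(defects fun v => χ v - a) : ℝ) ≤ ε * 2 ^ d := by
  have hd0 : (0:ℝ) < d := by exact_mod_cast hd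
  let A : ZMod 3 → Finset (Cube d) := fun a => {u | par u = 0 ∧ χ u = a}
  have hbd : ∀ a, (edgeBoundary (completion 0 (A a)) : ℝ) ≤ ε / 2 * 2 ^ d := by
    intro a
    have h1 : (2 * edgeBoundary (completion 0 (A a)) : ℝ) ≤ d * #(nonmono χ 1) := by
      exact_mod_cast two_mul_edgeBoundary_le (χ := χ) (fun c => c = a)
    have h2 : (#(nonmono χ 1) : ℝ) ≤ #(completion 1 (nonmono χ 1)) :=
      Nat.cast_le.2 (card_le_card (subset_completion _ _))
    have h3 : (d:ℝ) * #(nonmono χ 1) ≤ d * (ε * 2 ^ d / d) := by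
      gcongr
      exact h2.trans h
    have h4 : (d:ℝ) * (ε * 2 ^ d / d) = ε * 2 ^ d := by field_simp
    linarith
  by_contra! hcon
  have hA : ∀ a, (#(A a) : ℝ) ≤ ε * 2 ^ d := by
    intro a
    by_cases hP : 2 * #(completion 0 (A a)) ≤ 2 ^ d
    · have h1 := card_le_of_edgeBoundary_le hP (hbd a)
      have h2 : (#(A a) : ℝ) ≤ #(completion 0 (A a)) :=
        Nat.cast_le.2 (card_le_card (subset_completion _ _))
      linarith
    · have h1 := card_le_of_edgeBoundary_le (two_mul_card_compl_le hP)
        (by rw [edgeBoundary_compl]; exact hbd a)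
      have h2 : (#(defects fun v => χ v - a) : ℝ) ≤ #(completion 0 (A a))ᶜ := by
        refine Nat.cast_le.2 (card_le_card fun u hu => ?_)
        obtain ⟨-, h3, h4⟩ := mem_filter.1 hu
        rw [mem_compl, mem_completion_of_par h3]
        exact fun h5 => h4 (sub_eq_zero.2 (mem_filter.1 h5).2.2)
      have := hcon a
      linarith
  have hE := card_par_eq hd (0 : ZMod 2)
  have hsum : #{v : Cube d | par v = 0} = ∑ a : ZMod 3, #(A a) := by
    rw [card_eq_sum_card_fiberwise (f := χ) (t := univ) fun _ _ => mem_coe.2 (mem_univ _)]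
    refine sum_congr rfl fun a _ => ?_
    rw [filter_filter]
  rw [hsum] at hE
  have hE' : ∑ a : ZMod 3, (#(A a) : ℝ) = 2 ^ (d - 1) := by exact_mod_cast hE
  have hle : ∑ a : ZMod 3, (#(A a) : ℝ) ≤ ∑ a : ZMod 3, ε * 2 ^ d := sum_le_sum fun a _ => hA a
  rw [hE', sum_const, card_univ, ZMod.card, nsmul_eq_mul] at hle
  have h2 : (2:ℝ) ^ d = 2 * 2 ^ (d - 1) := by
    rw [← pow_succ', Nat.sub_add_cancel (by omega)]
  have : (0:ℝ) < 2 ^ (d - 1) := by positivity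
  rw [h2] at hle
  push_cast at hle
  nlinarith

/-- Proper colorings all of whose even vertices, up to few exceptions, have color `0`. -/
def IsNearlyZero (χ : Cube d → ZMod 3) : Prop := IsProper χ ∧
  4 * #(completion 1 (nonmono χ 1)) ≤ 2 ^ d ∧ #(defects χ) * Real.exp 20000 ≤ 2 ^ d

open Classical in
theorem card_proper_le (hd : 20 ≤ d)
    (hd1 : 2 * 2000 * Real.exp (2000 / Real.exp (-20000)) ≤ d) :
    #{χ : Cube d → ZMod 3 | IsProper χ} ≤
      2 * #{χ : Cube d → ZMod 3 | IsProper χ ∧ 2000 * 2 ^ d / d ≤ (energy χ : ℝ)} +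
      6 * #{χ : Cube d → ZMod 3 | IsNearlyZero χ} := by
  have hd0 : (0:ℝ) < d := by exact_mod_cast (by omega : 0 < d)
  set i : Fin d := ⟨0, by omega⟩
  set B : Finset (Cube d → ZMod 3) := {χ | IsProper χ ∧ 2000 * 2 ^ d / d ≤ (energy χ : ℝ)} with hB
  set Z : Finset (Cube d → ZMod 3) := {χ | IsNearlyZero χ} with hZ
  set ε := Real.exp (-20000) with hε
  have hε0 : 0 < ε := Real.exp_pos _
  have hεe : ε * Real.exp 20000 = 1 := by rw [hε, ← Real.exp_add]; simp
  have hε1 : ε ≤ 1 / 12 := by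
    have := Real.add_one_le_exp (20000:ℝ)
    nlinarith
  have hZmem : ∀ χ : Cube d → ZMod 3, IsProper χ →
      (#(completion 1 (nonmono χ 1)) : ℝ) ≤ ε * 2 ^ d / d → ∃ a, (fun v => χ v - a) ∈ Z := by
    intro χ h h1
    obtain ⟨a, ha⟩ := exists_dominant_color (by omega) hε1 h1
    refine ⟨a, mem_filter.2 ⟨mem_univ _, h.sub_const a, ?_, ?_⟩⟩
    · rw [nonmono_sub_const]
      have : 4 * (#(completion 1 (nonmono χ 1)) : ℝ) ≤ 2 ^ d := by
        have h2 : ε * 2 ^ d / d ≤ 1 / 12 * 2 ^ d := by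
          rw [div_le_iff₀ hd0]
          have h20 : (20:ℝ) ≤ d := by exact_mod_cast hd
          have : (0:ℝ) < 2 ^ d := by positivity
          nlinarith
        have : (0:ℝ) < 2 ^ d := by positivity
        linarith
      exact_mod_cast this
    · calc _ ≤ ε * 2 ^ d * Real.exp 20000 := by gcongr
        _ = (ε * Real.exp 20000) * 2 ^ d := by ring
        _ = _ := by rw [hεe, one_mul]
  have hsub : ({χ | IsProper χ} : Finset (Cube d → ZMod 3)) ⊆ (B ∪ B.image (shift i)) ∪
      (((univ : Finset (ZMod 3)) ×ˢ Z).image (fun p v => p.2 v + p.1) ∪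
        ((univ : Finset (ZMod 3)) ×ˢ Z).image (fun p => shift i fun v => p.2 v + p.1)) := by
    intro χ hχ
    have h : IsProper χ := (mem_filter.1 hχ).2
    by_cases h1 : 2000 * 2 ^ d / d ≤ (energy χ : ℝ)
    · exact mem_union_left _ (mem_union_left _ (mem_filter.2 ⟨mem_univ _, h, h1⟩))
    by_cases h2 : 2000 * 2 ^ d / d ≤ (energy (shift i χ) : ℝ)
    · exact mem_union_left _ (mem_union_right _ (mem_image.2 ⟨shift i χ,
        mem_filter.2 ⟨mem_univ _, h.shift i, h2⟩, shift_shift i χ⟩))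
    refine mem_union_right _ ?_
    have h3 : 2 * 2000 * 1 ≤ 2 * 2000 * Real.exp (2000 / ε) := by
      gcongr
      exact Real.one_le_exp (by positivity)
    have h4 : 12 * 2000 ≤ (d:ℝ) := by
      have : 2000 ≤ 2000 / ε := by rw [le_div_iff₀ hε0]; linarith
      have := Real.add_one_le_exp (2000 / ε)
      linarith
    rcases card_completion_le_or_shift i h (by norm_num) hε0 hε1 hd1 h4
      (not_le.1 h1).le (not_le.1 h2).le with h5 | h5
    · obtain ⟨a, ha⟩ := hZmem χ h h5
      exact mem_union_left _ (mem_image.2 ⟨(a, _), mem_product.2 ⟨mem_univ _, ha⟩, by simp⟩)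
    · obtain ⟨a, ha⟩ := hZmem _ (h.shift i) h5
      refine mem_union_right _ (mem_image.2 ⟨(a, _), mem_product.2 ⟨mem_univ _, ha⟩, ?_⟩)
      simp only [sub_add_cancel]
      exact shift_shift i χ
  refine (card_le_card hsub).trans ?_
  have c1 : #(B ∪ B.image (shift i)) ≤ #B + #B :=
    (card_union_le _ _).trans (Nat.add_le_add_left card_image_le _)
  have c0 : #((univ : Finset (ZMod 3)) ×ˢ Z) = 3 * #Z := by simp [card_product, ZMod.card]
  have c2 : #(((univ : Finset (ZMod 3)) ×ˢ Z).image (fun p v => p.2 v + p.1) ∪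
      ((univ : Finset (ZMod 3)) ×ˢ Z).image (fun p => shift i fun v => p.2 v + p.1)) ≤
      3 * #Z + 3 * #Z := by
    rw [← c0]
    exact (card_union_le _ _).trans (add_le_add card_image_le card_image_le)
  have := card_union_le (B ∪ B.image (shift i)) (((univ : Finset (ZMod 3)) ×ˢ Z).image
    (fun p v => p.2 v + p.1) ∪ ((univ : Finset (ZMod 3)) ×ˢ Z).image
      (fun p => shift i fun v => p.2 v + p.1))
  omega

open Classical in
theorem card_isNearlyZero_le (hd : 1000 ≤ d) (H : 4 * d * (2:ℝ) ^ ((d:ℝ) / 40) ≤ 2 ^ ((d : ℝ) / 4))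
    (H2 : 400 * (2:ℝ) ^ ((d:ℝ) / 20) + 2 * d ≤ 2 ^ ((d:ℝ) / 10) / d ^ 2)
    (H3 : 4 * d * Real.exp 1000 ≤ 2 ^ ((d : ℝ) / 4)) (H4 : 400 * Real.exp 1000 ^ 2 ≤ d)
    (H5 : d ^ 2 * Real.exp (d / 4) ≤ 2 ^ d) :
    (#{χ : Cube d → ZMod 3 | IsNearlyZero χ} : ℝ) ≤
      #{χ : Cube d → ZMod 3 | IsProper χ ∧ 8 * #(defects χ) ≤ d} +
      2 ^ 2 ^ (d - 1) * Real.exp (-d) := by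
  let S : ℕ → Finset (Cube d → ZMod 3) := fun m => {χ | IsProper χ ∧
    4 * #(completion 1 (nonmono χ 1)) ≤ 2 ^ d ∧ #(defects χ) = m}
  let M : Finset ℕ := {m ∈ range (2 ^ d) | d < 8 * m ∧ m * Real.exp 20000 ≤ 2 ^ d}
  have hsub : ({χ | IsNearlyZero χ} : Finset (Cube d → ZMod 3)) ⊆
      ({χ | IsProper χ ∧ 8 * #(defects χ) ≤ d} : Finset (Cube d → ZMod 3)) ∪ M.biUnion S := by
    intro χ hχ
    obtain ⟨h1, h2, h3⟩ := (mem_filter.1 hχ).2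
    by_cases h4 : 8 * #(defects χ) ≤ d
    · exact mem_union_left _ (mem_filter.2 ⟨mem_univ _, h1, h4⟩)
    · refine mem_union_right _ (mem_biUnion.2 ⟨#(defects χ), mem_filter.2 ⟨mem_range.2 ?_,
        not_le.1 h4, h3⟩, mem_filter.2 ⟨mem_univ _, h1, h2, rfl⟩⟩)
      have h5 : (1:ℝ) ≤ #(defects χ) := by exact_mod_cast (by omega : 1 ≤ #(defects χ))
      have h6 := Real.add_one_le_exp (20000:ℝ)
      have : (#(defects χ) : ℝ) < 2 ^ d := by nlinarith
      exact_mod_cast this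
  have h1 : (#{χ : Cube d → ZMod 3 | IsNearlyZero χ} : ℝ) ≤
      #{χ : Cube d → ZMod 3 | IsProper χ ∧ 8 * #(defects χ) ≤ d} + ∑ m ∈ M, (#(S m) : ℝ) := by
    exact_mod_cast (card_le_card hsub).trans ((card_union_le _ _).trans
      (Nat.add_le_add_left card_biUnion_le _))
  refine h1.trans (add_le_add_right ?_ _)
  have h2 : ∑ m ∈ M, (#(S m) : ℝ) ≤ ∑ m ∈ M, 2 ^ 2 ^ (d - 1) * Real.exp (-(2 * d)) := by
    refine sum_le_sum fun m hm => ?_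
    obtain ⟨h3, h4⟩ := (mem_filter.1 hm).2
    exact card_medium_le hd H H2 H3 H4 H5 h3 h4
  refine h2.trans ?_
  rw [sum_const, nsmul_eq_mul]
  have h3 : (#M : ℝ) ≤ 2 ^ d := by
    exact_mod_cast (card_filter_le _ _).trans (card_range _).le
  have h4 : (2:ℝ) ^ d ≤ Real.exp d := by
    have : (2:ℝ) ≤ Real.exp 1 := by have := Real.add_one_le_exp (1:ℝ); linarith
    calc (2:ℝ) ^ d ≤ Real.exp 1 ^ d := by gcongr
      _ = _ := by rw [← Real.exp_nat_mul, mul_one]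
  calc (#M : ℝ) * (2 ^ 2 ^ (d - 1) * Real.exp (-(2 * d))) ≤
      Real.exp d * (2 ^ 2 ^ (d - 1) * Real.exp (-(2 * d))) := by gcongr; exact h3.trans h4
    _ = 2 ^ 2 ^ (d - 1) * (Real.exp d * Real.exp (-(2 * d))) := by ring
    _ = _ := by rw [← Real.exp_add]; ring_nf

end

section

open Finset

variable {d : ℕ}

/-- The even vertices of the cube. -/
def evens (d : ℕ) : Finset (Cube d) := {v | par v = 0}

theorem mem_evens {v : Cube d} : v ∈ evens d ↔ par v = 0 := by simp [evens]

theorem par_eq_one_of_mem_nbhd {D : Finset (Cube d)} (hD : D ⊆ evens d) {x : Cube d}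
    (hx : x ∈ nbhd D) : par x = 1 := by
  obtain ⟨i, hi⟩ := mem_nbhd.1 hx
  have := mem_evens.1 (hD hi)
  rwa [par_add_dir, zmod_two_add_eq_iff, zero_add] at this

theorem card_nbhd_le (hd : 0 < d) {D : Finset (Cube d)} (hD : D ⊆ evens d) :
    #(nbhd D) ≤ 2 ^ (d - 1) := by
  rw [← card_par_eq hd 1]
  exact card_le_card fun x hx => by simpa using par_eq_one_of_mem_nbhd hD hx

theorem card_mono_add_card_nbhd_le {χ : Cube d → ZMod 3} (hd : #(defects χ) < d) :
    #(mono χ 1) + #(nbhd (defects χ)) ≤ 2 ^ (d - 1) := by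
  have hsub : defects χ ⊆ evens d := fun v hv => mem_evens.2 (mem_filter.1 hv).2.1
  rw [← card_union_of_disjoint, ← card_par_eq (by omega) 1]
  · refine card_le_card (union_subset (fun x hx => ?_) fun x hx => ?_)
    · simpa using (mem_filter.1 hx).2.1
    · simpa using par_eq_one_of_mem_nbhd hsub hx
  · rw [disjoint_left]
    intro x hx hx'
    obtain ⟨-, h1, h2⟩ := mem_filter.1 hx
    obtain ⟨i, hi⟩ := mem_nbhd.1 hx'
    have h3 : ∀ j, x + dir j ∈ defects χ := fun j => by
      obtain ⟨-, -, h4⟩ := mem_filter.1 hi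
      exact mem_filter.2 ⟨mem_univ _, by rw [par_add_dir, h1]; rfl, h2 i j ▸ h4⟩
    have h4 : #(univ.image fun j => x + dir j) = d := by
      rw [card_image_of_injective _ fun i j h => dir_injective (add_left_cancel h), card_univ,
        Fintype.card_fin]
    have h5 := card_le_card (image_subset_iff.2 fun j (_ : j ∈ (univ : Finset (Fin d))) => h3 j)
    omega

open Classical in
theorem card_defects_eq_le {D : Finset (Cube d)} (hD : #D < d) :
    #{χ : Cube d → ZMod 3 | IsProper χ ∧ defects χ = D} ≤
      2 ^ (2 ^ (d - 1) - #(nbhd D)) * 2 ^ #D := by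
  have hcard : #(univ : Finset ({x // x ∈ D} → Bool)) = 2 ^ #D := by simp
  rw [← hcard]
  refine card_le_mul_card_image_of_maps_to
    (f := fun χ (u : {x // x ∈ D}) => decide (χ u.1 = 1)) (fun _ _ => mem_univ _) _ fun g _ => ?_
  by_contra hlt
  obtain ⟨χ₀, hχ₀⟩ := card_pos.1 ((Nat.zero_le _).trans_lt (not_le.1 hlt))
  refine hlt ?_
  simp only [mem_filter, mem_univ, true_and] at hχ₀
  have hmono : #(mono χ₀ 1) ≤ 2 ^ (d - 1) - #(nbhd D) := by
    have := card_mono_add_card_nbhd_le (χ := χ₀) (by rw [hχ₀.1.2]; exact hD)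
    rw [hχ₀.1.2] at this
    omega
  refine le_trans (card_le_card fun χ hχ => ?_) ((card_extensions_le (by omega) χ₀).trans
    (Nat.pow_le_pow_right two_pos hmono))
  simp only [mem_filter, mem_univ, true_and] at hχ ⊢
  refine ⟨hχ.1.1, fun v hv => ?_⟩
  have hiff : ∀ χ : Cube d → ZMod 3, defects χ = D → (v ∈ D ↔ χ v ≠ 0) := fun χ h => by
    rw [← h]; simp [defects, hv]
  by_cases hvD : v ∈ D
  · have h1 := (hiff χ hχ.1.2).1 hvD
    have h2 := (hiff χ₀ hχ₀.1.2).1 hvD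
    have h3 := congrFun (hχ.2.trans hχ₀.2.symm) ⟨v, hvD⟩
    simp only [decide_eq_decide] at h3
    have key : ∀ a b : ZMod 3, a ≠ 0 → b ≠ 0 → (a = 1 ↔ b = 1) → a = b := by decide
    exact key _ _ h1 h2 h3
  · have h1 := mt (hiff χ hχ.1.2).2 hvD
    have h2 := mt (hiff χ₀ hχ₀.1.2).2 hvD
    rw [not_not] at h1 h2
    rw [h1, h2]

/-- The relative number of proper colorings with `k` even vertices of non-zero color. -/
noncomputable def defectSum (d k : ℕ) : ℝ :=
  ∑ D ∈ powersetCard k (evens d), 2 ^ k * (1 / 2) ^ #(nbhd D)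

theorem sum_powersetCard_succ {α : Type*} [DecidableEq α] (s : Finset α) (k : ℕ)
    (f : Finset α → ℝ) : (k + 1) * ∑ D ∈ powersetCard (k + 1) s, f D =
      ∑ D ∈ powersetCard k s, ∑ v ∈ s \ D, f (insert v D) := by
  have h1 : (k + 1) * ∑ D ∈ powersetCard (k + 1) s, f D =
      ∑ D ∈ powersetCard (k + 1) s, ∑ _v ∈ D, f D := by
    rw [mul_sum]
    refine sum_congr rfl fun D hD => ?_
    rw [sum_const, (mem_powersetCard.1 hD).2, nsmul_eq_mul]
    push_cast
    ring
  rw [h1, sum_sigma', sum_sigma']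
  refine sum_bij' (fun p _ => ⟨p.1.erase p.2, p.2⟩) (fun p _ => ⟨insert p.2 p.1, p.2⟩) ?_ ?_ ?_ ?_ ?_
  · rintro ⟨D, v⟩ h
    obtain ⟨h2, h3⟩ := mem_sigma.1 h
    obtain ⟨h4, h5⟩ := mem_powersetCard.1 h2
    refine mem_sigma.2 ⟨mem_powersetCard.2 ⟨(erase_subset _ _).trans h4, ?_⟩, ?_⟩
    · rw [card_erase_of_mem h3, h5]; rfl
    · exact mem_sdiff.2 ⟨h4 h3, notMem_erase _ _⟩
  · rintro ⟨D, v⟩ h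
    obtain ⟨h2, h3⟩ := mem_sigma.1 h
    obtain ⟨h4, h5⟩ := mem_powersetCard.1 h2
    obtain ⟨h6, h7⟩ := mem_sdiff.1 h3
    refine mem_sigma.2 ⟨mem_powersetCard.2 ⟨insert_subset h6 h4, ?_⟩, mem_insert_self _ _⟩
    rw [card_insert_of_notMem h7, h5]
  · rintro ⟨D, v⟩ h
    obtain ⟨-, h3⟩ := mem_sigma.1 h
    simp only [insert_erase h3]
  · rintro ⟨D, v⟩ h
    obtain ⟨-, h3⟩ := mem_sigma.1 h
    simp only [erase_insert (mem_sdiff.1 h3).2]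
  · rintro ⟨D, v⟩ h
    obtain ⟨-, h3⟩ := mem_sigma.1 h
    simp only [insert_erase h3]

theorem card_nearby_nonempty_le (D : Finset (Cube d)) :
    #{v | (nearby D v).Nonempty} ≤ #D * d ^ 2 := by
  have : ({v | (nearby D v).Nonempty} : Finset (Cube d)) ⊆
      (D ×ˢ (univ : Finset (Fin d × Fin d))).image fun p => p.1 + dir p.2.1 + dir p.2.2 := by
    intro v hv
    obtain ⟨w, hw⟩ := (mem_filter.1 hv).2
    obtain ⟨hw, i, j, hij⟩ := mem_filter.1 hw
    refine mem_image.2 ⟨(w, j, i), mem_product.2 ⟨hw, mem_univ _⟩, ?_⟩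
    simp only [← hij, add_dir_add_dir]
  refine (card_le_card this).trans (card_image_le.trans ?_)
  simp [card_product, sq]

theorem defectSum_succ_le (hd : 0 < d) (k : ℕ) : (k + 1) * defectSum d (k + 1) ≤
    defectSum d k * (1 + 2 * k * d ^ 2 * 4 ^ k / 2 ^ d) := by
  rw [defectSum, sum_powersetCard_succ, defectSum, sum_mul]
  refine sum_le_sum fun D hD => ?_
  obtain ⟨hDE, hk⟩ := mem_powersetCard.1 hD
  have h2d : (2:ℝ) ^ d = 2 * 2 ^ (d - 1) := by
    rw [← pow_succ', Nat.sub_add_cancel (by omega)]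
  calc _ ≤ ∑ v ∈ evens d \ D, 2 ^ (k + 1) * ((1 / 2) ^ #(nbhd D) * (1 / 2) ^ d *
        (1 + if (nearby D v).Nonempty then 4 ^ k else 0) : ℝ) := by
        refine sum_le_sum fun v hv => mul_le_mul_of_nonneg_left ?_ (by positivity)
        have h1 := card_nbhd_insert (mem_sdiff.1 hv).2
        have h2 : #(nearby D v) ≤ k := hk ▸ card_filter_le _ _
        have h3 : ((1:ℝ) / 2) ^ #(nbhd (insert v D)) * (1 / 4) ^ #(nearby D v) ≤
            (1 / 2) ^ #(nbhd D) * (1 / 2) ^ d := by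
          have : ((1:ℝ) / 4) = (1 / 2) ^ 2 := by norm_num
          rw [this, ← pow_mul, ← pow_add, ← pow_add]
          exact pow_le_pow_of_le_one (by norm_num) (by norm_num) h1
        have h4 : ((1:ℝ) / 2) ^ #(nbhd (insert v D)) ≤
            (1 / 2) ^ #(nbhd D) * (1 / 2) ^ d * 4 ^ #(nearby D v) := by
          have : ((1:ℝ) / 4) ^ #(nearby D v) = (4 ^ #(nearby D v))⁻¹ := by
            rw [one_div, inv_pow]
          rwa [this, ← div_eq_mul_inv, div_le_iff₀ (by positivity)] at h3
        refine h4.trans (mul_le_mul_of_nonneg_left ?_ (by positivity))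
        split_ifs with hne
        · have : (4:ℝ) ^ #(nearby D v) ≤ 4 ^ k := pow_le_pow_right₀ (by norm_num) h2
          linarith
        · rw [not_nonempty_iff_eq_empty.1 hne]; simp
    _ ≤ ∑ v ∈ evens d, 2 ^ (k + 1) * ((1 / 2) ^ #(nbhd D) * (1 / 2) ^ d *
        (1 + if (nearby D v).Nonempty then 4 ^ k else 0) : ℝ) :=
        sum_le_sum_of_subset_of_nonneg sdiff_subset fun v _ _ => by positivity
    _ = 2 ^ (k + 1) * ((1 / 2) ^ #(nbhd D) * (1 / 2) ^ d *
        (2 ^ (d - 1) + #{v ∈ evens d | (nearby D v).Nonempty} * 4 ^ k)) := by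
        rw [← mul_sum, ← mul_sum, sum_add_distrib, ← sum_filter, sum_const, sum_const,
          nsmul_eq_mul, nsmul_eq_mul, evens, card_par_eq hd]
        push_cast
        ring
    _ ≤ 2 ^ (k + 1) * ((1 / 2) ^ #(nbhd D) * (1 / 2) ^ d * (2 ^ (d - 1) + k * d ^ 2 * 4 ^ k)) := by
        have h1 : #{v ∈ evens d | (nearby D v).Nonempty} ≤ k * d ^ 2 :=
          (card_le_card (filter_subset_filter _ (subset_univ _))).trans
            (hk ▸ card_nearby_nonempty_le D)
        have h2 : (#{v ∈ evens d | (nearby D v).Nonempty} : ℝ) ≤ k * d ^ 2 := by exact_mod_cast h1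
        gcongr
    _ = _ := by
        rw [h2d, one_div, inv_pow 2 d, h2d, pow_succ]
        field_simp

theorem defectSum_le (hd : 0 < d) (k : ℕ) (hk : 8 * k ≤ d + 8) {δ : ℝ}
    (hδ : (d:ℝ) ^ 3 * 2 ^ ((d:ℝ) / 4) / 2 ^ d ≤ δ) :
    defectSum d k ≤ (1 + δ) ^ k / k.factorial := by
  induction k with
  | zero => simp [defectSum, nbhd]
  | succ k ih =>
    have h1 := defectSum_succ_le hd k
    have h2 := ih (by omega)
    have hδ0 : 0 ≤ δ := le_trans (by positivity) hδ
    have h3 : 2 * (k:ℝ) * d ^ 2 * 4 ^ k / 2 ^ d ≤ δ := by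
      refine le_trans ?_ hδ
      have h4 : 2 * (k:ℝ) ≤ d := by exact_mod_cast (by omega : 2 * k ≤ d)
      have h5 : (4:ℝ) ^ k ≤ 2 ^ ((d:ℝ) / 4) := by
        have : (4:ℝ) ^ k = 2 ^ ((2 * k : ℝ)) := by
          rw [Real.rpow_mul two_pos.le, Real.rpow_natCast]; norm_num
        rw [this]
        refine Real.rpow_le_rpow_of_exponent_le one_le_two ?_
        have : (8 * k : ℝ) ≤ d := by exact_mod_cast (by omega : 8 * k ≤ d)
        linarith
      calc 2 * (k:ℝ) * d ^ 2 * 4 ^ k / 2 ^ d ≤ d * d ^ 2 * 2 ^ ((d:ℝ) / 4) / 2 ^ d := by gcongr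
        _ = _ := by ring
    have h6 : (0:ℝ) < k + 1 := by positivity
    rw [Nat.factorial_succ, Nat.cast_mul, pow_succ]
    have h7 : (k + 1) * defectSum d (k + 1) ≤ (1 + δ) ^ k / k.factorial * (1 + δ) := by
      refine h1.trans ?_
      gcongr
    rw [← le_div_iff₀' h6] at h7
    refine h7.trans (le_of_eq ?_)
    push_cast
    field_simp

open Classical in
theorem card_few_defects_le (hd : 16 ≤ d) {δ : ℝ} (hδ : (d:ℝ) ^ 3 * 2 ^ ((d:ℝ) / 4) / 2 ^ d ≤ δ) :
    (#{χ : Cube d → ZMod 3 | IsProper χ ∧ 8 * #(defects χ) ≤ d} : ℝ) ≤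
      2 ^ 2 ^ (d - 1) * Real.exp (1 + δ) := by
  have hδ0 : 0 ≤ δ := le_trans (by positivity) hδ
  have hsub : ({χ | IsProper χ ∧ 8 * #(defects χ) ≤ d} : Finset (Cube d → ZMod 3)) ⊆
      (range (d / 8 + 1)).biUnion fun k => (powersetCard k (evens d)).biUnion fun D =>
        ({χ | IsProper χ ∧ defects χ = D} : Finset (Cube d → ZMod 3)) := by
    intro χ hχ
    obtain ⟨-, h1, h2⟩ := mem_filter.1 hχ
    refine mem_biUnion.2 ⟨#(defects χ), mem_range.2 (by omega), mem_biUnion.2 ⟨defects χ,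
      mem_powersetCard.2 ⟨fun v hv => mem_evens.2 (mem_filter.1 hv).2.1, rfl⟩,
      mem_filter.2 ⟨mem_univ _, h1, rfl⟩⟩⟩
  have h1 : (#{χ : Cube d → ZMod 3 | IsProper χ ∧ 8 * #(defects χ) ≤ d} : ℝ) ≤
      ∑ k ∈ range (d / 8 + 1), ∑ D ∈ powersetCard k (evens d),
        (#{χ : Cube d → ZMod 3 | IsProper χ ∧ defects χ = D} : ℝ) := by
    exact_mod_cast (card_le_card hsub).trans (card_biUnion_le.trans
      (sum_le_sum fun k _ => card_biUnion_le))
  calc _ ≤ _ := h1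
    _ ≤ ∑ k ∈ range (d / 8 + 1), ∑ D ∈ powersetCard k (evens d),
        2 ^ 2 ^ (d - 1) * (2 ^ k * (1 / 2) ^ #(nbhd D) : ℝ) := by
        refine sum_le_sum fun k hk => sum_le_sum fun D hD => ?_
        obtain ⟨h2, h3⟩ := mem_powersetCard.1 hD
        have h4 := mem_range.1 hk
        have h5 : (#{χ : Cube d → ZMod 3 | IsProper χ ∧ defects χ = D} : ℝ) ≤
            2 ^ (2 ^ (d - 1) - #(nbhd D)) * 2 ^ #D := by
          exact_mod_cast card_defects_eq_le (by omega)
        refine h5.trans (le_of_eq ?_)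
        rw [h3, pow_sub₀ _ two_ne_zero (card_nbhd_le (by omega) h2), one_div, inv_pow]
        ring
    _ = 2 ^ 2 ^ (d - 1) * ∑ k ∈ range (d / 8 + 1), defectSum d k := by
        simp only [mul_sum, defectSum]
    _ ≤ 2 ^ 2 ^ (d - 1) * ∑ k ∈ range (d / 8 + 1), (1 + δ) ^ k / k.factorial := by
        gcongr with k hk
        have := mem_range.1 hk
        exact defectSum_le (by omega) k (by omega) hδ
    _ ≤ _ := by
        gcongr
        exact Real.sum_le_exp_of_nonneg (by positivity) _

end

section

open Finset

variable {d : ℕ}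

/-- Integer homomorphisms on the cube viewed as a group, normalised at the origin. -/
def cubeHom (d : ℕ) : Set (Cube d → ℤ) := {f | f 0 = 0 ∧ ∀ v i, |f (v + dir i) - f v| = 1}

theorem cube_induction {P : Cube d → Prop} (h0 : P 0) (hs : ∀ v i, P v → P (v + dir i))
    (v : Cube d) : P v := by
  have key : ∀ s : Finset (Fin d), P (∑ i ∈ s, dir i) := by
    intro s
    induction s using Finset.induction_on with
    | empty => simpa using h0
    | insert i s hi ih => rw [sum_insert hi, add_comm]; exact hs _ _ ih
  have hv : v = ∑ i with v i ≠ 0, dir i := by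
    funext j
    have hz : ∀ a : ZMod 2, a = if a ≠ 0 then 1 else 0 := by decide
    rw [Finset.sum_apply, sum_filter, hz (v j)]
    rw [sum_eq_single j]
    · by_cases h : v j = 0 <;> simp [h, dir]
    · intro i _ hij
      simp [dir, hij.symm]
    · simp
  rw [hv]
  exact key _

/-- The identification of `Bool` with `ZMod 2`. -/
def boolEquiv : Bool ≃ ZMod 2 where
  toFun b := if b then 1 else 0
  invFun a := decide (a = 1)
  left_inv := by decide
  right_inv := by decide

theorem cubeAdj_iff (u v : Fin d → Bool) :
    cubeAdj d u v ↔ ∃ i, boolEquiv ∘ v = boolEquiv ∘ u + dir i := by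
  have key : ∀ a b : Bool, a ≠ b ↔ boolEquiv b = boolEquiv a + 1 := by decide
  have key' : ∀ a b : Bool, ¬ a ≠ b ↔ boolEquiv b = boolEquiv a := by decide
  rw [cubeAdj, card_eq_one]
  refine exists_congr fun i => ?_
  constructor
  · intro h
    funext j
    have hj : u j ≠ v j ↔ j = i := by
      simpa using congrArg (j ∈ ·) h
    by_cases hji : j = i
    · have := (key _ _).1 (hj.2 hji)
      subst hji
      simpa [dir] using this
    · have := (key' _ _).1 (mt hj.1 hji)
      simpa [dir, hji] using this
  · intro h
    ext j
    have hj := congrFun h j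
    simp only [mem_filter, mem_univ, true_and, mem_singleton]
    by_cases hji : j = i
    · subst hji
      simp only [iff_true]
      exact (key _ _).2 (by simpa [dir] using hj)
    · simp only [hji, iff_false]
      exact (key' _ _).2 (by simpa [dir, hji] using hj)

theorem ncard_homF : (HomF d).ncard = (cubeHom d).ncard := by
  let e : (Fin d → Bool) ≃ Cube d := Equiv.piCongrRight fun _ => boolEquiv
  have he : ∀ u, e u = boolEquiv ∘ u := fun _ => rfl
  let E : ((Fin d → Bool) → ℤ) ≃ (Cube d → ℤ) := e.arrowCongr (Equiv.refl ℤ)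
  have h : HomF d = E ⁻¹' cubeHom d := by
    ext f
    have hE : ∀ u, E f (e u) = f u := fun u => by simp [E]
    have h0 : (0 : Cube d) = e fun _ => false := rfl
    change (_ ∧ _) ↔ (_ ∧ _)
    rw [h0, hE]
    refine and_congr_right fun _ => ⟨fun h v i => ?_, fun h u v huv => ?_⟩
    · obtain ⟨u, rfl⟩ := e.surjective v
      obtain ⟨w, hw⟩ := e.surjective (e u + dir i)
      rw [← hw, hE, hE, abs_sub_comm]
      exact h u w ((cubeAdj_iff u w).2 ⟨i, hw⟩)
    · obtain ⟨i, hi⟩ := (cubeAdj_iff u v).1 huv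
      have := h (e u) i
      rw [he u, ← hi, ← he, ← he, hE, hE, abs_sub_comm] at this
      exact this
  rw [h, ← Set.ncard_image_of_injective _ E.injective, Set.image_preimage_eq _ E.surjective]

theorem isProper_of_mem_cubeHom {f : Cube d → ℤ} (hf : f ∈ cubeHom d) :
    IsProper fun v => (f v : ZMod 3) := by
  intro v i h
  have h' : (f (v + dir i) : ZMod 3) = f v := h
  have h1 : ((f (v + dir i) - f v : ℤ) : ZMod 3) = 0 := by rw [Int.cast_sub, h', sub_self]
  rcases eq_or_eq_neg_of_abs_eq (hf.2 v i) with h2 | h2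
  · rw [h2] at h1; revert h1; decide
  · rw [h2] at h1; revert h1; decide

theorem injOn_cubeHom : Set.InjOn (fun f v => (f v : ZMod 3) : (Cube d → ℤ) → Cube d → ZMod 3)
    (cubeHom d) := by
  intro f hf g hg hfg
  funext v
  refine cube_induction (P := fun v => f v = g v) (hf.1.trans hg.1.symm) (fun v i h => ?_) v
  have h1 : ((f (v + dir i) - g (v + dir i) : ℤ) : ZMod 3) = 0 := by
    push_cast
    rw [sub_eq_zero]
    exact congrFun hfg _
  rw [ZMod.intCast_zmod_eq_zero_iff_dvd] at h1
  rcases eq_or_eq_neg_of_abs_eq (hf.2 v i) with h2 | h2 <;>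
    rcases eq_or_eq_neg_of_abs_eq (hg.2 v i) with h3 | h3 <;> omega

theorem finite_cubeHom : (cubeHom d).Finite :=
  Set.Finite.of_finite_image (Set.toFinite _) injOn_cubeHom

open Classical in
theorem three_mul_ncard_cubeHom_le :
    3 * (cubeHom d).ncard ≤ #{χ : Cube d → ZMod 3 | IsProper χ} := by
  have h1 : (cubeHom d).ncard ≤ #{χ : Cube d → ZMod 3 | IsProper χ ∧ χ 0 = 0} := by
    rw [← Set.ncard_coe_finset]
    refine Set.ncard_le_ncard_of_injOn _ (fun f hf => ?_) injOn_cubeHom (Set.toFinite _)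
    simp only [coe_filter, mem_univ, true_and, Set.mem_ofPred_eq]
    exact ⟨isProper_of_mem_cubeHom hf, by rw [hf.1, Int.cast_zero]⟩
  have h2 : #((univ : Finset (ZMod 3)) ×ˢ
      ({χ | IsProper χ ∧ χ 0 = 0} : Finset (Cube d → ZMod 3))) ≤
      #{χ : Cube d → ZMod 3 | IsProper χ} := by
    refine card_le_card_of_injOn (fun p v => p.2 v - p.1) (fun p hp => ?_) fun p hp q hq hpq => ?_
    · have := (mem_filter.1 (mem_product.1 hp).2).2
      exact mem_filter.2 ⟨mem_univ _, this.1.sub_const _⟩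
    · have hp0 := (mem_filter.1 (mem_product.1 hp).2).2.2
      have hq0 := (mem_filter.1 (mem_product.1 hq).2).2.2
      have h0 := congrFun hpq 0
      simp only [hp0, hq0, zero_sub, neg_inj] at h0
      refine Prod.ext h0 (funext fun v => ?_)
      have := congrFun hpq v
      simp only [h0] at this
      exact sub_left_injective this
  rw [card_product, card_univ, ZMod.card] at h2
  omega

end

section

open Finset

variable {d : ℕ}

/-- The vertices reached from the origin by two steps. -/
def twoStep (d : ℕ) : Finset (Cube d) := univ.image fun p : Fin d × Fin d => dir p.1 + dir p.2

theorem dir_add_dir_mem_twoStep (i j : Fin d) : dir i + dir j ∈ twoStep d :=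
  mem_image.2 ⟨(i, j), mem_univ _, rfl⟩

theorem card_twoStep_le : #(twoStep d) ≤ d ^ 2 :=
  card_image_le.trans (by simp [sq])

/-- Sets of even vertices at pairwise distance more than two, avoiding the ball of radius two
around the origin. -/
def IsSparse (D : Finset (Cube d)) : Prop :=
  D ⊆ evens d \ twoStep d ∧ ∀ v ∈ D, ∀ i j, v + dir i + dir j ∈ D → v + dir i + dir j = v

/-- The vertices at which the homomorphism with excursion set `D` is free. -/
def freeSet (D : Finset (Cube d)) : Finset (Cube d) :=
  ({x | par x = 1 ∧ x ∉ nbhd D} : Finset (Cube d)) ∪ D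

open Classical in
/-- The homomorphism with excursion set `D` and sign pattern `S`. -/
noncomputable def excursion (D S : Finset (Cube d)) (x : Cube d) : ℤ :=
  if par x = 0 then (if x ∈ D then (if x ∈ S then 2 else -2) else 0)
  else if x ∈ nbhd D then (if x ∈ nbhd (D ∩ S) then 1 else -1)
  else if x ∈ S then 1 else -1

theorem IsSparse.even {D : Finset (Cube d)} (hD : IsSparse D) {x : Cube d} (hx : x ∈ D) :
    par x = 0 := mem_evens.1 (mem_sdiff.1 (hD.1 hx)).1

theorem IsSparse.dir_notMem_nbhd {D : Finset (Cube d)} (hD : IsSparse D) (i : Fin d) :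
    dir i ∉ nbhd D := by
  intro h
  obtain ⟨j, hj⟩ := mem_nbhd.1 h
  exact (mem_sdiff.1 (hD.1 hj)).2 (dir_add_dir_mem_twoStep i j)

theorem excursion_mem_cubeHom (hd : 0 < d) {D S : Finset (Cube d)} (hD : IsSparse D) :
    excursion D S ∈ cubeHom d := by
  have odd : ∀ x i, par x = 1 → |excursion D S (x + dir i) - excursion D S x| = 1 := by
    intro x i hx
    have hx0 : par x ≠ 0 := by rw [hx]; decide
    have hxi : par (x + dir i) = 0 := by rw [par_add_dir, hx]; rfl
    rw [excursion, excursion, if_pos hxi, if_neg hx0]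
    by_cases hiD : x + dir i ∈ D
    · rw [if_pos hiD, if_pos (mem_nbhd.2 ⟨i, hiD⟩)]
      by_cases hiS : x + dir i ∈ S
      · rw [if_pos hiS, if_pos (mem_nbhd.2 ⟨i, mem_inter.2 ⟨hiD, hiS⟩⟩)]
        rfl
      · rw [if_neg hiS, if_neg]
        · rfl
        · intro h
          obtain ⟨j, hj⟩ := mem_nbhd.1 h
          obtain ⟨hjD, hjS⟩ := mem_inter.1 hj
          have := hD.2 _ hiD i j (by rwa [add_dir_add_dir])
          rw [add_dir_add_dir] at this
          exact hiS (this ▸ hjS)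
    · rw [if_neg hiD]
      split_ifs <;> rfl
  refine ⟨?_, fun v i => ?_⟩
  · have h0 : (0 : Cube d) ∉ D := fun h => (mem_sdiff.1 (hD.1 h)).2 (by
      have := dir_add_dir_mem_twoStep (⟨0, hd⟩ : Fin d) ⟨0, hd⟩
      rwa [cube_add_self] at this)
    rw [excursion, if_pos (by simp [par]), if_neg h0]
  · by_cases hv : par v = 0
    · have := odd (v + dir i) i (by rw [par_add_dir, hv]; rfl)
      rwa [add_dir_add_dir, abs_sub_comm] at this
    · exact odd v i ((zmod_two_ne_iff _ _).1 hv)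

theorem IsSparse.mem_iff_excursion {D : Finset (Cube d)} (hD : IsSparse D) (S : Finset (Cube d))
    (x : Cube d) : x ∈ D ↔ par x = 0 ∧ excursion D S x ≠ 0 := by
  constructor
  · intro hx
    refine ⟨hD.even hx, ?_⟩
    rw [excursion, if_pos (hD.even hx), if_pos hx]
    split_ifs <;> decide
  · rintro ⟨h0, h1⟩
    by_contra hx
    exact h1 (by rw [excursion, if_pos h0, if_neg hx])

theorem IsSparse.mem_iff_excursion_pos {D : Finset (Cube d)} (hD : IsSparse D)
    (S : Finset (Cube d)) {x : Cube d} (hx : x ∈ freeSet D) :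
    x ∈ S ↔ 0 < excursion D S x := by
  rcases mem_union.1 hx with h | h
  · obtain ⟨-, h1, h2⟩ := mem_filter.1 h
    rw [excursion, if_neg (by rw [h1]; decide), if_neg h2]
    split_ifs <;> simpa
  · rw [excursion, if_pos (hD.even h), if_pos h]
    split_ifs <;> simpa

theorem IsSparse.dir_mem_freeSet {D : Finset (Cube d)} (hD : IsSparse D) (i : Fin d) :
    dir i ∈ freeSet D :=
  mem_union_left _ (mem_filter.2 ⟨mem_univ _, par_dir i, hD.dir_notMem_nbhd i⟩)

theorem IsSparse.card_freeSet (hd : 0 < d) {D : Finset (Cube d)} (hD : IsSparse D) :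
    2 ^ (d - 1) + #D ≤ #(freeSet D) + d * #D := by
  have h1 : #(nbhd D) ≤ d * #D := by
    have : nbhd D ⊆ (univ ×ˢ D).image fun p : Fin d × Cube d => p.2 + dir p.1 := by
      intro x hx
      obtain ⟨i, hi⟩ := mem_nbhd.1 hx
      exact mem_image.2 ⟨(i, x + dir i), mem_product.2 ⟨mem_univ _, hi⟩, add_dir_add_dir x i⟩
    refine (card_le_card this).trans (card_image_le.trans ?_)
    simp
  have h2 : #(freeSet D) = #{x : Cube d | par x = 1 ∧ x ∉ nbhd D} + #D := by
    refine card_union_of_disjoint (disjoint_left.2 fun x hx hxD => ?_)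
    have := (mem_filter.1 hx).2.1
    rw [hD.even hxD] at this
    exact absurd this (by decide)
  have h3 : 2 ^ (d - 1) ≤ #{x : Cube d | par x = 1 ∧ x ∉ nbhd D} + #(nbhd D) := by
    rw [← card_par_eq hd 1]
    refine (card_le_card fun x hx => ?_).trans (card_union_le _ _)
    by_cases h : x ∈ nbhd D
    · exact mem_union_right _ h
    · exact mem_union_left _ (mem_filter.2 ⟨mem_univ _, (mem_filter.1 hx).2, h⟩)
  omega

/-- The subsets of `T` that split the neighbourhood of the origin. -/
def splitSubsets (T : Finset (Cube d)) : Finset (Finset (Cube d)) :=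
  T.powerset.filter fun S => ∃ i j, dir i ∈ S ∧ dir j ∉ S

theorem card_splitSubsets {T : Finset (Cube d)} (hT : ∀ i, dir i ∈ T) :
    2 ^ #T ≤ #(splitSubsets T) + 2 * 2 ^ (#T - d) := by
  set N : Finset (Cube d) := univ.image dir with hN
  have hNd : #N = d := by
    rw [hN, card_image_of_injective _ dir_injective, card_univ, Fintype.card_fin]
  have hNT : N ⊆ T := image_subset_iff.2 fun i _ => hT i
  rw [← card_powerset, ← card_filter_add_card_filter_not
    (s := T.powerset) fun S => ∃ i j, dir i ∈ S ∧ dir j ∉ S]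
  refine Nat.add_le_add_left ?_ _
  have hc : #((univ : Finset Bool) ×ˢ (T \ N).powerset) = 2 * 2 ^ (#T - d) := by
    rw [card_product, card_powerset, card_sdiff_of_subset hNT, hNd, card_univ, Fintype.card_bool]
  rw [← hc]
  refine card_le_card_of_injOn (fun S => (decide (N ⊆ S), S \ N)) (fun S hS => ?_)
    fun S hS S' hS' h => ?_
  · have := mem_powerset.1 (mem_filter.1 hS).1
    exact mem_product.2 ⟨mem_univ _, mem_powerset.2 (sdiff_subset_sdiff this le_rfl)⟩
  · have key : ∀ S, S ∈ T.powerset.filter (fun S => ¬ ∃ i j, dir i ∈ S ∧ dir j ∉ S) →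
        ∀ x ∈ N, (x ∈ S ↔ N ⊆ S) := by
      intro S hS x hx
      refine ⟨fun hxS y hy => ?_, fun h => h hx⟩
      obtain ⟨i, -, rfl⟩ := mem_image.1 hx
      obtain ⟨j, -, rfl⟩ := mem_image.1 hy
      by_contra hyS
      exact (mem_filter.1 hS).2 ⟨i, j, hxS, hyS⟩
    obtain ⟨h1, h2⟩ := Prod.mk.inj h
    rw [decide_eq_decide] at h1
    ext x
    by_cases hx : x ∈ N
    · rw [key S hS x hx, key S' hS' x hx, h1]
    · have := congrArg (x ∈ ·) h2
      simpa [hx] using this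

theorem excursion_dir {D : Finset (Cube d)} (hD : IsSparse D) (S : Finset (Cube d)) (i : Fin d) :
    excursion D S (dir i) = 1 ∧ dir i ∈ S ∨ excursion D S (dir i) = -1 ∧ dir i ∉ S := by
  rw [excursion, if_neg (by rw [par_dir]; decide), if_neg (hD.dir_notMem_nbhd i)]
  by_cases h : dir i ∈ S <;> simp [h]

theorem excursion_dir_add_dir {D : Finset (Cube d)} (hD : IsSparse D) (S : Finset (Cube d))
    (i j : Fin d) : excursion D S (dir i + dir j) = 0 := by
  rw [excursion, if_pos (by rw [par_add_dir, par_dir]; rfl), if_neg]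
  exact fun h => (mem_sdiff.1 (hD.1 h)).2 (dir_add_dir_mem_twoStep i j)

/-- Translation of a homomorphism by `dir i`, normalised again at the origin. -/
def shiftHom (i : Fin d) (f : Cube d → ℤ) (v : Cube d) : ℤ := f (v + dir i) - f (dir i)

theorem shiftHom_mem_cubeHom (i : Fin d) {f : Cube d → ℤ} (hf : f ∈ cubeHom d) :
    shiftHom i f ∈ cubeHom d := by
  refine ⟨by simp [shiftHom], fun v j => ?_⟩
  have := hf.2 (v + dir i) j
  rw [shiftHom, shiftHom, sub_sub_sub_cancel_right, add_right_comm]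
  exact this

theorem injOn_shiftHom (i : Fin d) : Set.InjOn (shiftHom i) (cubeHom d) := by
  intro f hf g hg h
  have h0 := congrFun h (dir i)
  simp only [shiftHom, cube_add_self, hf.1, hg.1, zero_sub, neg_inj] at h0
  funext v
  have := congrFun h (v + dir i)
  simpa only [shiftHom, add_dir_add_dir, h0, sub_left_inj] using this

open Classical in
/-- The sparse sets of at most `d` elements. -/
noncomputable def smallSparse (d : ℕ) : Finset (Finset (Cube d)) :=
  univ.filter fun D => IsSparse D ∧ #D ≤ d

theorem mem_smallSparse {D : Finset (Cube d)} : D ∈ smallSparse d ↔ IsSparse D ∧ #D ≤ d := by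
  simp [smallSparse]

theorem injOn_excursion : Set.InjOn (fun p : (_ : Finset (Cube d)) × Finset (Cube d) =>
    excursion p.1 p.2) ((smallSparse d).sigma fun D => splitSubsets (freeSet D)) := by
  rintro ⟨D, S⟩ hp ⟨D', S'⟩ hp' h
  obtain ⟨hD, hS⟩ := mem_sigma.1 hp
  obtain ⟨hD', hS'⟩ := mem_sigma.1 hp'
  replace hD := (mem_smallSparse.1 hD).1
  replace hD' := (mem_smallSparse.1 hD').1
  replace hS := mem_powerset.1 (mem_filter.1 hS).1
  replace hS' := mem_powerset.1 (mem_filter.1 hS').1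
  dsimp only at hD hD' hS hS' h
  obtain rfl : D = D' := by
    ext x
    rw [hD.mem_iff_excursion S, hD'.mem_iff_excursion S', h]
  obtain rfl : S = S' := by
    ext x
    by_cases hx : x ∈ freeSet D
    · rw [hD.mem_iff_excursion_pos S hx, hD.mem_iff_excursion_pos S' hx, h]
    · exact iff_of_false (fun h => hx (hS h)) fun h => hx (hS' h)
  rfl

theorem two_mul_sum_card_splitSubsets_le (hd : 0 < d) :
    2 * ∑ D ∈ smallSparse d, #(splitSubsets (freeSet D)) ≤ (cubeHom d).ncard := by
  let i₀ : Fin d := ⟨0, hd⟩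
  rw [← card_sigma]
  set X := (smallSparse d).sigma fun D => splitSubsets (freeSet D) with hX
  let F := fun p : (_ : Finset (Cube d)) × Finset (Cube d) => excursion p.1 p.2
  have hsparse : ∀ p ∈ X, IsSparse p.1 := fun p hp => (mem_smallSparse.1 (mem_sigma.1 hp).1).1
  have hF : F '' X ⊆ cubeHom d := by
    rintro _ ⟨p, hp, rfl⟩
    exact excursion_mem_cubeHom hd (hsparse p hp)
  have hT : shiftHom i₀ '' (F '' X) ⊆ cubeHom d := by
    rintro _ ⟨f, hf, rfl⟩
    exact shiftHom_mem_cubeHom _ (hF hf)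
  have h1 : (F '' X).ncard = #X := by
    rw [injOn_excursion.ncard_image, Set.ncard_coe_finset]
  have h2 : (shiftHom i₀ '' (F '' X)).ncard = #X := by
    rw [((injOn_shiftHom i₀).mono hF).ncard_image, h1]
  have hdisj : Disjoint (F '' X) (shiftHom i₀ '' (F '' X)) := by
    rw [Set.disjoint_left]
    rintro _ ⟨p, hp, rfl⟩ ⟨_, ⟨q, hq, rfl⟩, h⟩
    obtain ⟨i, j, hi, hj⟩ := (mem_filter.1 (mem_sigma.1 hp).2).2
    have hk : ∀ k, F p (dir k) = - F q (dir i₀) := fun k => by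
      have h0 : F q (dir k + dir i₀) = 0 := excursion_dir_add_dir (hsparse q hq) _ _ _
      rw [← h, shiftHom, h0, zero_sub]
    have hij := (hk i).trans (hk j).symm
    rcases excursion_dir (hsparse p hp) p.2 i with h3 | h3
    · rcases excursion_dir (hsparse p hp) p.2 j with h4 | h4
      · exact hj h4.2
      · have := h3.1.symm.trans (hij.trans h4.1)
        exact absurd this (by decide)
    · exact h3.2 hi
  rw [two_mul]
  nth_rewrite 1 [← h1]
  rw [← h2, ← Set.ncard_union_eq hdisj (finite_cubeHom.subset hF) (finite_cubeHom.subset hT)]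
  exact Set.ncard_le_ncard (Set.union_subset hF hT) finite_cubeHom

open Classical in
/-- The number of sparse sets with `k` elements. -/
noncomputable def numSparse (d k : ℕ) : ℝ :=
  ∑ D ∈ powersetCard k (evens d \ twoStep d), if IsSparse D then 1 else 0

theorem numSparse_zero : numSparse d 0 = 1 := by
  have : IsSparse (∅ : Finset (Cube d)) := ⟨empty_subset _, fun v hv => absurd hv (notMem_empty v)⟩
  rw [numSparse, powersetCard_zero, sum_singleton, if_pos this]

theorem numSparse_nonneg (k : ℕ) : 0 ≤ numSparse d k :=
  sum_nonneg fun _ _ => by split_ifs <;> norm_num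

theorem IsSparse.insert {D : Finset (Cube d)} (hD : IsSparse D) {v : Cube d}
    (hv : v ∈ evens d \ twoStep d) (hn : ¬ (nearby D v).Nonempty) : IsSparse (insert v D) := by
  rw [not_nonempty_iff_eq_empty, eq_empty_iff_forall_notMem] at hn
  refine ⟨insert_subset hv hD.1, fun w hw i j h => ?_⟩
  rcases mem_insert.1 hw with rfl | hw
  · rcases mem_insert.1 h with h | h
    · exact h
    · exact absurd (mem_filter.2 ⟨h, i, j, rfl⟩) (hn _)
  · rcases mem_insert.1 h with h | h
    · exact absurd (mem_filter.2 ⟨hw, j, i, by rw [← h, add_dir_add_dir, add_dir_add_dir]⟩) (hn w)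
    · exact hD.2 w hw i j h

theorem mul_numSparse_le (hd : 0 < d) {k : ℕ} :
    ((2:ℝ) ^ (d - 1) - (d ^ 2 + k + k * d ^ 2)) * numSparse d k ≤
      (k + 1) * numSparse d (k + 1) := by
  classical
  rw [numSparse, numSparse, sum_powersetCard_succ, mul_sum]
  refine sum_le_sum fun D hD => ?_
  by_cases hs : IsSparse D
  · rw [if_pos hs, mul_one, ← natCast_card_filter]
    have h1 : (evens d \ twoStep d) \ D ⊆ {v ∈ (evens d \ twoStep d) \ D | IsSparse (insert v D)} ∪
        ({v | (nearby D v).Nonempty} : Finset (Cube d)) := by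
      intro v hv
      by_cases hn : (nearby D v).Nonempty
      · exact mem_union_right _ (mem_filter.2 ⟨mem_univ _, hn⟩)
      · exact mem_union_left _ (mem_filter.2 ⟨hv, hs.insert (mem_sdiff.1 hv).1 hn⟩)
    have h2 := (card_le_card h1).trans (card_union_le _ _)
    have h3 := card_nearby_nonempty_le D
    have h4 : #(evens d) = 2 ^ (d - 1) := card_par_eq hd 0
    have h5 : #(evens d) ≤ #(evens d \ twoStep d) + #(twoStep d) := by
      have := le_card_sdiff (twoStep d) (evens d)
      omega
    have h6 : #(evens d \ twoStep d) ≤ #((evens d \ twoStep d) \ D) + #D := by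
      have := le_card_sdiff D (evens d \ twoStep d)
      omega
    have h7 := card_twoStep_le (d := d)
    rw [(mem_powersetCard.1 hD).2] at h3 h6
    have h8 : 2 ^ (d - 1) ≤ #{v ∈ (evens d \ twoStep d) \ D | IsSparse (insert v D)} +
        (d ^ 2 + k + k * d ^ 2) := by omega
    have h9 : (2:ℝ) ^ (d - 1) ≤ #{v ∈ (evens d \ twoStep d) \ D | IsSparse (insert v D)} +
        (d ^ 2 + k + k * d ^ 2) := by exact_mod_cast h8
    linarith
  · rw [if_neg hs, mul_zero]
    exact sum_nonneg fun _ _ => by split_ifs <;> norm_num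

theorem pow_div_factorial_le_numSparse (hd : 0 < d) {δ : ℝ}
    (hδ : (2 * d ^ 2 + d ^ 3 : ℝ) ≤ δ * 2 ^ (d - 1)) (hδ1 : δ ≤ 1) :
    ∀ k ≤ d, (2 ^ (d - 1)) ^ k * ((1 - δ) ^ k / k.factorial) ≤ numSparse d k := by
  intro k
  induction k with
  | zero => simp [numSparse_zero]
  | succ k ih =>
    intro hk
    have h1 := ih (by omega)
    have h2 := mul_numSparse_le hd (k := k)
    have hd1 : (1:ℝ) ≤ d := by exact_mod_cast hd
    have hkd : (k:ℝ) ≤ d := by exact_mod_cast (by omega : k ≤ d)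
    have h3 : (d ^ 2 + k + k * d ^ 2 : ℝ) ≤ 2 * d ^ 2 + d ^ 3 := by
      nlinarith [mul_le_mul_of_nonneg_right hkd (sq_nonneg (d:ℝ))]
    have h4 : (1 - δ) * 2 ^ (d - 1) * numSparse d k ≤ (k + 1) * numSparse d (k + 1) :=
      (mul_le_mul_of_nonneg_right (by linarith) (numSparse_nonneg k)).trans h2
    have h5 : 0 ≤ (1 - δ) * 2 ^ (d - 1) := mul_nonneg (by linarith) (by positivity)
    have h6 := (mul_le_mul_of_nonneg_left h1 h5).trans h4
    have hk1 : (0:ℝ) < k + 1 := by positivity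
    rw [← mul_le_mul_iff_right₀ hk1]
    refine le_trans (le_of_eq ?_) h6
    rw [Nat.factorial_succ]
    push_cast
    field_simp
    ring

theorem le_card_splitSubsets_freeSet (hd : 0 < d) {D : Finset (Cube d)} (hD : IsSparse D) :
    (2:ℝ) ^ 2 ^ (d - 1) * ((1 - 2 / 2 ^ d) * (1 / 2 ^ (d - 1)) ^ #D) ≤
      #(splitSubsets (freeSet D)) := by
  have h1 : ((2:ℝ) ^ #(freeSet D)) ≤ #(splitSubsets (freeSet D)) + 2 * 2 ^ (#(freeSet D) - d) := by
    exact_mod_cast card_splitSubsets hD.dir_mem_freeSet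
  have h2 : d ≤ #(freeSet D) := by
    have : #(univ.image (dir : Fin d → Cube d)) = d := by
      rw [card_image_of_injective _ dir_injective, card_univ, Fintype.card_fin]
    exact this.ge.trans (card_le_card (image_subset_iff.2 fun i _ => hD.dir_mem_freeSet i))
  have h3 : (2:ℝ) ^ #(freeSet D) = 2 ^ (#(freeSet D) - d) * 2 ^ d := by
    rw [← pow_add, Nat.sub_add_cancel h2]
  have h4 : (2:ℝ) ^ #(freeSet D) * (1 - 2 / 2 ^ d) ≤ #(splitSubsets (freeSet D)) := by
    rw [mul_sub, mul_one, mul_div_assoc', div_eq_mul_inv, h3]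
    rw [h3] at h1
    have : (2:ℝ) ^ (#(freeSet D) - d) * 2 ^ d * 2 * (2 ^ d)⁻¹ = 2 * 2 ^ (#(freeSet D) - d) := by
      field_simp
    rw [this]
    linarith
  refine le_trans ?_ h4
  rw [← mul_assoc, mul_right_comm]
  have h5 : (0:ℝ) ≤ 1 - 2 / 2 ^ d := by
    rw [sub_nonneg, div_le_one (by positivity)]
    exact le_self_pow₀ one_le_two hd.ne'
  refine mul_le_mul_of_nonneg_right ?_ h5
  rw [one_div, inv_pow, ← pow_mul, ← div_eq_mul_inv, div_le_iff₀ (by positivity), ← pow_add]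
  refine pow_le_pow_right₀ one_le_two ?_
  have h6 := hD.card_freeSet hd
  obtain ⟨e, rfl⟩ : ∃ e, d = e + 1 := ⟨d - 1, by omega⟩
  rw [add_mul, one_mul] at h6
  simp only [add_tsub_cancel_right] at h6 ⊢
  omega

theorem le_ncard_cubeHom (hd : 0 < d) {δ : ℝ}
    (hδ : (2 * d ^ 2 + d ^ 3 : ℝ) ≤ δ * 2 ^ (d - 1)) (hδ1 : δ ≤ 1) :
    2 * (2:ℝ) ^ 2 ^ (d - 1) * (1 - 2 / 2 ^ d) *
      ∑ k ∈ range (d + 1), (1 - δ) ^ k / k.factorial ≤ (cubeHom d).ncard := by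
  classical
  have h1 : (2 * ∑ D ∈ smallSparse d, #(splitSubsets (freeSet D)) : ℝ) ≤ (cubeHom d).ncard := by
    exact_mod_cast two_mul_sum_card_splitSubsets_le hd
  refine le_trans ?_ h1
  rw [Nat.cast_sum, mul_assoc, mul_assoc]
  refine mul_le_mul_of_nonneg_left ?_ zero_le_two
  have h5 : (0:ℝ) ≤ 1 - 2 / 2 ^ d := by
    rw [sub_nonneg, div_le_one (by positivity)]
    exact le_self_pow₀ one_le_two hd.ne'
  have h2 : ∀ D ∈ smallSparse d, (2:ℝ) ^ 2 ^ (d - 1) * ((1 - 2 / 2 ^ d) *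
      (1 / 2 ^ (d - 1)) ^ #D) ≤ #(splitSubsets (freeSet D)) := fun D hD =>
    le_card_splitSubsets_freeSet hd (mem_smallSparse.1 hD).1
  refine le_trans ?_ (sum_le_sum h2)
  rw [← mul_sum, ← mul_sum]
  refine mul_le_mul_of_nonneg_left (mul_le_mul_of_nonneg_left ?_ h5) (by positivity)
  rw [← sum_fiberwise_of_maps_to (s := smallSparse d) (t := range (d + 1)) (g := card)
    fun D hD => mem_range.2 (Nat.lt_succ_of_le (mem_smallSparse.1 hD).2)]
  refine sum_le_sum fun k hk => ?_
  have hkd : k ≤ d := Nat.le_of_lt_succ (mem_range.1 hk)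
  have h6 : ∑ D ∈ smallSparse d with #D = k, ((1:ℝ) / 2 ^ (d - 1)) ^ #D =
      numSparse d k * (1 / 2 ^ (d - 1)) ^ k := by
    rw [sum_congr rfl fun D hD => by rw [(mem_filter.1 hD).2], sum_const, nsmul_eq_mul, numSparse,
      ← natCast_card_filter]
    congr 3
    ext D
    simp only [smallSparse, mem_filter, mem_univ, true_and, mem_powersetCard]
    constructor
    · rintro ⟨⟨h, -⟩, h'⟩
      exact ⟨⟨h.1, h'⟩, h⟩
    · rintro ⟨⟨-, h'⟩, h⟩
      exact ⟨⟨h, h' ▸ hkd⟩, h'⟩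
  rw [h6]
  have h7 := mul_le_mul_of_nonneg_right (pow_div_factorial_le_numSparse hd hδ hδ1 k hkd)
    (show (0:ℝ) ≤ (1 / 2 ^ (d - 1)) ^ k by positivity)
  refine le_trans (le_of_eq ?_) h7
  rw [one_div, inv_pow]
  field_simp

end

section

open Finset

open Filter in
theorem eventually_mul_pow_le_exp (C : ℝ) (k : ℕ) {b : ℝ} (hb : 0 < b) :
    ∀ᶠ d : ℕ in atTop, C * (d:ℝ) ^ k ≤ Real.exp (b * d) := by
  have h := (isLittleO_pow_exp_pos_mul_atTop k hb).comp_tendsto tendsto_natCast_atTop_atTop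
  have h1 := h.bound (show (0:ℝ) < 1 / (|C| + 1) by positivity)
  filter_upwards [h1] with d hd
  simp only [Function.comp_apply, Real.norm_eq_abs, Real.abs_exp] at hd
  rw [abs_of_nonneg (by positivity), one_div, inv_mul_eq_div, le_div_iff₀ (by positivity)] at hd
  refine le_trans ?_ hd
  rw [mul_comm]
  exact mul_le_mul_of_nonneg_left (by linarith [le_abs_self C]) (by positivity)

theorem two_pow_le_factorial_succ (d : ℕ) : 2 ^ d ≤ (d + 1).factorial := by
  induction d with
  | zero => simp
  | succ d ih =>
    rw [Nat.factorial_succ, pow_succ, mul_comm]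
    exact Nat.mul_le_mul (by omega) ih

variable {d : ℕ}

theorem ncard_cubeHom_le (hd : 1000 ≤ d) {δ : ℝ}
    (hd1 : 2 * 2000 * Real.exp (2000 / Real.exp (-20000)) ≤ d)
    (hd2 : 400 * Real.exp 1000 ^ 2 ≤ d)
    (H : 4 * d * (2:ℝ) ^ ((d:ℝ) / 40) ≤ 2 ^ ((d:ℝ) / 4))
    (H2 : 400 * (2:ℝ) ^ ((d:ℝ) / 20) + 2 * d ≤ 2 ^ ((d:ℝ) / 10) / d ^ 2)
    (H3 : 4 * d * Real.exp 1000 ≤ 2 ^ ((d:ℝ) / 4))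
    (H5 : (d:ℝ) ^ 2 * Real.exp (d / 4) ≤ 2 ^ d)
    (hδ : (d:ℝ) ^ 3 * 2 ^ ((d:ℝ) / 4) / 2 ^ d ≤ δ) :
    ((cubeHom d).ncard : ℝ) ≤ 2 ^ 2 ^ (d - 1) *
      (2 * Real.exp (1 + δ) + 2 * Real.exp (-d) + Real.exp (-(2 * d))) := by
  classical
  have h1 : (3 * (cubeHom d).ncard : ℝ) ≤ #{χ : Cube d → ZMod 3 | IsProper χ} := by
    exact_mod_cast three_mul_ncard_cubeHom_le
  have h2 : (#{χ : Cube d → ZMod 3 | IsProper χ} : ℝ) ≤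
      2 * #{χ : Cube d → ZMod 3 | IsProper χ ∧ 2000 * (2:ℝ) ^ d / d ≤ (energy χ : ℝ)} +
      6 * #{χ : Cube d → ZMod 3 | IsNearlyZero χ} := by
    exact_mod_cast card_proper_le (by omega) hd1
  have h3 : (2:ℝ) ^ ((d:ℝ) / 10) ≤ 2 ^ d := by
    rw [← Real.rpow_natCast]
    exact Real.rpow_le_rpow_of_exponent_le one_le_two (by linarith [Nat.cast_nonneg (α := ℝ) d])
  have h4 := card_large_energy_le (by omega) H (H2.trans (by gcongr))
  have h5 := card_isNearlyZero_le hd H H2 H3 hd2 H5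
  have h6 := card_few_defects_le (d := d) (by omega) hδ
  have h7 : (0:ℝ) ≤ 2 ^ 2 ^ (d - 1) * Real.exp (-(2 * d)) := by positivity
  linarith

theorem sum_pow_div_factorial_ge {δ : ℝ} (hδ0 : 0 ≤ δ) (hδ1 : δ ≤ 1) (hδ : 2 / 2 ^ d ≤ δ) :
    Real.exp (1 - δ) - δ ≤ ∑ k ∈ range (d + 1), (1 - δ) ^ k / k.factorial := by
  have habs : |1 - δ| ≤ 1 := by rw [abs_of_nonneg (by linarith)]; linarith
  have h := (abs_le.1 (Real.exp_bound habs (Nat.succ_pos d))).2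
  have h1 : |1 - δ| ^ (d + 1) * (((d + 1).succ : ℕ) / ((d + 1).factorial * (d + 1 : ℕ)) : ℝ) ≤ δ := by
    have h2 : (2:ℝ) ^ d ≤ (d + 1).factorial := by exact_mod_cast two_pow_le_factorial_succ d
    have h3 : (((d + 1).succ : ℕ) / ((d + 1).factorial * (d + 1 : ℕ)) : ℝ) ≤ 2 / 2 ^ d := by
      rw [div_le_div_iff₀ (by positivity) (by positivity)]
      push_cast
      have hd : (0:ℝ) ≤ d := Nat.cast_nonneg d
      nlinarith [mul_le_mul_of_nonneg_right h2 hd]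
    refine le_trans (mul_le_of_le_one_left (by positivity) (pow_le_one₀ (abs_nonneg _) habs)) ?_
    exact h3.trans hδ
  exact sub_le_comm.1 (h.trans h1)

theorem abs_ncard_cubeHom_sub_le (hd : 1000 ≤ d) {δ : ℝ} (hδ0 : 0 ≤ δ) (hδ1 : δ ≤ 1)
    (hd1 : 2 * 2000 * Real.exp (2000 / Real.exp (-20000)) ≤ d)
    (hd2 : 400 * Real.exp 1000 ^ 2 ≤ d)
    (H : 4 * d * (2:ℝ) ^ ((d:ℝ) / 40) ≤ 2 ^ ((d:ℝ) / 4))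
    (H2 : 400 * (2:ℝ) ^ ((d:ℝ) / 20) + 2 * d ≤ 2 ^ ((d:ℝ) / 10) / d ^ 2)
    (H3 : 4 * d * Real.exp 1000 ≤ 2 ^ ((d:ℝ) / 4))
    (H5 : (d:ℝ) ^ 2 * Real.exp (d / 4) ≤ 2 ^ d)
    (hδ : (d:ℝ) ^ 3 * 2 ^ ((d:ℝ) / 4) / 2 ^ d ≤ δ)
    (hδ' : (2 * d ^ 2 + d ^ 3 : ℝ) ≤ δ * 2 ^ (d - 1)) (hδe : Real.exp (-d) ≤ δ) :
    |((cubeHom d).ncard : ℝ) - 2 * Real.exp 1 * 2 ^ 2 ^ (d - 1)| ≤ 15 * δ * 2 ^ 2 ^ (d - 1) := by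
  have he := Real.exp_one_lt_d9
  have he0 := Real.exp_pos 1
  have hM : (0:ℝ) < 2 ^ 2 ^ (d - 1) := by positivity
  rw [abs_le]
  constructor
  · have h2d : (2:ℝ) / 2 ^ d ≤ δ := by
      have hd1 : (1:ℝ) ≤ d := by exact_mod_cast (by omega : 1 ≤ d)
      have h2 : (2:ℝ) ^ d = 2 * 2 ^ (d - 1) := by
        rw [← pow_succ', Nat.sub_add_cancel (by omega)]
      rw [div_le_iff₀ (by positivity), h2]
      nlinarith [one_le_pow₀ hd1 (n := 2), one_le_pow₀ hd1 (n := 3)]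
    have h1 := le_ncard_cubeHom (by omega) hδ' hδ1
    have h2 := sum_pow_div_factorial_ge hδ0 hδ1 h2d
    have h3 : Real.exp 1 * (1 - δ) ≤ Real.exp (1 - δ) := by
      rw [sub_eq_add_neg 1 δ, Real.exp_add]
      refine mul_le_mul_of_nonneg_left ?_ he0.le
      linarith [Real.add_one_le_exp (-δ)]
    set s := ∑ k ∈ range (d + 1), (1 - δ) ^ k / k.factorial with hs
    have hs0 : 0 ≤ s := sum_nonneg fun k _ =>
      div_nonneg (pow_nonneg (by linarith) _) (Nat.cast_nonneg _)
    have h4 : Real.exp 1 - 7 * δ ≤ (1 - 2 / 2 ^ d) * s := by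
      have h5 : (1 - δ) * s ≤ (1 - 2 / 2 ^ d) * s :=
        mul_le_mul_of_nonneg_right (by linarith) hs0
      have h6 : (1 - δ) * (Real.exp 1 * (1 - δ) - δ) ≤ (1 - δ) * s :=
        mul_le_mul_of_nonneg_left (by linarith) (by linarith)
      nlinarith [mul_nonneg he0.le (sq_nonneg δ), mul_nonneg hδ0 (sub_nonneg.2 he.le),
        sq_nonneg δ]
    have h7 := mul_le_mul_of_nonneg_left h4 hM.le
    nlinarith [mul_nonneg hM.le hδ0]
  · have h1 := ncard_cubeHom_le hd hd1 hd2 H H2 H3 H5 hδ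
    have h2 : Real.exp (1 + δ) ≤ Real.exp 1 + 2 * Real.exp 1 * δ := by
      rw [Real.exp_add]
      have := (abs_le.1 (Real.abs_exp_sub_one_le (x := δ) (by rwa [abs_of_nonneg hδ0]))).2
      rw [abs_of_nonneg hδ0] at this
      nlinarith
    have h3 : Real.exp (-(2 * d)) ≤ Real.exp (-d) :=
      Real.exp_le_exp.2 (by linarith [Nat.cast_nonneg (α := ℝ) d])
    have h4 : 2 * Real.exp (1 + δ) + 2 * Real.exp (-d) + Real.exp (-(2 * d)) ≤
        2 * Real.exp 1 + 15 * δ := by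
      nlinarith [mul_nonneg hδ0 (sub_nonneg.2 he.le)]
    have h5 := mul_le_mul_of_nonneg_left h4 hM.le
    linarith

theorem abs_ncard_cubeHom_sub_le_exp (hd : 1000 ≤ d)
    (hd1 : 2 * 2000 * Real.exp (2000 / Real.exp (-20000)) ≤ d)
    (hd2 : 400 * Real.exp 1000 ^ 2 ≤ d)
    (h : (1000 + 4 * Real.exp 1000) * (d:ℝ) ^ 3 ≤ Real.exp (1 / 100 * d)) :
    |((cubeHom d).ncard : ℝ) - 2 * Real.exp 1 * 2 ^ 2 ^ (d - 1)| ≤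
      Real.exp (-(1 / 10) * d) * 2 ^ 2 ^ (d - 1) := by
  have hdr : (1000:ℝ) ≤ d := by exact_mod_cast hd
  set y := Real.log 2 * d with hy
  have hy1 : 0.69 * (d:ℝ) ≤ y := by
    have := Real.log_two_gt_d9
    exact mul_le_mul_of_nonneg_right (by linarith) (by linarith)
  have hpow : (2:ℝ) ^ d = Real.exp y := by
    rw [← Real.rpow_natCast, Real.rpow_def_of_pos two_pos]
  have hrpow : ∀ c : ℝ, (2:ℝ) ^ ((d:ℝ) / c) = Real.exp (y / c) := fun c => by
    rw [Real.rpow_def_of_pos two_pos, mul_div_assoc]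
  have hpow' : (2:ℝ) ^ (d - 1) = Real.exp y / 2 := by
    rw [← hpow, eq_div_iff two_ne_zero, ← pow_succ, Nat.sub_add_cancel (by omega)]
  have hE := Real.exp_pos 1000
  have hd3 : (d:ℝ) ^ 2 ≤ d ^ 3 := pow_le_pow_right₀ (by linarith) (by norm_num)
  have hd31 : (d:ℝ) ≤ d ^ 3 := le_self_pow₀ (by linarith) (by norm_num)
  have hE3 : Real.exp 1000 * d ≤ Real.exp 1000 * d ^ 3 := mul_le_mul_of_nonneg_left hd31 hE.le
  have hE0 : 0 ≤ Real.exp 1000 * (d:ℝ) ^ 3 := by positivity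
  set w := Real.exp (1 / 100 * d) with hw
  have hmul : ∀ {p a b : ℝ}, p ≤ w → 1 / 100 * d + a ≤ b → p * Real.exp a ≤ Real.exp b :=
    fun {p a b} hp hab => by
      refine (mul_le_mul_of_nonneg_right hp (Real.exp_pos a).le).trans ?_
      rw [hw, ← Real.exp_add]
      exact Real.exp_le_exp.2 hab
  have hfin : 15 * Real.exp (-(d / 4)) ≤ Real.exp (-(1 / 10) * d) := hmul (by linarith) (by linarith)
  refine (abs_ncard_cubeHom_sub_le (δ := Real.exp (-(d / 4))) hd (Real.exp_pos _).le
    (Real.exp_le_one_iff.2 (by linarith)) hd1 hd2 ?_ ?_ ?_ ?_ ?_ ?_ ?_).trans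
    (mul_le_mul_of_nonneg_right hfin (by positivity))
  · rw [hrpow, hrpow]
    exact hmul (by linarith) (by linarith)
  · rw [hrpow, hrpow, le_div_iff₀ (by positivity)]
    have h1 : 1 ≤ Real.exp (y / 20) := Real.one_le_exp (by linarith)
    have h2 : w * Real.exp (y / 20) ≤ Real.exp (y / 10) := hmul le_rfl (by linarith)
    have h3 : w ≤ w * Real.exp (y / 20) := le_mul_of_one_le_right (Real.exp_pos _).le h1
    have h4 : 400 * (d:ℝ) ^ 2 * Real.exp (y / 20) ≤ w / 2 * Real.exp (y / 20) :=
      mul_le_mul_of_nonneg_right (by linarith) (Real.exp_pos _).le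
    have h5 : 2 * (d:ℝ) ^ 3 ≤ w / 2 := by linarith
    nlinarith
  · rw [hrpow]
    have h1 : 4 * d * Real.exp 1000 ≤ w := by linarith
    have := hmul h1 (a := 0) (b := y / 4) (by linarith)
    rwa [Real.exp_zero, mul_one] at this
  · rw [hpow]
    exact hmul (by linarith) (by linarith)
  · rw [hrpow, hpow, div_le_iff₀ (Real.exp_pos _), ← Real.exp_add]
    exact hmul (by linarith) (by linarith)
  · rw [hpow', mul_div_assoc', ← Real.exp_add]
    have := hmul (p := 2 * (2 * d ^ 2 + d ^ 3)) (a := 0) (b := -(d / 4) + y) (by linarith)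
      (by linarith)
    rw [Real.exp_zero] at this
    linarith
  · exact Real.exp_le_exp.2 (by linarith)

end

theorem count_homF :
    ∃ c > (0:ℝ), ∃ d₀ : ℕ, ∀ d : ℕ, d₀ ≤ d →
      |((HomF d).ncard : ℝ) - 2 * Real.exp 1 * 2 ^ 2 ^ (d - 1)| ≤
        Real.exp (-c * d) * 2 ^ 2 ^ (d - 1) := by
  refine ⟨1 / 10, by norm_num, Filter.eventually_atTop.1 ?_⟩
  filter_upwards [Filter.eventually_ge_atTop 1000,
    tendsto_natCast_atTop_atTop.eventually_ge_atTop
      (2 * 2000 * Real.exp (2000 / Real.exp (-20000))),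
    tendsto_natCast_atTop_atTop.eventually_ge_atTop (400 * Real.exp 1000 ^ 2),
    eventually_mul_pow_le_exp (1000 + 4 * Real.exp 1000) 3 (b := 1 / 100) (by norm_num)]
    with d hd hd1 hd2 h
  rw [ncard_homF]
  exact abs_ncard_cubeHom_sub_le_exp hd hd1 hd2 h
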